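/- For every integer n ≥ 2 and every real C > 0, there exists M such that for all integers m ≥ M, every non-homotopic drawing in the plane with n vertices and m edges has crossing number at least C·m². (That is, for fixed n the minimum crossing number of a non-homotopic multigraph with n vertices and m edges is super-quadratic in m.) -/

import Mathlib

open unitInterval ENNReal

/-- A drawing in the plane with `n` vertices and `m` edges: a finite set `V ⊆ ℂ` of
`n` vertices together with continuous curves `f e : [0,1] → ℂ` whose endpoints are
vertices and whose interiors avoid the vertices. -/
structure PlaneDrawing (n m : ℕ) where
  V : Set ℂ
  finV : V.Finite
  cardV : V.ncard = n
  f : Fin m → I → ℂ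
  cont : ∀ e, Continuous (f e)
  source_mem : ∀ e, f e 0 ∈ V
  target_mem : ∀ e, f e 1 ∈ V
  interior_not_mem : ∀ e, ∀ t : I, t ≠ 0 → t ≠ 1 → f e t ∉ V

/-- Homotopy between two curves, fixing the endpoints of the first, with interior
avoiding the vertex set `V`. -/
def HomotopicIn (V : Set ℂ) (a b : I → ℂ) : Prop :=
  ∃ g : I × I → ℂ, Continuous g ∧
    (∀ t, g (0, t) = a t) ∧ (∀ t, g (1, t) = b t) ∧
    (∀ s, g (s, 0) = a 0) ∧ (∀ s, g (s, 1) = a 1) ∧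
    (∀ s t : I, s ≠ 0 → s ≠ 1 → t ≠ 0 → t ≠ 1 → g (s, t) ∉ V)

/-- Two edges are homotopic if one is homotopic to the other or to its reversal. -/
def EdgeHomotopic (V : Set ℂ) (a b : I → ℂ) : Prop :=
  HomotopicIn V a b ∨ HomotopicIn V (fun t => a (σ t)) b

/-- An edge is a trivial loop if it is homotopic to the constant map at its endpoint. -/
def IsTrivialLoop (V : Set ℂ) (a : I → ℂ) : Prop :=
  EdgeHomotopic V a fun _ => a 0

/-- A drawing is non-homotopic if no two distinct edges are homotopic and
no edge is a trivial loop. -/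
def PlaneDrawing.NonHomotopic {n m : ℕ} (D : PlaneDrawing n m) : Prop :=
  (∀ e e' : Fin m, e ≠ e' → ¬ EdgeHomotopic D.V (D.f e) (D.f e')) ∧
  (∀ e : Fin m, ¬ IsTrivialLoop D.V (D.f e))

/-- The crossing number: half the cardinality of the set of ordered crossings. -/
noncomputable def PlaneDrawing.crossingNumber {n m : ℕ} (D : PlaneDrawing n m) : ℝ≥0∞ :=
  (({p : (Fin m × I) × (Fin m × I) |
      p.1 ≠ p.2 ∧ p.1.2 ≠ 0 ∧ p.1.2 ≠ 1 ∧ p.2.2 ≠ 0 ∧ p.2.2 ≠ 1 ∧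
      D.f p.1.1 p.1.2 = D.f p.2.1 p.2.2}).encard : ℝ≥0∞) / 2

theorem exists_pos_forall_le_norm_sub {K T : Set ℂ} (hK : IsCompact K) (hT : IsClosed T)
    (h : Disjoint K T) : ∃ r > 0, ∀ x ∈ K, ∀ y ∈ T, r ≤ ‖y - x‖ := by
  obtain ⟨r, hr, h'⟩ := hK.exists_thickening_subset_open hT.isOpen_compl
    (Set.subset_compl_iff_disjoint_right.2 h)
  refine ⟨r, hr, fun x hx y hy => ?_⟩
  by_contra hlt
  refine h' (Metric.mem_thickening_iff.2 ⟨x, hx, ?_⟩) hy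
  rw [dist_eq_norm]
  exact not_le.1 hlt

/-- The part of a planar map pushing points off the slit `[0,1]` horizontally. -/
noncomputable def slitPush (M e c : ℝ) (z : ℂ) : ℂ :=
  ⟨max z.re (min (M * (1 - |z.im| / e)) (c * z.re)), z.im⟩

theorem continuous_slitPush (M e c : ℝ) : Continuous (slitPush M e c) := by
  have h : slitPush M e c = fun z : ℂ =>
      ((max z.re (min (M * (1 - |z.im| / e)) (c * z.re)) : ℝ) : ℂ) + z.im * Complex.I := by
    ext z
    apply Complex.ext <;> simp [slitPush]
  rw [h]
  fun_prop

theorem exists_push_off_slit {T K L : Set ℂ} (hT : IsClosed T) (h0 : (0 : ℂ) ∈ T)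
    (hseg : ∀ t : ℝ, 0 < t → t ≤ 1 → (t : ℂ) ∉ T)
    (hK : IsCompact K) (hKT : Disjoint K T)
    (hL : IsCompact L) (hLK : L ⊆ K) (hLs : ∀ t : ℝ, 0 ≤ t → t ≤ 1 → (t : ℂ) ∉ L) :
    ∃ H : ℂ → ℂ, Continuous H ∧ (∀ z ∈ L, H z = z) ∧
      ∀ z ∈ K, H z ∉ T ∧ ∀ t : ℝ, 0 ≤ t → t ≤ 1 → H z ≠ t := by
  obtain ⟨ε, hε, hε2, hεK⟩ : ∃ ε > 0, ε ≤ 2 ∧ ∀ z ∈ K, ε ≤ ‖z‖ := by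
    obtain ⟨r, hr, h⟩ := exists_pos_forall_le_norm_sub (isCompact_singleton (x := (0 : ℂ)))
      hK.isClosed (by
        rw [Set.disjoint_singleton_left]
        exact fun h => hKT.le_bot ⟨h, h0⟩)
    exact ⟨min r 2, by positivity, min_le_right _ _,
      fun z hz => (min_le_left _ _).trans (by simpa using h 0 rfl z hz)⟩
  have hS : ∀ a : ℝ, IsCompact ((fun t : ℝ => (t : ℂ)) '' Set.Icc a 1) := fun a =>
    isCompact_Icc.image Complex.continuous_ofReal
  have hdT : Disjoint ((fun t : ℝ => (t : ℂ)) '' Set.Icc (ε / 2) 1) T := by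
    rw [Set.disjoint_left]
    rintro _ ⟨t, ht, rfl⟩
    exact hseg t (by have := ht.1; linarith) ht.2
  have hdL : Disjoint ((fun t : ℝ => (t : ℂ)) '' Set.Icc 0 1) L := by
    rw [Set.disjoint_left]
    rintro _ ⟨t, ht, rfl⟩
    exact hLs t ht.1 ht.2
  obtain ⟨r₁, hr₁, h₁⟩ := exists_pos_forall_le_norm_sub (hS (ε / 2)) hT hdT
  obtain ⟨r₂, hr₂, h₂⟩ := exists_pos_forall_le_norm_sub (hS 0) hL.isClosed hdL
  obtain ⟨e, he, he1, he2, he3⟩ : ∃ e > 0, 2 * e < r₁ ∧ 2 * e < r₂ ∧ e ≤ ε / 2 :=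
    ⟨min (min (r₁ / 3) (r₂ / 3)) (ε / 2), by positivity,
      by linarith [min_le_left (min (r₁ / 3) (r₂ / 3)) (ε / 2), min_le_left (r₁ / 3) (r₂ / 3)],
      by linarith [min_le_left (min (r₁ / 3) (r₂ / 3)) (ε / 2), min_le_right (r₁ / 3) (r₂ / 3)],
      min_le_right _ _⟩
  have hM : (0 : ℝ) < 1 + e := by linarith
  have hc : (1 + e) / (ε / 2) * (ε / 2) = 1 + e := by field_simp
  have hc0 : 0 < (1 + e) / (ε / 2) := by positivity
  set c := (1 + e) / (ε / 2) + 1 with hcdef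
  have hnear : ∀ X Y : ℝ, X ≤ 1 + e → |Y| < e → ∀ a, a ≤ X → a ≤ 1 →
      ∃ t ∈ Set.Icc a 1, ‖(⟨X, Y⟩ : ℂ) - (t : ℂ)‖ < 2 * e := by
    intro X Y hX hY a ha ha1
    refine ⟨min X 1, ⟨le_min ha ha1, min_le_right _ _⟩, ?_⟩
    refine (Complex.norm_le_abs_re_add_abs_im _).trans_lt ?_
    have h1 : |X - min X 1| ≤ e := by
      rcases le_total X 1 with h | h
      · simp [min_eq_left h, he.le]
      · rw [min_eq_right h, abs_of_nonneg] <;> linarith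
    simp only [Complex.sub_re, Complex.ofReal_re, Complex.sub_im, Complex.ofReal_im, sub_zero]
    linarith
  have hmoved : ∀ z : ℂ, ε ≤ ‖z‖ → slitPush (1 + e) e c z ≠ z →
      ε / 2 ≤ z.re ∧ |z.im| < e ∧ z.re ≤ (slitPush (1 + e) e c z).re ∧
        (slitPush (1 + e) e c z).re ≤ 1 + e := by
    intro z hz hne
    have hlt : z.re < min ((1 + e) * (1 - |z.im| / e)) (c * z.re) := by
      by_contra hle
      refine hne (Complex.ext ?_ rfl)
      exact max_eq_left (not_lt.1 hle)
    have hx : 0 < z.re := by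
      have := hlt.trans_le (min_le_right _ _)
      have h2 : 0 < (1 + e) / (ε / 2) * z.re := by rw [hcdef] at this; linarith
      exact pos_of_mul_pos_right h2 hc0.le
    have hy : |z.im| < e := by
      have := hx.trans (hlt.trans_le (min_le_left _ _))
      have h2 : 0 < 1 - |z.im| / e := pos_of_mul_pos_right this hM.le
      rwa [sub_pos, div_lt_one he] at h2
    refine ⟨?_, hy, le_max_left _ _, ?_⟩
    · have := Complex.norm_le_abs_re_add_abs_im z
      rw [abs_of_pos hx] at this
      linarith
    · have h3 : (1 + e) * (1 - |z.im| / e) ≤ 1 + e := by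
        have : 0 ≤ |z.im| / e := by positivity
        nlinarith
      exact max_le (hlt.le.trans ((min_le_left _ _).trans h3)) ((min_le_left _ _).trans h3)
  refine ⟨slitPush (1 + e) e c, continuous_slitPush _ _ _, ?_, ?_⟩
  · intro z hz
    by_contra hne
    obtain ⟨ha, hb, hc1, hd⟩ := hmoved z (hεK z (hLK hz)) hne
    obtain ⟨t, ht, hlt⟩ := hnear z.re z.im (hc1.trans hd) hb 0 (by linarith) zero_le_one
    exact absurd (h₂ _ ⟨t, ht, rfl⟩ z hz) (not_le.2 (hlt.trans he2))
  · intro z hz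
    constructor
    · by_cases hne : slitPush (1 + e) e c z = z
      · rw [hne]
        exact fun h => hKT.le_bot ⟨hz, h⟩
      · obtain ⟨ha, hb, hc1, hd⟩ := hmoved z (hεK z hz) hne
        intro hmem
        obtain ⟨t, ht, hlt⟩ := hnear _ _ hd hb (ε / 2) (ha.trans hc1) (by linarith)
        exact absurd (h₁ _ ⟨t, ht, rfl⟩ _ hmem) (not_le.2 (hlt.trans he1))
    · intro t ht0 ht1 heq
      have him : z.im = 0 := by simpa [slitPush] using congrArg Complex.im heq
      have hre : max z.re (min ((1 + e) * (1 - |z.im| / e)) (c * z.re)) = t := by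
        simpa [slitPush] using congrArg Complex.re heq
      rw [him] at hre
      simp only [abs_zero, zero_div, sub_zero, mul_one] at hre
      have hn : ε ≤ |z.re| := by
        have := Complex.norm_le_abs_re_add_abs_im z
        rw [him, abs_zero, add_zero] at this
        exact (hεK z hz).trans this
      rcases le_abs.1 hn with h | h
      · have h4 : 1 + e ≤ c * z.re := by
          rw [hcdef]
          nlinarith
        rw [min_eq_left h4] at hre
        have := le_max_right z.re (1 + e)
        linarith
      · have h4 : c * z.re ≤ z.re := by
          rw [hcdef]
          nlinarith
        rw [max_eq_left ((min_le_right _ _).trans h4)] at hre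
        linarith

theorem isSimplyConnected_compl_union_slit {T : Set ℂ} (hT : IsClosed T) (h0 : (0 : ℂ) ∈ T)
    (hseg : ∀ t : ℝ, 0 < t → t ≤ 1 → (t : ℂ) ∉ T) (hs : IsSimplyConnected Tᶜ) :
    IsSimplyConnected (T ∪ (fun t : ℝ => (t : ℂ)) '' Set.Icc 0 1)ᶜ := by
  rw [isSimplyConnected_iff_exists_homotopy_refl_forall_mem] at hs ⊢
  set T' := T ∪ (fun t : ℝ => (t : ℂ)) '' Set.Icc 0 1 with hT'
  have hsub : T'ᶜ ⊆ Tᶜ := Set.compl_subset_compl.2 Set.subset_union_left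
  have hnot : ∀ z ∈ T'ᶜ, ∀ t : ℝ, 0 ≤ t → t ≤ 1 → z ≠ t :=
    fun z hz t ht0 ht1 h => hz (Or.inr ⟨t, ⟨ht0, ht1⟩, h.symm⟩)
  have hmem : ∀ z, z ∉ T → (∀ t : ℝ, 0 ≤ t → t ≤ 1 → z ≠ t) → z ∈ T'ᶜ := by
    rintro z hz h (h' | ⟨t, ht, rfl⟩)
    · exact hz h'
    · exact h t ht.1 ht.2 rfl
  refine ⟨isPathConnected_iff.2 ⟨?_, ?_⟩, ?_⟩
  · obtain ⟨z, hz⟩ := hs.1.nonempty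
    obtain ⟨H, -, -, hH⟩ := exists_push_off_slit hT h0 hseg (isCompact_singleton (x := z))
      (Set.disjoint_singleton_left.2 hz) isCompact_empty (Set.empty_subset _) (by simp)
    exact ⟨H z, hmem _ (hH z rfl).1 (hH z rfl).2⟩
  · intro x hx y hy
    obtain ⟨γ, hγ⟩ := (isPathConnected_iff.1 hs.1).2 x (hsub hx) y (hsub hy)
    obtain ⟨H, hc, hfix, hH⟩ := exists_push_off_slit (K := Set.range γ) (L := {x, y}) hT h0 hseg
      (isCompact_range γ.continuous)
      (by rw [Set.disjoint_left]; rintro _ ⟨t, rfl⟩; exact hγ t)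
      (Set.toFinite _).isCompact
      (by
        rintro z (rfl | rfl)
        · exact ⟨0, γ.source⟩
        · exact ⟨1, γ.target⟩)
      (by
        rintro t h0 h1 (h | h)
        · exact hnot x hx t h0 h1 h.symm
        · exact hnot y hy t h0 h1 h.symm)
    refine ⟨(γ.map hc).cast (hfix x (by simp)).symm (hfix y (by simp)).symm, fun t => ?_⟩
    exact hmem _ (hH _ ⟨t, rfl⟩).1 (hH _ ⟨t, rfl⟩).2
  · intro x p hp
    obtain ⟨F, hF⟩ := hs.2 x p (fun t => hsub (hp t))
    obtain ⟨H, hc, hfix, hH⟩ := exists_push_off_slit (K := Set.range F) (L := Set.range p) hT h0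
      hseg (isCompact_range F.continuous)
      (by rw [Set.disjoint_left]; rintro _ ⟨t, rfl⟩; exact hF t)
      (isCompact_range p.continuous)
      (by
        rintro _ ⟨t, rfl⟩
        exact ⟨(0, t), by simp⟩)
      (by
        rintro t h0 h1 ⟨s, hs⟩
        exact hnot _ (hp s) t h0 h1 hs)
    have hx : H x = x := hfix x ⟨0, p.source⟩
    refine ⟨{ toFun := fun st => H (F st)
              continuous_toFun := hc.comp F.continuous
              map_zero_left := fun t => ?_
              map_one_left := fun t => ?_
              prop' := fun s t ht => ?_ }, fun t => ?_⟩
    · simpa using hfix _ ⟨t, rfl⟩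
    · simpa using hx
    · have := F.eq_fst s ht
      simp only [ContinuousMap.coe_mk] at this ⊢
      rw [this]
      exact hfix _ ⟨t, rfl⟩
    · exact hmem _ (hH _ ⟨t, rfl⟩).1 (hH _ ⟨t, rfl⟩).2

theorem isSimplyConnected_compl_union_segment {T : Set ℂ} {w l : ℂ} (hT : IsClosed T)
    (hw : w ∈ T) (hseg : ∀ z ∈ segment ℝ l w, z ≠ w → z ∉ T) (hs : IsSimplyConnected Tᶜ) :
    IsSimplyConnected (T ∪ segment ℝ l w)ᶜ := by
  rcases eq_or_ne l w with rfl | hlw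
  · simpa [Set.union_eq_left.2 (Set.singleton_subset_iff.2 hw)] using hs
  have hne : l - w ≠ 0 := sub_ne_zero.2 hlw
  let φ : ℂ ≃ₜ ℂ := (Homeomorph.mulLeft₀ (l - w) hne).trans (Homeomorph.addRight w)
  have hφ : ∀ z, φ z = (l - w) * z + w := fun z => rfl
  have hsegeq : φ ⁻¹' segment ℝ l w = (fun t : ℝ => (t : ℂ)) '' Set.Icc 0 1 := by
    ext z
    rw [Set.mem_preimage, segment_symm, segment_eq_image]
    constructor
    · rintro ⟨t, ht, h⟩
      refine ⟨t, ht, ?_⟩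
      rw [hφ] at h
      have : (l - w) * (z - t) = 0 := by
        simp only [Complex.real_smul, Complex.ofReal_sub, Complex.ofReal_one] at h
        linear_combination -h
      rcases mul_eq_zero.1 this with h' | h'
      · exact absurd h' hne
      · exact (sub_eq_zero.1 h').symm
    · rintro ⟨t, ht, rfl⟩
      refine ⟨t, ht, ?_⟩
      simp only [hφ, Complex.real_smul, Complex.ofReal_sub, Complex.ofReal_one]
      ring
  have key := isSimplyConnected_compl_union_slit (T := φ ⁻¹' T) (hT.preimage φ.continuous)
    (by simpa [hφ] using hw)
    (by
      intro t h0 h1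
      have hmem : φ t ∈ segment ℝ l w := by
        rw [← Set.mem_preimage, hsegeq]
        exact ⟨t, ⟨h0.le, h1⟩, rfl⟩
      refine hseg _ hmem ?_
      rw [hφ]
      simp [hne, h0.ne'])
    (by
      rw [← Set.preimage_compl]
      exact (φ.isSimplyConnected_preimage).2 hs)
  rw [← hsegeq, ← Set.preimage_union, ← Set.preimage_compl] at key
  exact (φ.isSimplyConnected_preimage).1 key

/-- The half-open segment from `a` (included) to `b` (excluded). -/
def hseg (a b : ℂ) : Set ℂ := segment ℝ a b \ {b}

/-- The horizontal ray going right from `ρ`. -/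
def rightRay (ρ : ℂ) : Set ℂ := {z | ∃ t : ℝ, 0 ≤ t ∧ z = ρ + t}

theorem left_mem_hseg {a b : ℂ} (h : a ≠ b) : a ∈ hseg a b := ⟨left_mem_segment ℝ a b, h⟩

theorem self_mem_rightRay (ρ : ℂ) : ρ ∈ rightRay ρ := ⟨0, le_rfl, by simp⟩

theorem mem_segment_iff_exists {a b z : ℂ} :
    z ∈ segment ℝ a b ↔ ∃ t : ℝ, 0 ≤ t ∧ t ≤ 1 ∧ z = a + t * (b - a) := by
  rw [segment_eq_image']
  constructor
  · rintro ⟨t, ht, rfl⟩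
    exact ⟨t, ht.1, ht.2, by simp⟩
  · rintro ⟨t, h0, h1, rfl⟩
    exact ⟨t, ⟨h0, h1⟩, by simp⟩

theorem mem_hseg_iff_exists {a b z : ℂ} (hab : a ≠ b) :
    z ∈ hseg a b ↔ ∃ t : ℝ, 0 ≤ t ∧ t < 1 ∧ z = a + t * (b - a) := by
  constructor
  · rintro ⟨h, hne⟩
    obtain ⟨t, h0, h1, rfl⟩ := mem_segment_iff_exists.1 h
    refine ⟨t, h0, lt_of_le_of_ne h1 ?_, rfl⟩
    rintro rfl
    exact hne (by simp)
  · rintro ⟨t, h0, h1, rfl⟩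
    refine ⟨mem_segment_iff_exists.2 ⟨t, h0, h1.le, rfl⟩, ?_⟩
    intro h
    have : ((t : ℂ) - 1) * (b - a) = 0 := by
      have : a + t * (b - a) = b := h
      linear_combination this
    rcases mul_eq_zero.1 this with h' | h'
    · have : t = 1 := by exact_mod_cast sub_eq_zero.1 h'
      exact h1.ne this
    · exact hab (sub_eq_zero.1 h').symm

theorem isClosed_segment_complex (a b : ℂ) : IsClosed (segment ℝ a b) := by
  rw [segment_eq_image']
  exact (isCompact_Icc.image (by fun_prop)).isClosed

theorem isClosed_rightRay (ρ : ℂ) : IsClosed (rightRay ρ) := by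
  have : rightRay ρ = {z : ℂ | z.im = ρ.im ∧ ρ.re ≤ z.re} := by
    ext z
    constructor
    · rintro ⟨t, ht, rfl⟩
      simp [ht]
    · rintro ⟨h1, h2⟩
      exact ⟨z.re - ρ.re, by linarith, Complex.ext (by simp) (by simp [h1])⟩
  rw [this]
  exact (isClosed_eq Complex.continuous_im continuous_const).inter
    (isClosed_le continuous_const Complex.continuous_re)

theorem hseg_split {a b z : ℂ} (hz : z ∈ hseg a b) (hza : z ≠ a) :
    hseg a b = hseg a z ∪ hseg z b ∧ Disjoint (hseg a z) (hseg z b) := by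
  have hab : a ≠ b := by
    rintro rfl
    exact hz.2 (by simpa using hz.1)
  obtain ⟨t, h0, h1, rfl⟩ := (mem_hseg_iff_exists hab).1 hz
  have ht : 0 < t := by
    refine lt_of_le_of_ne h0 ?_
    rintro rfl
    simp at hza
  have hzb : a + t * (b - a) ≠ b := hz.2
  have e1 : ∀ w, w ∈ hseg a (a + t * (b - a)) ↔ ∃ s : ℝ, 0 ≤ s ∧ s < t ∧ w = a + s * (b - a) := by
    intro w
    rw [mem_hseg_iff_exists hza.symm]
    constructor
    · rintro ⟨s, hs0, hs1, rfl⟩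
      exact ⟨s * t, by positivity, by nlinarith, by push_cast; ring⟩
    · rintro ⟨s, hs0, hs1, rfl⟩
      refine ⟨s / t, by positivity, (div_lt_one ht).2 hs1, ?_⟩
      have : (t : ℂ) ≠ 0 := by exact_mod_cast ht.ne'
      push_cast
      field_simp
      ring
  have e2 : ∀ w, w ∈ hseg (a + t * (b - a)) b ↔
      ∃ s : ℝ, t ≤ s ∧ s < 1 ∧ w = a + s * (b - a) := by
    intro w
    rw [mem_hseg_iff_exists hzb]
    constructor
    · rintro ⟨s, hs0, hs1, rfl⟩
      exact ⟨t + s * (1 - t), by nlinarith, by nlinarith, by push_cast; ring⟩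
    · rintro ⟨s, hs0, hs1, rfl⟩
      have h1t : 0 < 1 - t := by linarith
      refine ⟨(s - t) / (1 - t), div_nonneg (by linarith) h1t.le,
        (div_lt_one h1t).2 (by linarith), ?_⟩
      have : (1 - t : ℂ) ≠ 0 := by exact_mod_cast h1t.ne'
      push_cast
      field_simp
      ring
  constructor
  · ext w
    rw [Set.mem_union, e1, e2, mem_hseg_iff_exists hab]
    constructor
    · rintro ⟨s, hs0, hs1, rfl⟩
      rcases lt_or_ge s t with h | h
      · exact Or.inl ⟨s, hs0, h, rfl⟩
      · exact Or.inr ⟨s, h, hs1, rfl⟩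
    · rintro (⟨s, hs0, hs1, rfl⟩ | ⟨s, hs0, hs1, rfl⟩)
      · exact ⟨s, hs0, hs1.trans h1, rfl⟩
      · exact ⟨s, h0.trans hs0, hs1, rfl⟩
  · rw [Set.disjoint_left]
    intro w hw hw'
    obtain ⟨s, -, hs, h⟩ := (e1 w).1 hw
    obtain ⟨s', hs', -, h'⟩ := (e2 w).1 hw'
    rw [h] at h'
    have : (s : ℂ) = s' := by
      have h3 := add_left_cancel h'
      exact mul_right_cancel₀ (sub_ne_zero.2 hab.symm) h3
    have : s = s' := by exact_mod_cast this
    linarith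

/-- A finite rooted tree drawn in the plane with straight edges, together with a ray going from
the root to infinity. -/
structure PTree (ρ : ℂ) where
  N : Finset ℂ
  par : ℂ → ℂ
  rk : ℂ → ℝ
  root_not_mem : ρ ∉ N
  par_mem : ∀ p ∈ N, par p ∈ insert ρ N
  rk_lt : ∀ p ∈ N, rk (par p) < rk p
  disj : ∀ p ∈ N, ∀ q ∈ N, p ≠ q → Disjoint (hseg p (par p)) (hseg q (par q))
  disj_ray : ∀ p ∈ N, Disjoint (hseg p (par p)) (rightRay ρ)

namespace PTree

variable {ρ : ℂ}

/-- The point set of a planar tree with its ray. -/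
def carrier (T : PTree ρ) : Set ℂ := rightRay ρ ∪ ⋃ p ∈ T.N, hseg p (T.par p)

theorem ne_par (T : PTree ρ) {p : ℂ} (hp : p ∈ T.N) : p ≠ T.par p := fun h =>
  (T.rk_lt p hp).ne (by rw [← h])

theorem hseg_subset (T : PTree ρ) {p : ℂ} (hp : p ∈ T.N) : hseg p (T.par p) ⊆ T.carrier :=
  fun _ hz => Or.inr (Set.mem_biUnion hp hz)

theorem node_mem (T : PTree ρ) {p : ℂ} (hp : p ∈ insert ρ T.N) : p ∈ T.carrier := by
  rcases Finset.mem_insert.1 hp with rfl | hp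
  · exact Or.inl (self_mem_rightRay _)
  · exact T.hseg_subset hp (left_mem_hseg (T.ne_par hp))

theorem segment_subset (T : PTree ρ) {p : ℂ} (hp : p ∈ T.N) :
    segment ℝ p (T.par p) ⊆ T.carrier := by
  intro z hz
  by_cases h : z = T.par p
  · rw [h]
    exact T.node_mem (T.par_mem p hp)
  · exact T.hseg_subset hp ⟨hz, h⟩

theorem carrier_eq (T : PTree ρ) :
    T.carrier = rightRay ρ ∪ ⋃ p ∈ T.N, segment ℝ p (T.par p) := by
  apply Set.Subset.antisymm
  · exact Set.union_subset_union_right _ (Set.iUnion₂_mono fun p _ => Set.sdiff_subset)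
  · exact Set.union_subset Set.subset_union_left
      (Set.iUnion₂_subset fun p hp => T.segment_subset hp)

theorem isClosed_carrier (T : PTree ρ) : IsClosed T.carrier := by
  rw [T.carrier_eq]
  exact (isClosed_rightRay ρ).union
    (T.N.finite_toSet.isClosed_biUnion fun p _ => isClosed_segment_complex _ _)

theorem mem_carrier {T : PTree ρ} {z : ℂ} :
    z ∈ T.carrier ↔ z ∈ rightRay ρ ∨ ∃ p ∈ T.N, z ∈ hseg p (T.par p) := by
  simp [carrier]

theorem not_mem_ray (T : PTree ρ) {p : ℂ} (hp : p ∈ T.N) : p ∉ rightRay ρ := fun h =>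
  (T.disj_ray p hp).le_bot ⟨left_mem_hseg (T.ne_par hp), h⟩

theorem eq_of_mem_hseg (T : PTree ρ) {p q z : ℂ} (hp : p ∈ T.N) (hq : q ∈ T.N)
    (h : z ∈ hseg p (T.par p)) (h' : z ∈ hseg q (T.par q)) : p = q := by
  by_contra hne
  exact (T.disj p hp q hq hne).le_bot ⟨h, h'⟩

/-- The restriction of a planar tree to a set of nodes closed under taking parents. -/
def restrict (T : PTree ρ) (N' : Finset ℂ) (hN : N' ⊆ T.N)
    (hpar : ∀ p ∈ N', T.par p ∈ insert ρ N') : PTree ρ where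
  N := N'
  par := T.par
  rk := T.rk
  root_not_mem h := T.root_not_mem (hN h)
  par_mem := hpar
  rk_lt p hp := T.rk_lt p (hN hp)
  disj p hp q hq := T.disj p (hN hp) q (hN hq)
  disj_ray p hp := T.disj_ray p (hN hp)

theorem isSimplyConnected_compl_rightRay (ρ : ℂ) : IsSimplyConnected (rightRay ρ)ᶜ := by
  have hstar : StarConvex ℝ (ρ - 1) (rightRay ρ)ᶜ := by
    intro z hz a b ha hb hab hmem
    apply hz
    obtain ⟨t, ht, h⟩ := hmem
    have hb0 : 0 < b := by
      refine lt_of_le_of_ne hb ?_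
      rintro rfl
      obtain rfl : a = 1 := by linarith
      have := congrArg Complex.re h
      simp at this
      linarith
    refine ⟨(t + a) / b, by positivity, ?_⟩
    have hb' : (b : ℂ) ≠ 0 := by exact_mod_cast hb0.ne'
    have hab' : (a : ℂ) + b = 1 := by exact_mod_cast hab
    push_cast
    simp only [Complex.real_smul] at h
    field_simp
    linear_combination h - hab' * ρ
  have hne : ((rightRay ρ)ᶜ).Nonempty := by
    refine ⟨ρ - 1, ?_⟩
    rintro ⟨t, ht, h⟩
    have := congrArg Complex.re h
    simp at this
    linarith
  have := hstar.contractibleSpace hne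
  exact SimplyConnectedSpace.ofContractible _

theorem isSimplyConnected_compl : ∀ (k : ℕ) (T : PTree ρ), T.N.card = k →
    IsSimplyConnected T.carrierᶜ := by
  intro k
  induction k with
  | zero =>
    intro T hT
    have : T.carrier = rightRay ρ := by
      simp [carrier, Finset.card_eq_zero.1 hT]
    rw [this]
    exact isSimplyConnected_compl_rightRay ρ
  | succ k ih =>
    intro T hT
    obtain ⟨l, hl, hmax⟩ := T.N.exists_max_image T.rk (Finset.card_pos.1 (by omega))
    have hpar : ∀ p ∈ T.N, T.par p ≠ l := fun p hp h =>
      absurd (hmax p hp) (not_le.2 (h ▸ T.rk_lt p hp))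
    let T' := T.restrict (T.N.erase l) (Finset.erase_subset _ _) (by
      intro p hp
      have hp' := Finset.mem_of_mem_erase hp
      rcases Finset.mem_insert.1 (T.par_mem p hp') with h | h
      · rw [h]; exact Finset.mem_insert_self _ _
      · exact Finset.mem_insert_of_mem (Finset.mem_erase.2 ⟨hpar p hp', h⟩))
    have hT' := ih T' (by simp [T', restrict, Finset.card_erase_of_mem hl, hT])
    have heq : T.carrier = T'.carrier ∪ segment ℝ l (T.par l) := by
      rw [T.carrier_eq, T'.carrier_eq, Set.union_assoc]
      congr 1
      ext z
      simp only [Set.mem_iUnion, Set.mem_union, T', restrict, Finset.mem_erase]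
      constructor
      · rintro ⟨p, hp, hz⟩
        by_cases h : p = l
        · exact Or.inr (h ▸ hz)
        · exact Or.inl ⟨p, ⟨h, hp⟩, hz⟩
      · rintro (⟨p, hp, hz⟩ | hz)
        · exact ⟨p, hp.2, hz⟩
        · exact ⟨l, hl, hz⟩
    rw [heq]
    refine isSimplyConnected_compl_union_segment T'.isClosed_carrier ?_ ?_ hT'
    · refine T'.node_mem ?_
      rcases Finset.mem_insert.1 (T.par_mem l hl) with h | h
      · rw [h]; exact Finset.mem_insert_self _ _
      · exact Finset.mem_insert_of_mem (Finset.mem_erase.2 ⟨hpar l hl, h⟩)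
    · intro z hz hne hmem
      have hz' : z ∈ hseg l (T.par l) := ⟨hz, hne⟩
      rcases mem_carrier.1 hmem with h | ⟨p, hp, h⟩
      · exact (T.disj_ray l hl).le_bot ⟨hz', h⟩
      · have hp' : p ≠ l ∧ p ∈ T.N := Finset.mem_erase.1 hp
        exact hp'.1 (T.eq_of_mem_hseg hp'.2 hl h hz')

end PTree

namespace PTree

variable {ρ : ℂ}

/-- Attach a new leaf to a planar tree. -/
theorem exists_add_leaf (T : PTree ρ) {a z : ℂ} (hz : z ∈ insert ρ T.N) (ha : a ∉ T.carrier)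
    (hd : Disjoint (hseg a z) T.carrier) :
    ∃ T' : PTree ρ, T'.carrier = T.carrier ∪ hseg a z ∧ T'.N = insert a T.N := by
  have haN : a ∉ insert ρ T.N := fun h => ha (T.node_mem h)
  have haN' : a ∉ T.N := fun h => haN (Finset.mem_insert_of_mem h)
  have haz : z ≠ a := fun h => haN (h ▸ hz)
  have hne : ∀ p ∈ T.N, p ≠ a := fun p hp h => haN' (h ▸ hp)
  have hpne : ∀ p ∈ T.N, T.par p ≠ a := fun p hp h => haN (h ▸ T.par_mem p hp)
  refine ⟨{ N := insert a T.N
            par := Function.update T.par a z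
            rk := Function.update T.rk a (T.rk z + 1)
            root_not_mem := ?_
            par_mem := ?_
            rk_lt := ?_
            disj := ?_
            disj_ray := ?_ }, ?_, rfl⟩
  · rw [Finset.mem_insert, not_or]
    exact ⟨fun h => haN (h ▸ Finset.mem_insert_self _ _), T.root_not_mem⟩
  · intro p hp
    rw [Finset.insert_comm]
    apply Finset.mem_insert_of_mem
    rcases Finset.mem_insert.1 hp with rfl | hp
    · simpa using hz
    · rw [Function.update_of_ne (hne p hp)]
      exact T.par_mem p hp
  · intro p hp
    rcases Finset.mem_insert.1 hp with rfl | hp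
    · simp [Function.update_of_ne haz]
    · rw [Function.update_of_ne (hne p hp), Function.update_of_ne (hne p hp),
        Function.update_of_ne (hpne p hp)]
      exact T.rk_lt p hp
  · intro p hp q hq hpq
    rcases Finset.mem_insert.1 hp with rfl | hp' <;>
      rcases Finset.mem_insert.1 hq with rfl | hq'
    · exact absurd rfl hpq
    · rw [Function.update_self, Function.update_of_ne (hne q hq')]
      exact hd.mono_right (T.hseg_subset hq')
    · rw [Function.update_self, Function.update_of_ne (hne p hp')]
      exact (hd.mono_right (T.hseg_subset hp')).symm
    · rw [Function.update_of_ne (hne p hp'), Function.update_of_ne (hne q hq')]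
      exact T.disj p hp' q hq' hpq
  · intro p hp
    rcases Finset.mem_insert.1 hp with rfl | hp
    · rw [Function.update_self]
      exact hd.mono_right Set.subset_union_left
    · rw [Function.update_of_ne (hne p hp)]
      exact T.disj_ray p hp
  · ext w
    simp only [mem_carrier, Set.mem_union, Finset.mem_insert, exists_eq_or_imp,
      Function.update_self]
    have : (∃ p ∈ T.N, w ∈ hseg p (Function.update T.par a z p)) ↔
        ∃ p ∈ T.N, w ∈ hseg p (T.par p) :=
      exists_congr fun p => and_congr_right fun hp => by rw [Function.update_of_ne (hne p hp)]
    rw [this, or_assoc]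
    exact or_congr_right or_comm

/-- Subdivide an edge of a planar tree. -/
theorem exists_subdivide (T : PTree ρ) {p z : ℂ} (hp : p ∈ T.N) (hz : z ∈ hseg p (T.par p))
    (hzp : z ≠ p) :
    ∃ T' : PTree ρ, T'.carrier = T.carrier ∧ T'.N = insert z T.N := by
  obtain ⟨hsplit, hdisj⟩ := hseg_split hz hzp
  have hzN' : z ∉ T.N := fun h => hzp (T.eq_of_mem_hseg h hp (left_mem_hseg (T.ne_par h)) hz)
  have hzρ : z ≠ ρ := fun h =>
    (T.disj_ray p hp).le_bot ⟨hz, h ▸ self_mem_rightRay _⟩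
  have hzN : z ∉ insert ρ T.N := by
    rw [Finset.mem_insert, not_or]
    exact ⟨hzρ, hzN'⟩
  have hne : ∀ q ∈ T.N, q ≠ z := fun q hq h => hzN' (h ▸ hq)
  have hpne : ∀ q ∈ T.N, T.par q ≠ z := fun q hq h => hzN (h ▸ T.par_mem q hq)
  have e1 : Function.update (Function.update T.par p z) z (T.par p) z = T.par p := by simp
  have e2 : Function.update (Function.update T.par p z) z (T.par p) p = z := by
    simp [Function.update_of_ne hzp.symm]
  have e3 : ∀ q ∈ T.N, q ≠ p →
      Function.update (Function.update T.par p z) z (T.par p) q = T.par q := fun q hq h => by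
    rw [Function.update_of_ne (hne q hq), Function.update_of_ne h]
  set par' := Function.update (Function.update T.par p z) z (T.par p) with hpar'
  have hsub : ∀ q ∈ insert z T.N, ∃ q' ∈ T.N, hseg q (par' q) ⊆ hseg q' (T.par q') := by
    intro q hq
    rcases Finset.mem_insert.1 hq with rfl | hq
    · exact ⟨p, hp, by rw [e1, hsplit]; exact Set.subset_union_right⟩
    · by_cases h : q = p
      · subst h
        exact ⟨q, hp, by rw [e2, hsplit]; exact Set.subset_union_left⟩
      · exact ⟨q, hq, by rw [e3 q hq h]⟩
  refine ⟨{ N := insert z T.N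
            par := par'
            rk := Function.update T.rk z ((T.rk p + T.rk (T.par p)) / 2)
            root_not_mem := ?_
            par_mem := ?_
            rk_lt := ?_
            disj := ?_
            disj_ray := ?_ }, ?_, rfl⟩
  · rw [Finset.mem_insert, not_or]
    exact ⟨hzρ.symm, T.root_not_mem⟩
  · intro q hq
    rw [Finset.insert_comm]
    rcases Finset.mem_insert.1 hq with rfl | hq
    · rw [e1]
      exact Finset.mem_insert_of_mem (T.par_mem p hp)
    · by_cases h : q = p
      · subst h
        rw [e2]
        exact Finset.mem_insert_self _ _
      · rw [e3 q hq h]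
        exact Finset.mem_insert_of_mem (T.par_mem q hq)
  · have hlt := T.rk_lt p hp
    intro q hq
    rcases Finset.mem_insert.1 hq with rfl | hq
    · rw [e1, Function.update_self, Function.update_of_ne (hpne p hp)]
      linarith
    · by_cases h : q = p
      · subst h
        rw [e2, Function.update_self, Function.update_of_ne (hne q hq)]
        linarith
      · rw [e3 q hq h, Function.update_of_ne (hne q hq), Function.update_of_ne (hpne q hq)]
        exact T.rk_lt q hq
  · have hzq : ∀ q ∈ T.N, Disjoint (hseg z (par' z)) (hseg q (par' q)) := by
      intro q hq
      by_cases h : q = p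
      · subst h
        rw [e1, e2]
        exact hdisj.symm
      · rw [e1, e3 q hq h]
        refine (T.disj p hp q hq (Ne.symm h)).mono_left ?_
        rw [hsplit]
        exact Set.subset_union_right
    have hsub' : ∀ q ∈ T.N, hseg q (par' q) ⊆ hseg q (T.par q) := by
      intro q hq
      by_cases h : q = p
      · subst h
        rw [e2, hsplit]
        exact Set.subset_union_left
      · rw [e3 q hq h]
    intro q hq q' hq' hqq
    rcases Finset.mem_insert.1 hq with rfl | h <;>
      rcases Finset.mem_insert.1 hq' with rfl | h'
    · exact absurd rfl hqq
    · exact hzq q' h'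
    · exact (hzq q h).symm
    · exact (T.disj q h q' h' hqq).mono (hsub' q h) (hsub' q' h')
  · intro q hq
    obtain ⟨q', hq', h⟩ := hsub q hq
    exact (T.disj_ray q' hq').mono_left h
  · ext w
    simp only [mem_carrier]
    refine or_congr_right ⟨?_, ?_⟩
    · rintro ⟨q, hq, hw⟩
      obtain ⟨q', hq', h⟩ := hsub q hq
      exact ⟨q', hq', h hw⟩
    · rintro ⟨q, hq, hw⟩
      by_cases h : q = p
      · subst h
        rw [hsplit] at hw
        rcases hw with hw | hw
        · exact ⟨q, Finset.mem_insert_of_mem hq, by rwa [e2]⟩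
        · exact ⟨z, Finset.mem_insert_self _ _, by rwa [e1]⟩
      · exact ⟨q, Finset.mem_insert_of_mem hq, by rwa [e3 q hq h]⟩

theorem exists_node (T : PTree ρ) {z : ℂ} (hz : z ∈ T.carrier) (hray : z ∈ rightRay ρ → z = ρ) :
    ∃ T' : PTree ρ, T'.carrier = T.carrier ∧ T.N ⊆ T'.N ∧ z ∈ insert ρ T'.N := by
  rcases mem_carrier.1 hz with h | ⟨p, hp, h⟩
  · exact ⟨T, rfl, subset_rfl, by rw [hray h]; exact Finset.mem_insert_self _ _⟩
  · by_cases hzp : z = p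
    · exact ⟨T, rfl, subset_rfl, by rw [hzp]; exact Finset.mem_insert_of_mem hp⟩
    · obtain ⟨T', h1, h2⟩ := T.exists_subdivide hp h hzp
      refine ⟨T', h1, by rw [h2]; exact Finset.subset_insert _ _, ?_⟩
      rw [h2]
      exact Finset.mem_insert_of_mem (Finset.mem_insert_self _ _)

theorem exists_add_segment {K : Set ℂ} (hK : ∀ z ∈ K, z ∈ rightRay ρ → z = ρ) (T : PTree ρ)
    (hT : T.carrier ⊆ K ∪ rightRay ρ) {a b : ℂ} (hab : segment ℝ a b ⊆ K) (hb : b ∈ T.carrier) :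
    ∃ T' : PTree ρ, T'.carrier ⊆ K ∪ rightRay ρ ∧ T.carrier ⊆ T'.carrier ∧ a ∈ T'.carrier := by
  by_cases ha : a ∈ T.carrier
  · exact ⟨T, hT, subset_rfl, ha⟩
  have hcont : Continuous fun t : ℝ => a + t * (b - a) := by fun_prop
  have hS : IsCompact (Set.Icc (0 : ℝ) 1 ∩ (fun t : ℝ => a + t * (b - a)) ⁻¹' T.carrier) :=
    isCompact_Icc.inter_right (T.isClosed_carrier.preimage hcont)
  obtain ⟨t, ⟨ht, hmem⟩, hmin⟩ := hS.exists_isLeast ⟨1, ⟨by simp, by simpa using hb⟩⟩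
  set z := a + t * (b - a) with hz
  have hsub : segment ℝ a z ⊆ segment ℝ a b :=
    (convex_segment a b).segment_subset (left_mem_segment ℝ a b)
      (mem_segment_iff_exists.2 ⟨t, ht.1, ht.2, rfl⟩)
  have hzK : z ∈ K := hab (hsub (right_mem_segment ℝ a z))
  obtain ⟨T₁, hc, -, hzN⟩ := T.exists_node hmem (hK z hzK)
  have haz : a ≠ z := fun h => ha (h ▸ hmem)
  have hd : Disjoint (hseg a z) T₁.carrier := by
    rw [hc, Set.disjoint_left]
    intro w hw hwT
    obtain ⟨s, hs0, hs1, rfl⟩ := (mem_hseg_iff_exists haz).1 hw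
    have ht0 : 0 < t := by
      refine lt_of_le_of_ne ht.1 ?_
      rintro rfl
      simp [hz] at haz
    have : t ≤ s * t := by
      refine hmin ⟨⟨mul_nonneg hs0 ht.1, by nlinarith [ht.2]⟩, ?_⟩
      have e : a + ((s * t : ℝ) : ℂ) * (b - a) = a + s * (z - a) := by
        rw [hz]; push_cast; ring
      rw [Set.mem_preimage, e]
      exact hwT
    nlinarith
  obtain ⟨T₂, hc2, hN2⟩ := T₁.exists_add_leaf hzN (by rwa [hc]) hd
  refine ⟨T₂, ?_, ?_, ?_⟩
  · rw [hc2, hc]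
    exact Set.union_subset hT (Set.sdiff_subset.trans ((hsub.trans hab).trans Set.subset_union_left))
  · rw [hc2, hc]
    exact Set.subset_union_left
  · rw [hc2]
    exact Or.inr (left_mem_hseg haz)

theorem exists_of_links {K : Set ℂ} (hK : ∀ z ∈ K, z ∈ rightRay ρ → z = ρ)
    (V : Finset ℂ)
    (hV : ∀ v ∈ V, Relation.ReflTransGen (fun a b => segment ℝ a b ⊆ K) v ρ) :
    ∃ T : PTree ρ, T.carrier ⊆ K ∪ rightRay ρ ∧ ∀ v ∈ V, v ∈ T.carrier := by
  classical
  induction V using Finset.induction_on with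
  | empty =>
    refine ⟨⟨∅, id, fun _ => 0, by simp, by simp, by simp, by simp, by simp⟩, ?_, by simp⟩
    simp [carrier]
  | insert v V hv ih =>
    obtain ⟨T, hT, hVT⟩ := ih fun w hw => hV w (Finset.mem_insert_of_mem hw)
    have key : ∀ a, Relation.ReflTransGen (fun a b => segment ℝ a b ⊆ K) a ρ →
        ∃ T' : PTree ρ, T'.carrier ⊆ K ∪ rightRay ρ ∧ T.carrier ⊆ T'.carrier ∧
          a ∈ T'.carrier := by
      intro a ha
      induction ha using Relation.ReflTransGen.head_induction_on with
      | refl => exact ⟨T, hT, subset_rfl, Or.inl (self_mem_rightRay _)⟩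
      | head hab _ ih' =>
        obtain ⟨T', h1, h2, h3⟩ := ih'
        obtain ⟨T'', h4, h5, h6⟩ := T'.exists_add_segment hK h1 hab h3
        exact ⟨T'', h4, h2.trans h5, h6⟩
    obtain ⟨T', h1, h2, h3⟩ := key v (hV v (Finset.mem_insert_self _ _))
    refine ⟨T', h1, fun w hw => ?_⟩
    rcases Finset.mem_insert.1 hw with rfl | hw
    · exact h3
    · exact h2 (hVT w hw)

theorem exists_nodes (T : PTree ρ) (P : Finset ℂ) (hP : ∀ z ∈ P, z ∈ rightRay ρ → z = ρ) :
    ∃ T' : PTree ρ, T'.carrier = T.carrier ∧ ∀ z ∈ P, z ∈ T.carrier → z ∈ insert ρ T'.N := by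
  classical
  induction P using Finset.induction_on with
  | empty => exact ⟨T, rfl, by simp⟩
  | insert z P hz ih =>
    obtain ⟨T', h1, h2⟩ := ih fun w hw => hP w (Finset.mem_insert_of_mem hw)
    by_cases hzT : z ∈ T.carrier
    · obtain ⟨T'', h3, h4, h5⟩ :=
        T'.exists_node (h1 ▸ hzT) (hP z (Finset.mem_insert_self _ _))
      refine ⟨T'', h3.trans h1, fun w hw hwT => ?_⟩
      rcases Finset.mem_insert.1 hw with rfl | hw
      · exact h5
      · exact Finset.insert_subset_insert _ h4 (h2 w hw hwT)
    · refine ⟨T', h1, fun w hw hwT => ?_⟩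
      rcases Finset.mem_insert.1 hw with rfl | hw
      · exact absurd hwT hzT
      · exact h2 w hw hwT

/-- `T.Anc p q` says that `q` is an ancestor of `p` (or `p` itself). -/
def Anc (T : PTree ρ) : ℂ → ℂ → Prop := Relation.ReflTransGen fun p q => p ∈ T.N ∧ T.par p = q

/-- Pruning: a tree containing `V` may be assumed to have only nodes lying below some `v ∈ V`. -/
theorem exists_prune (T : PTree ρ) (V : Set ℂ) (hV : ∀ v ∈ V, v ∈ insert ρ T.N) :
    ∃ T' : PTree ρ, T'.carrier ⊆ T.carrier ∧ (∀ v ∈ V, v ∈ insert ρ T'.N) ∧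
      (∀ p ∈ T'.N, ∃ v ∈ V, T'.Anc v p) ∧
      ∀ z, z ∈ insert ρ T.N → z ∈ T'.carrier → z ∈ insert ρ T'.N := by
  classical
  let N' := T.N.filter fun p => ∃ v ∈ V, T.Anc v p
  have hN' : N' ⊆ T.N := Finset.filter_subset _ _
  have hcl : ∀ p ∈ N', T.par p ∈ insert ρ N' := by
    intro p hp
    obtain ⟨hpN, v, hv, hvp⟩ := Finset.mem_filter.1 hp
    rcases Finset.mem_insert.1 (T.par_mem p hpN) with h | h
    · rw [h]; exact Finset.mem_insert_self _ _
    · exact Finset.mem_insert_of_mem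
        (Finset.mem_filter.2 ⟨h, v, hv, Relation.ReflTransGen.tail hvp ⟨hpN, rfl⟩⟩)
  have hcar : (T.restrict N' hN' hcl).carrier ⊆ T.carrier := by
    intro z hz
    rcases mem_carrier.1 hz with h | ⟨p, hp, h⟩
    · exact Or.inl h
    · exact T.hseg_subset (hN' hp) h
  refine ⟨T.restrict N' hN' hcl, hcar, ?_, ?_, ?_⟩
  · intro v hv
    rcases Finset.mem_insert.1 (hV v hv) with h | h
    · rw [h]; exact Finset.mem_insert_self _ _
    · exact Finset.mem_insert_of_mem (Finset.mem_filter.2 ⟨h, v, hv, Relation.ReflTransGen.refl⟩)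
  · intro p hp
    obtain ⟨hpN, v, hv, hvp⟩ := Finset.mem_filter.1 hp
    refine ⟨v, hv, ?_⟩
    have : ∀ q, T.Anc v q → (T.restrict N' hN' hcl).Anc v q := by
      intro q hq
      induction hq with
      | refl => exact Relation.ReflTransGen.refl
      | tail h1 h2 ih =>
        exact ih.tail ⟨Finset.mem_filter.2 ⟨h2.1, v, hv, h1⟩, h2.2⟩
    exact this p hvp
  · intro z hz hzc
    rcases Finset.mem_insert.1 hz with h | hzN
    · rw [h]; exact Finset.mem_insert_self _ _
    · rcases mem_carrier.1 hzc with h | ⟨p, hp, h⟩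
      · exact absurd h (T.not_mem_ray hzN)
      · have : z = p := T.eq_of_mem_hseg hzN (hN' hp) (left_mem_hseg (T.ne_par hzN)) h
        rw [this]
        exact Finset.mem_insert_of_mem hp

end PTree

section PathClasses

variable {X : Type*} [TopologicalSpace X]

open Path

theorem symm_trans_cancel {x y z : X} (p : Homotopic.Quotient x y) (q : Homotopic.Quotient y z) :
    p.symm.trans (p.trans q) = q := by
  rw [← Homotopic.Quotient.trans_assoc]; simp

theorem trans_symm_cancel {x y z : X} (p : Homotopic.Quotient x y) (q : Homotopic.Quotient x z) :
    p.trans (p.symm.trans q) = q := by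
  rw [← Homotopic.Quotient.trans_assoc]; simp

theorem symm_trans_rev {x y z : X} (p : Homotopic.Quotient x y) (q : Homotopic.Quotient y z) :
    (p.trans q).symm = q.symm.trans p.symm := by
  have h : (p.trans q).trans (q.symm.trans p.symm) = Homotopic.Quotient.refl x := by
    rw [Homotopic.Quotient.trans_assoc, trans_symm_cancel, Homotopic.Quotient.trans_symm]
  rw [← symm_trans_cancel (p.trans q) (q.symm.trans p.symm), h, Homotopic.Quotient.trans_refl]

/-- A homotopy class of paths has a representative inside `S`. -/
def InS (S : Set X) {x y : X} (m : Homotopic.Quotient x y) : Prop :=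
  ∃ γ : Path x y, (∀ t, γ t ∈ S) ∧ Homotopic.Quotient.mk γ = m

/-- Any two paths inside `S` with the same endpoints are homotopic in the ambient space. -/
def Thin (S : Set X) : Prop :=
  ∀ ⦃x y : X⦄ (m m' : Homotopic.Quotient x y), InS S m → InS S m' → m = m'

theorem InS.source {S : Set X} {x y : X} {m : Homotopic.Quotient x y} (h : InS S m) : x ∈ S := by
  obtain ⟨γ, hγ, -⟩ := h
  simpa using hγ 0

theorem InS.target {S : Set X} {x y : X} {m : Homotopic.Quotient x y} (h : InS S m) : y ∈ S := by
  obtain ⟨γ, hγ, -⟩ := h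
  simpa using hγ 1

theorem InS.refl {S : Set X} {x : X} (h : x ∈ S) : InS S (Homotopic.Quotient.refl x) :=
  ⟨Path.refl x, fun _ => h, rfl⟩

theorem InS.symm {S : Set X} {x y : X} {m : Homotopic.Quotient x y} (h : InS S m) : InS S m.symm := by
  obtain ⟨γ, hγ, rfl⟩ := h
  exact ⟨γ.symm, fun t => hγ _, rfl⟩

theorem InS.trans {S : Set X} {x y z : X} {m : Homotopic.Quotient x y} {m' : Homotopic.Quotient y z} (h : InS S m)
    (h' : InS S m') : InS S (m.trans m') := by
  obtain ⟨γ, hγ, rfl⟩ := h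
  obtain ⟨γ', hγ', rfl⟩ := h'
  refine ⟨γ.trans γ', fun t => ?_, rfl⟩
  rw [Path.trans_apply]
  split_ifs
  · exact hγ _
  · exact hγ' _

theorem InS.mono {S S' : Set X} {x y : X} {m : Homotopic.Quotient x y} (h : InS S m) (hS : S ⊆ S') :
    InS S' m := by
  obtain ⟨γ, hγ, rfl⟩ := h
  exact ⟨γ, fun t => hS (hγ t), rfl⟩

/-- Loop classes at `b` that move inside `Ω`, then inside `D`, then inside `Ω`. -/
def crossSet (Ω D : Set X) (b : X) : Set (Homotopic.Quotient b b) :=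
  {g | ∃ (x x' : X) (α : Homotopic.Quotient b x) (μ : Homotopic.Quotient x x') (β : Homotopic.Quotient b x'),
    InS Ω α ∧ InS D μ ∧ InS Ω β ∧ g = α.trans (μ.trans β.symm)}

theorem conj_eq_of_joined {Ω D : Set X} (hΩ : Thin Ω) (hD : Thin D) {b x x' y y' : X}
    {α : Homotopic.Quotient b x} {μ : Homotopic.Quotient x x'} {β : Homotopic.Quotient b x'} {α' : Homotopic.Quotient b y} {ν : Homotopic.Quotient y y'} {β' : Homotopic.Quotient b y'}
    {δ : Homotopic.Quotient x y} {δ' : Homotopic.Quotient x' y'} (hα : InS Ω α) (hμ : InS D μ) (hβ : InS Ω β) (hα' : InS Ω α')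
    (hν : InS D ν) (hβ' : InS Ω β') (hδ : InS (D ∩ Ω) δ) (hδ' : InS (D ∩ Ω) δ') :
    α.trans (μ.trans β.symm) = α'.trans (ν.trans β'.symm) := by
  have h1 : α' = α.trans δ := hΩ _ _ hα' (hα.trans (hδ.mono Set.inter_subset_right))
  have h2 : β' = β.trans δ' := hΩ _ _ hβ' (hβ.trans (hδ'.mono Set.inter_subset_right))
  have h3 : ν = δ.symm.trans (μ.trans δ') := hD _ _ hν
    ((hδ.mono Set.inter_subset_left).symm.trans (hμ.trans (hδ'.mono Set.inter_subset_left)))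
  rw [h1, h2, h3]
  simp only [Homotopic.Quotient.trans_assoc, symm_trans_rev, trans_symm_cancel]

/-- A code for the components of `D ∩ Ω` bounds the number of crossing classes. -/
theorem finite_crossSet {ι : Type*} [Fintype ι] {Ω D : Set X} (hΩ : Thin Ω) (hD : Thin D) (b : X)
    (code : X → ι)
    (hcode : ∀ x ∈ D ∩ Ω, ∀ y ∈ D ∩ Ω, code x = code y → ∃ δ : Homotopic.Quotient x y, InS (D ∩ Ω) δ) :
    (crossSet Ω D b).Finite ∧ (crossSet Ω D b).ncard ≤ Fintype.card ι ^ 2 := by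
  have hchoice : ∀ g : crossSet Ω D b, ∃ (x x' : X) (α : Homotopic.Quotient b x) (μ : Homotopic.Quotient x x') (β : Homotopic.Quotient b x'),
    InS Ω α ∧ InS D μ ∧ InS Ω β ∧ g.1 = α.trans (μ.trans β.symm) := fun g => g.2
  choose x x' α μ β hα hμ hβ hg using hchoice
  have hinj : Function.Injective fun g : crossSet Ω D b => (code (x g), code (x' g)) := by
    intro g h hgh
    obtain ⟨e1, e2⟩ := Prod.mk.injEq .. ▸ hgh
    obtain ⟨δ, hδ⟩ := hcode _ ⟨(hμ g).source, (hα g).target⟩ _ ⟨(hμ h).source, (hα h).target⟩ e1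
    obtain ⟨δ', hδ'⟩ := hcode _ ⟨(hμ g).target, (hβ g).target⟩ _ ⟨(hμ h).target, (hβ h).target⟩ e2
    apply Subtype.ext
    rw [hg, hg]
    exact conj_eq_of_joined hΩ hD (hα g) (hμ g) (hβ g) (hα h) (hμ h) (hβ h) hδ hδ'
  have hfin : Finite (crossSet Ω D b) := Finite.of_injective _ hinj
  refine ⟨hfin, ?_⟩
  have := Nat.card_le_card_of_injective _ hinj
  rw [Nat.card_coe_set_eq] at this
  simpa [pow_two] using this

theorem crossSet_subset {Ω D D' : Set X} (hΩ : Thin Ω) (hD : Thin D) (b : X)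
    (hDD : ∀ x ∈ D ∩ D', ∀ y ∈ D ∩ D', ∃ δ : Homotopic.Quotient x y, InS (D ∩ D') δ)
    (hmove : ∀ x ∈ D ∩ Ω, ∃ y ∈ D', ∃ δ : Homotopic.Quotient x y, InS (D ∩ Ω) δ) :
    crossSet Ω D b ⊆ crossSet Ω D' b := by
  rintro g ⟨x, x', α, μ, β, hα, hμ, hβ, rfl⟩
  obtain ⟨y, hy, δ, hδ⟩ := hmove x ⟨hμ.source, hα.target⟩
  obtain ⟨y', hy', δ', hδ'⟩ := hmove x' ⟨hμ.target, hβ.target⟩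
  obtain ⟨ν, hν⟩ := hDD y ⟨hδ.target.1, hy⟩ y' ⟨hδ'.target.1, hy'⟩
  have h1 := hα.trans (hδ.mono Set.inter_subset_right)
  have h2 := hβ.trans (hδ'.mono Set.inter_subset_right)
  exact ⟨y, y', _, ν, _, h1, hν.mono Set.inter_subset_right, h2,
    conj_eq_of_joined hΩ hD hα hμ hβ h1 (hν.mono Set.inter_subset_left) h2 hδ hδ'⟩

/-- Products of `k` elements of a set of loop classes. -/
def wordSet {b : X} (G : Set (Homotopic.Quotient b b)) : ℕ → Set (Homotopic.Quotient b b)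
  | 0 => {Homotopic.Quotient.refl b}
  | k + 1 => Set.image2 (fun g h => g.trans h) (wordSet G k) G

theorem finite_wordSet {b : X} {G : Set (Homotopic.Quotient b b)} {N : ℕ} (hG : G.Finite) (hN : G.ncard ≤ N)
    (k : ℕ) : (wordSet G k).Finite ∧ (wordSet G k).ncard ≤ N ^ k := by
  induction k with
  | zero => simp [wordSet]
  | succ k ih =>
    refine ⟨ih.1.image2 _ hG, ?_⟩
    rw [wordSet, ← Set.image_uncurry_prod]
    refine (Set.ncard_image_le (ih.1.prod hG)).trans ?_
    rw [Set.ncard_prod, pow_succ]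
    exact Nat.mul_le_mul ih.2 hN

theorem wordSet_mono {b : X} {G : Set (Homotopic.Quotient b b)} (h1 : Homotopic.Quotient.refl b ∈ G) {j k : ℕ} (hjk : j ≤ k) :
    wordSet G j ⊆ wordSet G k := by
  induction hjk with
  | refl => exact subset_rfl
  | step _ ih => exact ih.trans fun g hg => ⟨g, hg, _, h1, by simp⟩

theorem thin_of_simplyConnectedSpace {Y : Type*} [TopologicalSpace Y] [SimplyConnectedSpace Y]
    (i : C(Y, X)) (hi : Topology.IsInducing i) {S : Set X} (hS : S ⊆ Set.range i)
    (hinj : Function.Injective i) : Thin S := by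
  have lift : ∀ {y y' : Y} (γ : Path (i y) (i y')), (∀ t, γ t ∈ S) →
      ∃ γ' : Path y y', γ'.map i.continuous = γ := by
    intro y y' γ hγ
    choose g hg using fun t => hS (hγ t)
    refine ⟨⟨⟨g, ?_⟩, hinj (by rw [hg]; simp), hinj (by rw [hg]; simp)⟩, ?_⟩
    · rw [hi.continuous_iff]
      convert γ.continuous using 1
      exact funext hg
    · ext t
      exact hg t
  intro x x' m m' hm hm'
  obtain ⟨y, rfl⟩ := hS hm.source
  obtain ⟨y', rfl⟩ := hS hm.target
  obtain ⟨γ, hγ, rfl⟩ := hm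
  obtain ⟨γ', hγ', rfl⟩ := hm'
  obtain ⟨δ, rfl⟩ := lift γ hγ
  obtain ⟨δ', rfl⟩ := lift γ' hγ'
  exact Homotopic.Quotient.eq.2 ((SimplyConnectedSpace.paths_homotopic δ δ').map i)

end PathClasses

namespace PTree

variable {ρ : ℂ}

theorem Anc.eq_or_rk_lt {T : PTree ρ} {p q : ℂ} (h : T.Anc p q) : p = q ∨ T.rk q < T.rk p := by
  induction h with
  | refl => exact Or.inl rfl
  | tail _ h ih =>
    right
    obtain ⟨hN, rfl⟩ := h
    rcases ih with rfl | ih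
    · exact T.rk_lt _ hN
    · exact (T.rk_lt _ hN).trans ih

theorem Anc.total {T : PTree ρ} {v p q : ℂ} (h : T.Anc v p) (h' : T.Anc v q) :
    T.Anc p q ∨ T.Anc q p :=
  Relation.ReflTransGen.total_of_right_unique (fun _ _ _ h1 h2 => h1.2.symm.trans h2.2) h h'

open Classical in
/-- The children of a node. -/
noncomputable def kids (T : PTree ρ) (q : ℂ) : Finset ℂ := T.N.filter fun p => T.par p = q

theorem mem_kids {T : PTree ρ} {p q : ℂ} : p ∈ T.kids q ↔ p ∈ T.N ∧ T.par p = q := by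
  classical simp [kids]

theorem Anc.eq_or_exists {T : PTree ρ} {p q : ℂ} (h : T.Anc p q) :
    p = q ∨ ∃ c ∈ T.kids q, T.Anc p c := by
  rcases Relation.ReflTransGen.cases_tail h with h | ⟨c, h1, h2⟩
  · exact Or.inl h.symm
  · exact Or.inr ⟨c, mem_kids.2 h2, h1⟩

theorem anc_of_mem_kids {T : PTree ρ} {p q : ℂ} (h : p ∈ T.kids q) : T.Anc p q :=
  Relation.ReflTransGen.single (mem_kids.1 h)

theorem rk_lt_of_mem_kids {T : PTree ρ} {p q : ℂ} (h : p ∈ T.kids q) : T.rk q < T.rk p := by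
  obtain ⟨h', rfl⟩ := mem_kids.1 h
  exact T.rk_lt _ h'

theorem eq_of_kids_of_anc {T : PTree ρ} {p c c' : ℂ} (hc : c ∈ T.kids p) (hc' : c' ∈ T.kids p)
    (h : T.Anc c c') : c = c' := by
  rcases Relation.ReflTransGen.cases_head h with h | ⟨d, ⟨-, h1⟩, h2⟩
  · exact h
  · have : d = p := h1.symm.trans (mem_kids.1 hc).2
    subst this
    exfalso
    have := rk_lt_of_mem_kids hc'
    rcases Anc.eq_or_rk_lt h2 with rfl | h3
    · exact this.false
    · exact (this.trans h3).false

theorem eq_of_kids_of_anc_anc {T : PTree ρ} {p c c' v : ℂ} (hc : c ∈ T.kids p)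
    (hc' : c' ∈ T.kids p) (h : T.Anc v c) (h' : T.Anc v c') : c = c' := by
  rcases h.total h' with h | h
  · exact eq_of_kids_of_anc hc hc' h
  · exact (eq_of_kids_of_anc hc' hc h).symm

/-- Every node of the tree lies below some point of `V`. -/
def Pruned (T : PTree ρ) (V : Finset ℂ) : Prop := ∀ p ∈ T.N, ∃ v ∈ V, T.Anc v p

theorem Pruned.card_kids_le {T : PTree ρ} {V : Finset ℂ} (h : T.Pruned V) (q : ℂ) :
    (T.kids q).card ≤ V.card := by
  choose! f hf hf' using h
  refine Finset.card_le_card_of_injOn f (fun p hp => hf p (mem_kids.1 hp).1) fun c hc c' hc' hcc => ?_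
  have h1 := hf' c (mem_kids.1 hc).1
  rw [hcc] at h1
  exact eq_of_kids_of_anc_anc hc hc' h1 (hf' c' (mem_kids.1 hc').1)

open Classical in
/-- The points of `V` above a given node. -/
noncomputable def label (T : PTree ρ) (V : Finset ℂ) (q : ℂ) : Finset ℂ :=
  V.filter fun v => T.Anc v q

theorem mem_label {T : PTree ρ} {V : Finset ℂ} {q v : ℂ} : v ∈ T.label V q ↔ v ∈ V ∧ T.Anc v q := by
  classical simp [label]

/-- Nodes where the set of points of `V` above may change. -/
def IsEnd (T : PTree ρ) (V : Finset ℂ) (q : ℂ) : Prop :=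
  q ∈ insert ρ T.N ∧ (q ∈ V ∨ (T.kids q).card ≠ 1)

theorem IsEnd.eq_of_anc {T : PTree ρ} {V : Finset ℂ} (h : T.Pruned V) {e e' : ℂ}
    (he : T.IsEnd V e) (hanc : T.Anc e' e) (hl : T.label V e = T.label V e') : e' = e := by
  rcases hanc.eq_or_exists with heq | ⟨c, hc, hec⟩
  · exact heq
  exfalso
  have hlt : T.rk e < T.rk e' := by
    have := rk_lt_of_mem_kids hc
    rcases hec.eq_or_rk_lt with rfl | h
    · exact this
    · exact this.trans h
  rcases he.2 with heV | hcard
  · have : e ∈ T.label V e' := hl ▸ mem_label.2 ⟨heV, Relation.ReflTransGen.refl⟩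
    rcases (mem_label.1 this).2.eq_or_rk_lt with rfl | h
    · exact hlt.false
    · exact (h.trans hlt).false
  · obtain ⟨c', hc', hne⟩ : ∃ c' ∈ T.kids e, c' ≠ c := by
      by_contra! hall
      exact hcard (Finset.card_eq_one.2 ⟨c, Finset.eq_singleton_iff_unique_mem.2 ⟨hc, hall⟩⟩)
    obtain ⟨v, hv, hvc⟩ := h c' (mem_kids.1 hc').1
    have hve : v ∈ T.label V e := mem_label.2 ⟨hv, hvc.trans (anc_of_mem_kids hc')⟩
    rw [hl] at hve
    exact hne (eq_of_kids_of_anc_anc hc' hc hvc ((mem_label.1 hve).2.trans hec))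

theorem IsEnd.eq_of_label {T : PTree ρ} {V : Finset ℂ} (h : T.Pruned V) {e e' : ℂ}
    (he : T.IsEnd V e) (he' : T.IsEnd V e') (hl : T.label V e = T.label V e') : e = e' := by
  by_contra hne
  obtain ⟨v, hv⟩ : (T.label V e).Nonempty := by
    rcases Finset.mem_insert.1 he.1 with h1 | h1
    · rcases Finset.mem_insert.1 he'.1 with h2 | h2
      · exact absurd (h1.trans h2.symm) hne
      · obtain ⟨v, hv, hv'⟩ := h e' h2
        exact ⟨v, hl ▸ mem_label.2 ⟨hv, hv'⟩⟩
    · obtain ⟨v, hv, hv'⟩ := h e h1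
      exact ⟨v, mem_label.2 ⟨hv, hv'⟩⟩
  have h1 := (mem_label.1 hv).2
  have h2 := (mem_label.1 (hl ▸ hv)).2
  rcases h1.total h2 with h3 | h3
  · exact hne (he'.eq_of_anc h h3 hl.symm)
  · exact hne (he.eq_of_anc h h3 hl).symm

theorem Pruned.card_ends_le {T : PTree ρ} {V : Finset ℂ} (h : T.Pruned V) :
    {e | T.IsEnd V e}.Finite ∧ {e | T.IsEnd V e}.ncard ≤ 2 ^ V.card := by
  have hfin : {e | T.IsEnd V e}.Finite :=
    (insert ρ T.N).finite_toSet.subset fun e he => he.1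
  refine ⟨hfin, ?_⟩
  have := Set.ncard_le_ncard_of_injOn (s := {e | T.IsEnd V e}) (t := (V.powerset : Set (Finset ℂ)))
    (T.label V) (fun e _ => by
      simp only [Finset.coe_powerset, Set.mem_preimage, Set.mem_powerset_iff, Finset.coe_subset]
      exact fun v hv => (mem_label.1 hv).1)
    (fun e he e' he' hl => he.eq_of_label h he' hl) V.powerset.finite_toSet
  rwa [Set.ncard_coe_finset, Finset.card_powerset] at this

/-- Propagation of a property from ends to all nodes through nodes with a single child. -/
theorem exists_end_of_step {T : PTree ρ} {V : Finset ℂ} (R : ℂ → ℂ → Prop) (hrefl : ∀ q, R q q)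
    (htrans : ∀ a b c, R a b → R b c → R a c)
    (hstep : ∀ q ∈ insert ρ T.N, q ∉ V → ∀ p, T.kids q = {p} → R q p) {q : ℂ}
    (hq : q ∈ insert ρ T.N) : ∃ e, T.IsEnd V e ∧ R q e := by
  classical
  by_contra! hcon
  obtain ⟨p, hp, hmax⟩ := ((insert ρ T.N).filter fun p => R q p).exists_max_image T.rk
    ⟨q, Finset.mem_filter.2 ⟨hq, hrefl q⟩⟩
  obtain ⟨hpN, hqp⟩ := Finset.mem_filter.1 hp
  have hne : ¬ T.IsEnd V p := fun h => hcon p h hqp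
  simp only [IsEnd, not_and, not_or, not_not] at hne
  obtain ⟨hpV, hcard⟩ := hne hpN
  obtain ⟨c, hc⟩ := Finset.card_eq_one.1 hcard
  have hcp : c ∈ T.kids p := by simp [hc]
  have := hmax c (Finset.mem_filter.2 ⟨Finset.mem_insert_of_mem (mem_kids.1 hcp).1,
    htrans _ _ _ hqp (hstep p hpN hpV c hc)⟩)
  exact absurd (rk_lt_of_mem_kids hcp) (not_lt.2 this)

end PTree

theorem exists_polar {z : ℂ} (h : ¬ ∃ t : ℝ, 0 ≤ t ∧ z = t) :
    ∃ s θ : ℝ, 0 < s ∧ 0 < θ ∧ θ < 2 * Real.pi ∧ z = s * Complex.exp (θ * Complex.I) := by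
  have hz : z ≠ 0 := fun h0 => h ⟨0, le_rfl, by simp [h0]⟩
  have hs : 0 < ‖z‖ := norm_pos_iff.2 hz
  have hpi := Real.pi_pos
  rcases lt_trichotomy (Complex.arg z) 0 with h0 | h0 | h0
  · refine ⟨‖z‖, Complex.arg z + 2 * Real.pi, hs, ?_, by linarith, ?_⟩
    · linarith [Complex.neg_pi_lt_arg z]
    · push_cast
      rw [add_mul, Complex.exp_add, Complex.exp_two_pi_mul_I, mul_one, Complex.norm_mul_exp_arg_mul_I]
  · exact absurd ⟨‖z‖, hs.le, by
      have := Complex.norm_mul_exp_arg_mul_I z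
      rw [h0] at this
      simpa using this.symm⟩ h
  · refine ⟨‖z‖, Complex.arg z, hs, h0, ?_, (Complex.norm_mul_exp_arg_mul_I z).symm⟩
    linarith [Complex.arg_le_pi z]

theorem polar_angle_eq {s s' θ θ' : ℝ} (hs : 0 < s) (hs' : 0 < s')
    (hd : |θ - θ'| < 2 * Real.pi)
    (h : (s : ℂ) * Complex.exp (θ * Complex.I) = s' * Complex.exp (θ' * Complex.I)) : θ = θ' := by
  have hn := congrArg norm h
  rw [norm_mul, norm_mul, Complex.norm_exp_ofReal_mul_I, Complex.norm_exp_ofReal_mul_I,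
    Complex.norm_of_nonneg hs.le, Complex.norm_of_nonneg hs'.le, mul_one, mul_one] at hn
  subst hn
  have h1 := mul_left_cancel₀ (by exact_mod_cast hs.ne' : (s : ℂ) ≠ 0) h
  obtain ⟨k, hk⟩ := Complex.exp_eq_exp_iff_exists_int.1 h1
  have hk' : θ = θ' + k * (2 * Real.pi) := by
    have := congrArg Complex.im hk
    simpa using this
  have hpi := Real.pi_pos
  have : k = 0 := by
    rw [hk', add_sub_cancel_left, abs_mul, abs_of_pos (by positivity : 0 < 2 * Real.pi)] at hd
    have : |(k : ℝ)| < 1 := by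
      by_contra! hk1
      nlinarith
    exact Int.abs_lt_one_iff.1 (by exact_mod_cast this)
  simpa [this] using hk'

namespace PTree

variable {ρ : ℂ}

open Classical in
/-- The direction of the edge going down from a node, which is the ray at the root. -/
noncomputable def up (T : PTree ρ) (q : ℂ) : ℂ := if q = ρ then 1 else T.par q - q

open Classical in
/-- The directions of the edges at a node. -/
noncomputable def dirs (T : PTree ρ) (q : ℂ) : Finset ℂ :=
  insert (T.up q) ((T.kids q).image fun p => p - q)

theorem card_dirs_le (T : PTree ρ) (q : ℂ) : (T.dirs q).card ≤ (T.kids q).card + 1 := by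
  classical
  exact (Finset.card_insert_le _ _).trans (Nat.add_le_add_right Finset.card_image_le 1)

theorem mem_dirs {T : PTree ρ} {q d : ℂ} :
    d ∈ T.dirs q ↔ d = T.up q ∨ ∃ p ∈ T.kids q, d = p - q := by
  classical simp [dirs, eq_comm]

theorem up_root (T : PTree ρ) : T.up ρ = 1 := by simp [up]

theorem up_of_mem (T : PTree ρ) {q : ℂ} (hq : q ∈ T.N) : T.up q = T.par q - q := by
  rw [up, if_neg]
  rintro rfl
  exact T.root_not_mem hq

theorem up_ne_zero (T : PTree ρ) {q : ℂ} (hq : q ∈ insert ρ T.N) : T.up q ≠ 0 := by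
  rcases Finset.mem_insert.1 hq with rfl | hq
  · simp [up_root]
  · rw [T.up_of_mem hq]
    exact sub_ne_zero.2 (T.ne_par hq).symm

theorem ne_of_mem_kids {T : PTree ρ} {p q : ℂ} (hp : p ∈ T.kids q) : p ≠ q := by
  obtain ⟨h, rfl⟩ := mem_kids.1 hp
  exact T.ne_par h

/-- Inside the disk of radius `r` around `q` the tree looks like a union of rays. -/
def Conic (T : PTree ρ) (q : ℂ) (r : ℝ) : Prop :=
  ∀ z, ‖z - q‖ < r → (z ∈ T.carrier ↔ ∃ d ∈ T.dirs q, ∃ t : ℝ, 0 ≤ t ∧ z = q + t * d)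

theorem Conic.mono {T : PTree ρ} {q : ℂ} {r r' : ℝ} (h : T.Conic q r) (hr : r' ≤ r) :
    T.Conic q r' := fun z hz => h z (hz.trans_le hr)

theorem exists_conic (T : PTree ρ) {q : ℂ} (hq : q ∈ insert ρ T.N) : ∃ r > 0, T.Conic q r := by
  classical
  obtain ⟨r₁, hr₁, h₁⟩ : ∃ r > 0, ∀ p ∈ T.N, q ∉ segment ℝ p (T.par p) →
      ∀ z ∈ segment ℝ p (T.par p), r ≤ ‖z - q‖ := by
    have hcl : IsClosed (⋃ p ∈ T.N.filter fun p => q ∉ segment ℝ p (T.par p),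
        segment ℝ p (T.par p)) :=
      (T.N.filter _).finite_toSet.isClosed_biUnion fun p _ => isClosed_segment_complex _ _
    obtain ⟨r, hr, h⟩ := exists_pos_forall_le_norm_sub (isCompact_singleton (x := q)) hcl (by
      rw [Set.disjoint_singleton_left]
      simp only [Set.mem_iUnion, not_exists]
      exact fun p hp => (Finset.mem_filter.1 hp).2)
    refine ⟨r, hr, fun p hp hqp z hz => h q rfl z ?_⟩
    exact Set.mem_biUnion (Finset.mem_coe.2 (Finset.mem_filter.2 ⟨hp, hqp⟩)) hz
  obtain ⟨r₂, hr₂, h₂⟩ : ∃ r > 0, q ≠ ρ → ∀ z ∈ rightRay ρ, r ≤ ‖z - q‖ := by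
    by_cases hqρ : q = ρ
    · exact ⟨1, one_pos, fun h => absurd hqρ h⟩
    · obtain ⟨r, hr, h⟩ := exists_pos_forall_le_norm_sub (isCompact_singleton (x := q))
        (isClosed_rightRay ρ) (Set.disjoint_singleton_left.2
          (T.not_mem_ray ((Finset.mem_insert.1 hq).resolve_left hqρ)))
      exact ⟨r, hr, fun _ => h q rfl⟩
  obtain ⟨r₃, hr₃, h₃⟩ : ∃ r > 0, ∀ p ∈ T.kids q, r ≤ ‖p - q‖ := by
    obtain ⟨r, hr, h⟩ := exists_pos_forall_le_norm_sub (isCompact_singleton (x := q))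
      (T.kids q).finite_toSet.isClosed (Set.disjoint_singleton_left.2 fun h =>
        ne_of_mem_kids (Finset.mem_coe.1 h) rfl)
    exact ⟨r, hr, fun p hp => h q rfl p hp⟩
  have hup : 0 < ‖T.up q‖ := norm_pos_iff.2 (T.up_ne_zero hq)
  refine ⟨min (min r₁ r₂) (min r₃ ‖T.up q‖), by positivity, fun z hz => ?_⟩
  have hz1 : ‖z - q‖ < r₁ := hz.trans_le ((min_le_left _ _).trans (min_le_left _ _))
  have hz2 : ‖z - q‖ < r₂ := hz.trans_le ((min_le_left _ _).trans (min_le_right _ _))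
  have hz3 : ‖z - q‖ < r₃ := hz.trans_le ((min_le_right _ _).trans (min_le_left _ _))
  have hz4 : ‖z - q‖ < ‖T.up q‖ := hz.trans_le ((min_le_right _ _).trans (min_le_right _ _))
  constructor
  · intro hzT
    rcases mem_carrier.1 hzT with h | ⟨p, hp, h⟩
    · have hqρ : q = ρ := by
        by_contra hne
        exact absurd hz2 (not_lt.2 (h₂ hne z h))
      obtain ⟨t, ht, rfl⟩ := h
      exact ⟨T.up q, mem_dirs.2 (Or.inl rfl), t, ht, by rw [hqρ, up_root, mul_one]⟩
    · have hqp : q ∈ segment ℝ p (T.par p) := by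
        by_contra hne
        exact absurd hz1 (not_lt.2 (h₁ p hp hne z h.1))
      obtain ⟨t, ht0, ht1, rfl⟩ := (mem_hseg_iff_exists (T.ne_par hp)).1 h
      by_cases hqpar : q = T.par p
      · refine ⟨p - q, mem_dirs.2 (Or.inr ⟨p, mem_kids.2 ⟨hp, hqpar.symm⟩, rfl⟩), 1 - t,
          by linarith, ?_⟩
        rw [hqpar]
        push_cast
        ring
      · rcases Finset.mem_insert.1 hq with hqρ | hqN
        · exfalso
          exact (T.disj_ray p hp).le_bot ⟨⟨hqp, hqpar⟩, hqρ ▸ self_mem_rightRay ρ⟩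
        · have : q = p := T.eq_of_mem_hseg hqN hp (left_mem_hseg (T.ne_par hqN)) ⟨hqp, hqpar⟩
          subst this
          exact ⟨T.up q, mem_dirs.2 (Or.inl rfl), t, ht0, by rw [T.up_of_mem hqN]⟩
  · rintro ⟨d, hd, t, ht, rfl⟩
    rw [add_sub_cancel_left, norm_mul, Complex.norm_of_nonneg ht] at hz3 hz4
    rcases mem_dirs.1 hd with rfl | ⟨p, hp, rfl⟩
    · have ht1 : t < 1 := by
        by_contra! h
        nlinarith
      rcases Finset.mem_insert.1 hq with rfl | hqN
      · exact Or.inl ⟨t, ht, by rw [up_root, mul_one]⟩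
      · refine T.segment_subset hqN (mem_segment_iff_exists.2 ⟨t, ht, ht1.le, ?_⟩)
        rw [T.up_of_mem hqN]
    · have h3 := h₃ p hp
      have hpq : 0 < ‖p - q‖ := norm_pos_iff.2 (sub_ne_zero.2 (ne_of_mem_kids hp))
      have ht1 : t < 1 := by
        by_contra! h
        nlinarith
      obtain ⟨hpN, rfl⟩ := mem_kids.1 hp
      refine T.segment_subset hpN (mem_segment_iff_exists.2 ⟨1 - t, by linarith, by linarith, ?_⟩)
      push_cast
      ring

/-- In which of the sectors at `q` a point lies. -/
noncomputable def code (T : PTree ρ) (q x : ℂ) : T.dirs q → SignType :=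
  fun d => SignType.sign ((x - q) / d.1).im

theorem Conic.segment_disjoint {T : PTree ρ} {q : ℂ} (hq : q ∈ insert ρ T.N) {r : ℝ}
    (h : T.Conic q r) {x y : ℂ}
    (hx : ‖x - q‖ < r) (hy : ‖y - q‖ < r) (hxT : x ∉ T.carrier) (hyT : y ∉ T.carrier)
    (hc : T.code q x = T.code q y) : ∀ z ∈ segment ℝ x y, z ∉ T.carrier := by
  intro z hz hzT
  have hzr : ‖z - q‖ < r := by
    have := (convex_ball q r).segment_subset (by simpa [dist_eq_norm] using hx)
      (by simpa [dist_eq_norm] using hy) hz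
    simpa [dist_eq_norm] using this
  obtain ⟨d, hd, t, ht, hzt⟩ := (h z hzr).1 hzT
  obtain ⟨u, hu0, hu1, hzu⟩ := mem_segment_iff_exists.1 hz
  have hd0 : d ≠ 0 := by
    rcases mem_dirs.1 hd with rfl | ⟨p, hp, rfl⟩
    · exact T.up_ne_zero hq
    · exact sub_ne_zero.2 (ne_of_mem_kids hp)
  have hsign : SignType.sign ((x - q) / d).im = SignType.sign ((y - q) / d).im :=
    congrFun hc ⟨d, hd⟩
  have hcomb : (t : ℂ) = (1 - u : ℝ) * ((x - q) / d) + (u : ℝ) * ((y - q) / d) := by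
    have : (t : ℂ) = (z - q) / d := by
      rw [hzt]; field_simp; ring
    rw [this, hzu]
    push_cast
    field_simp
    ring
  have him := congrArg Complex.im hcomb
  have hre := congrArg Complex.re hcomb
  simp only [Complex.ofReal_im, Complex.ofReal_re, Complex.add_im, Complex.add_re,
    Complex.im_ofReal_mul, Complex.re_ofReal_mul] at him hre
  have hout : ∀ w : ℂ, ‖w - q‖ < r → w ∉ T.carrier → ((w - q) / d).im = 0 → ((w - q) / d).re < 0 := by
    intro w hw hwT h0
    by_contra! hre
    refine hwT ((h w hw).2 ⟨d, hd, ((w - q) / d).re, hre, ?_⟩)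
    have : (((w - q) / d).re : ℂ) = (w - q) / d := Complex.ext (by simp) (by simp [h0])
    rw [this]
    field_simp
    ring
  rcases lt_trichotomy ((x - q) / d).im 0 with hx0 | hx0 | hx0
  · rw [sign_neg hx0, eq_comm, sign_eq_neg_one_iff] at hsign
    rcases hu0.eq_or_lt with rfl | hu
    · simp at him; linarith
    · nlinarith [mul_pos_of_neg_of_neg hx0 hsign, mul_neg_of_pos_of_neg hu hsign,
        mul_nonpos_of_nonneg_of_nonpos (sub_nonneg.2 hu1) hx0.le]
  · rw [hx0, sign_zero, eq_comm, sign_eq_zero_iff] at hsign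
    have h1 := hout x hx hxT hx0
    have h2 := hout y hy hyT hsign
    rcases hu0.eq_or_lt with rfl | hu
    · simp at hre; linarith
    · nlinarith [mul_neg_of_pos_of_neg hu h2,
        mul_nonpos_of_nonneg_of_nonpos (sub_nonneg.2 hu1) h1.le]
  · rw [sign_pos hx0, eq_comm, sign_eq_one_iff] at hsign
    rcases hu0.eq_or_lt with rfl | hu
    · simp at him; linarith
    · nlinarith [mul_pos hu hsign, mul_nonneg (sub_nonneg.2 hu1) hx0.le]

end PTree

namespace PTree

variable {ρ : ℂ}

theorem up_ne_smul (T : PTree ρ) {p q : ℂ} (hq : q ∈ insert ρ T.N) (hp : p ∈ T.kids q) {c : ℝ}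
    (hc : 0 < c) : T.up q ≠ c * (p - q) := by
  intro h
  obtain ⟨hpN, hpq⟩ := mem_kids.1 hp
  set s : ℝ := min 1 c / 2 with hs
  have hmin : 0 < min 1 c := by positivity
  have hs0 : 0 < s := by positivity
  have hs1 : s < 1 := by linarith [min_le_left 1 c]
  have hsc : s < c := by linarith [min_le_right 1 c]
  have hmem : q + s * (p - q) ∈ hseg p (T.par p) := by
    refine (mem_hseg_iff_exists (T.ne_par hpN)).2 ⟨1 - s, by linarith, by linarith, ?_⟩
    rw [hpq]
    push_cast
    ring
  have hc' : (c : ℂ) ≠ 0 := by exact_mod_cast hc.ne'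
  have heq : (s : ℂ) * (p - q) = (s / c : ℝ) * T.up q := by
    rw [h]; push_cast; field_simp
  rcases Finset.mem_insert.1 hq with rfl | hqN
  · refine (T.disj_ray p hpN).le_bot ⟨hmem, s / c, by positivity, ?_⟩
    rw [heq, up_root, mul_one]
  · have : q + s * (p - q) ∈ hseg q (T.par q) := by
      refine (mem_hseg_iff_exists (T.ne_par hqN)).2 ⟨s / c, by positivity,
        (div_lt_one hc).2 hsc, ?_⟩
      rw [heq, T.up_of_mem hqN]
    have := T.eq_of_mem_hseg hpN hqN hmem this
    exact ne_of_mem_kids hp this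

/-- Around a node with a single child any point off the tree can be rotated towards the edge
to the child. -/
theorem Conic.exists_joinedIn {T : PTree ρ} {p q : ℂ} (hq : q ∈ insert ρ T.N)
    (hkids : T.kids q = {p}) {r : ℝ} (h : T.Conic q r) {x : ℂ} (hx : ‖x - q‖ < r)
    (hxT : x ∉ T.carrier) {s : ℝ} (hs : 0 < s) (hsr : s * ‖p - q‖ < r) {U : Set ℂ}
    (hU : U ∈ nhds (q + s * (p - q))) :
    ∃ y ∈ U, JoinedIn (Metric.ball q r ∩ T.carrierᶜ) x y := by
  have hp : p ∈ T.kids q := by simp [hkids]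
  have hpq : p - q ≠ 0 := sub_ne_zero.2 (ne_of_mem_kids hp)
  have hpd : p - q ∈ T.dirs q := mem_dirs.2 (Or.inr ⟨p, hp, rfl⟩)
  obtain ⟨sx, θ, hsx, hθ0, hθ1, hxe⟩ : ∃ s θ : ℝ, 0 < s ∧ 0 < θ ∧ θ < 2 * Real.pi ∧
      (x - q) / (p - q) = s * Complex.exp (θ * Complex.I) := by
    refine exists_polar fun ⟨t, ht, hxt⟩ => hxT ((h x hx).2 ⟨p - q, hpd, t, ht, ?_⟩)
    rw [div_eq_iff hpq] at hxt
    linear_combination hxt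
  obtain ⟨su, φ, hsu, hφ0, hφ1, hue⟩ : ∃ s θ : ℝ, 0 < s ∧ 0 < θ ∧ θ < 2 * Real.pi ∧
      T.up q / (p - q) = s * Complex.exp (θ * Complex.I) := by
    refine exists_polar fun ⟨t, ht, hut⟩ => ?_
    rw [div_eq_iff hpq] at hut
    rcases ht.eq_or_lt with rfl | ht
    · exact T.up_ne_zero hq (by simpa using hut)
    · exact T.up_ne_smul hq hp ht hut
  have hup : T.up q = su * Complex.exp (φ * Complex.I) * (p - q) := by
    rw [← hue]; field_simp
  have hxeq : x = q + sx * Complex.exp (θ * Complex.I) * (p - q) := by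
    rw [← hxe]; field_simp; ring
  have hθφ : θ ≠ φ := by
    rintro rfl
    refine hxT ((h x hx).2 ⟨T.up q, mem_dirs.2 (Or.inl rfl), sx / su, by positivity, ?_⟩)
    rw [hup, hxeq]
    have : (su : ℂ) ≠ 0 := by exact_mod_cast hsu.ne'
    push_cast
    field_simp
  have hsxr : sx * ‖p - q‖ < r := by
    have : x - q = sx * Complex.exp (θ * Complex.I) * (p - q) := by rw [hxeq]; ring
    rwa [this, norm_mul, norm_mul, Complex.norm_exp_ofReal_mul_I, mul_one,
      Complex.norm_of_nonneg hsx.le] at hx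
  have hT : ∀ a b : ℝ, 0 < a → a * ‖p - q‖ < r → 0 < b → b < 2 * Real.pi → b ≠ φ →
      q + a * Complex.exp (b * Complex.I) * (p - q) ∈ Metric.ball q r ∩ T.carrierᶜ := by
    intro a b ha har hb0 hb1 hbφ
    have hn : ‖q + a * Complex.exp (b * Complex.I) * (p - q) - q‖ < r := by
      rwa [add_sub_cancel_left, norm_mul, norm_mul, Complex.norm_exp_ofReal_mul_I, mul_one,
        Complex.norm_of_nonneg ha.le]
    refine ⟨by simpa [dist_eq_norm] using hn, fun hmem => ?_⟩
    obtain ⟨d, hd, t, ht, hzt⟩ := (h _ hn).1 hmem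
    have hzt' := add_left_cancel hzt
    have ht0 : 0 < t := by
      refine lt_of_le_of_ne ht ?_
      rintro rfl
      rw [Complex.ofReal_zero, zero_mul] at hzt'
      have ha' : (a : ℂ) ≠ 0 := by exact_mod_cast ha.ne'
      simp [ha', hpq, Complex.exp_ne_zero] at hzt'
    rcases mem_dirs.1 hd with rfl | ⟨p', hp', rfl⟩
    · rw [hup, ← mul_assoc, ← mul_assoc] at hzt'
      have h1 := mul_right_cancel₀ hpq hzt'
      rw [← Complex.ofReal_mul] at h1
      refine hbφ (polar_angle_eq ha (mul_pos ht0 hsu) ?_ h1)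
      rw [abs_lt]; constructor <;> linarith
    · have : p' = p := by simpa [hkids] using hp'
      subst this
      have h1 := mul_right_cancel₀ hpq hzt'
      have h2 : (a : ℂ) * Complex.exp (b * Complex.I) = t * Complex.exp ((0 : ℝ) * Complex.I) := by
        simpa using h1
      have := polar_angle_eq ha ht0 (by rw [abs_lt]; constructor <;> linarith) h2
      linarith
  have hjoin : ∀ θ' : ℝ, 0 < θ' → θ' < 2 * Real.pi → ((θ < φ ∧ θ' < φ) ∨ (φ < θ ∧ φ < θ')) →
      JoinedIn (Metric.ball q r ∩ T.carrierᶜ) x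
        (q + s * Complex.exp (θ' * Complex.I) * (p - q)) := by
    intro θ' h0 h1 hside
    have hcvx : ∀ a b t : ℝ, t ∈ Set.Icc (0 : ℝ) 1 → ∀ c, (a < c → b < c → (1 - t) * a + t * b < c) ∧
        (c < a → c < b → c < (1 - t) * a + t * b) := by
      intro a b t ht c
      have h1t : 0 ≤ 1 - t := by linarith [ht.2]
      constructor
      · intro ha hb
        rcases ht.1.eq_or_lt with rfl | h
        · simpa using ha
        · nlinarith [mul_pos h (sub_pos.2 hb), mul_nonneg h1t (sub_pos.2 ha).le]
      · intro ha hb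
        rcases ht.1.eq_or_lt with rfl | h
        · simpa using ha
        · nlinarith [mul_pos h (sub_pos.2 hb), mul_nonneg h1t (sub_pos.2 ha).le]
    refine ⟨⟨⟨fun t : I => q + (((1 - (t : ℝ)) * sx + t * s : ℝ) : ℂ) *
      Complex.exp ((((1 - (t : ℝ)) * θ + t * θ' : ℝ) : ℂ) * Complex.I) * (p - q), by fun_prop⟩,
      by simp [hxeq], by simp⟩, fun t => ?_⟩
    refine hT _ _ ((hcvx sx s t t.2 0).2 hsx hs) ?_ ((hcvx θ θ' t t.2 0).2 hθ0 h0)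
      ((hcvx θ θ' t t.2 _).1 hθ1 h1) ?_
    · have := (hcvx (sx * ‖p - q‖) (s * ‖p - q‖) t t.2 r).1 hsxr hsr
      linarith
    · rcases hside with ⟨h2, h3⟩ | ⟨h2, h3⟩
      · exact ((hcvx θ θ' t t.2 φ).1 h2 h3).ne
      · exact ((hcvx θ θ' t t.2 φ).2 h2 h3).ne'
  have hcont : ∀ θ₀ : ℝ, Complex.exp (θ₀ * Complex.I) = 1 → ∃ δ > 0, ∀ θ' : ℝ, |θ' - θ₀| < δ →
      q + s * Complex.exp (θ' * Complex.I) * (p - q) ∈ U := by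
    intro θ₀ h0
    have hc : Continuous fun θ' : ℝ => q + s * Complex.exp (θ' * Complex.I) * (p - q) := by fun_prop
    have := hc.continuousAt.preimage_mem_nhds (t := U) (x := θ₀) (by simpa [h0] using hU)
    obtain ⟨δ, hδ, hδU⟩ := Metric.mem_nhds_iff.1 this
    exact ⟨δ, hδ, fun θ' hθ' => hδU (by simpa [Real.dist_eq] using hθ')⟩
  rcases lt_or_gt_of_ne hθφ with hlt | hgt
  · obtain ⟨δ, hδ, hδU⟩ := hcont 0 (by simp)
    have hm : 0 < min δ φ := lt_min hδ hφ0
    refine ⟨_, hδU (min δ φ / 2) ?_, hjoin (min δ φ / 2) (by linarith) ?_ (Or.inl ⟨hlt, ?_⟩)⟩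
    · rw [sub_zero, abs_of_pos (by linarith)]
      linarith [min_le_left δ φ]
    · linarith [min_le_right δ φ]
    · linarith [min_le_right δ φ]
  · obtain ⟨δ, hδ, hδU⟩ := hcont (2 * Real.pi) (by
      push_cast
      exact Complex.exp_two_pi_mul_I)
    have hm : 0 < min δ (2 * Real.pi - φ) := lt_min hδ (by linarith)
    have h1 := min_le_left δ (2 * Real.pi - φ)
    have h2 := min_le_right δ (2 * Real.pi - φ)
    refine ⟨_, hδU (2 * Real.pi - min δ (2 * Real.pi - φ) / 2) ?_,
      hjoin (2 * Real.pi - min δ (2 * Real.pi - φ) / 2) (by linarith) (by linarith)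
        (Or.inr ⟨hgt, by linarith⟩)⟩
    rw [sub_sub_cancel_left, abs_neg, abs_of_pos (by linarith)]
    linarith

/-- An open rectangle around the middle part of the edge below `p`. -/
def tube (T : PTree ρ) (p : ℂ) (s ε : ℝ) : Set ℂ :=
  {z | s < ((z - p) / (T.par p - p)).re ∧ ((z - p) / (T.par p - p)).re < 1 - s ∧
    |((z - p) / (T.par p - p)).im| < ε}

theorem isOpen_tube (T : PTree ρ) (p : ℂ) (s ε : ℝ) : IsOpen (T.tube p s ε) := by
  have hc : Continuous fun z => (z - p) / (T.par p - p) := by fun_prop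
  exact (isOpen_lt continuous_const (Complex.continuous_re.comp hc)).inter
    ((isOpen_lt (Complex.continuous_re.comp hc) continuous_const).inter
      (isOpen_lt (Complex.continuous_im.comp hc).abs continuous_const))

theorem convex_tube (T : PTree ρ) (p : ℂ) (s ε : ℝ) : Convex ℝ (T.tube p s ε) := by
  have hd : ∀ x y : ℂ, ∀ a b : ℝ, a + b = 1 → (a • x + b • y - p) / (T.par p - p) =
      a * ((x - p) / (T.par p - p)) + b * ((y - p) / (T.par p - p)) := by
    intro x y a b hab
    have : a • x + b • y - p = a * (x - p) + b * (y - p) := by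
      have : (a : ℂ) + b = 1 := by exact_mod_cast hab
      simp only [Complex.real_smul]
      linear_combination p * this
    rw [this]
    ring
  rintro x ⟨hx1, hx2, hx3⟩ y ⟨hy1, hy2, hy3⟩ a b ha hb hab
  rw [abs_lt] at hx3 hy3
  have key : ∀ u v c : ℝ, u < c → v < c → a * u + b * v < c := by
    intro u v c hu hv
    rcases ha.eq_or_lt with rfl | ha'
    · have : b = 1 := by linarith
      simpa [this]
    · have hb' : b = 1 - a := by linarith
      subst hb'
      nlinarith [mul_pos ha' (sub_pos.2 hu), mul_nonneg hb (sub_pos.2 hv).le]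
  simp only [tube, Set.mem_ofPred_eq, hd x y a b hab, Complex.add_re, Complex.add_im,
    Complex.re_ofReal_mul, Complex.im_ofReal_mul, abs_lt]
  refine ⟨?_, key _ _ _ hx2 hy2, ?_, key _ _ _ hx3.2 hy3.2⟩
  · have := key _ _ _ (neg_lt_neg hx1) (neg_lt_neg hy1); linarith
  · have := key _ _ _ (neg_lt_neg hx3.1) (neg_lt_neg hy3.1); linarith

theorem exists_tube (T : PTree ρ) {p : ℂ} (hp : p ∈ T.N) {s : ℝ} (hs : 0 < s) :
    ∃ ε > 0, ∀ z ∈ T.tube p s ε, (z ∈ T.carrier ↔ ((z - p) / (T.par p - p)).im = 0) := by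
  classical
  have hd : T.par p - p ≠ 0 := sub_ne_zero.2 (T.ne_par hp).symm
  have hdn : 0 < ‖T.par p - p‖ := norm_pos_iff.2 hd
  have hcl : IsClosed (rightRay ρ ∪ ⋃ q ∈ T.N.erase p, segment ℝ q (T.par q)) :=
    (isClosed_rightRay ρ).union ((T.N.erase p).finite_toSet.isClosed_biUnion fun q _ =>
      isClosed_segment_complex _ _)
  have hK : IsCompact ((fun t : ℝ => p + t * (T.par p - p)) '' Set.Icc s (1 - s)) :=
    isCompact_Icc.image (by fun_prop)
  obtain ⟨r, hr, h⟩ := exists_pos_forall_le_norm_sub hK hcl (by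
    rw [Set.disjoint_left]
    rintro z ⟨t, ht, rfl⟩ hz
    have hmem : p + t * (T.par p - p) ∈ hseg p (T.par p) :=
      (mem_hseg_iff_exists (T.ne_par hp)).2 ⟨t, hs.le.trans ht.1, by linarith [ht.2], rfl⟩
    rcases hz with hz | hz
    · exact (T.disj_ray p hp).le_bot ⟨hmem, hz⟩
    · simp only [Set.mem_iUnion] at hz
      obtain ⟨q, hq, hz⟩ := hz
      obtain ⟨hqp, hqN⟩ := Finset.mem_erase.1 hq
      by_cases hzq : p + t * (T.par p - p) = T.par q
      · rcases Finset.mem_insert.1 (T.par_mem q hqN) with h1 | h1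
        · exact (T.disj_ray p hp).le_bot ⟨hmem, by rw [hzq, h1]; exact self_mem_rightRay ρ⟩
        · have := T.eq_of_mem_hseg h1 hp (left_mem_hseg (T.ne_par h1))
            (by rw [← hzq]; exact hmem)
          rw [this] at hzq
          have h2 : (t : ℂ) * (T.par p - p) = 0 := by linear_combination hzq
          rcases mul_eq_zero.1 h2 with h3 | h3
          · have : t = 0 := by exact_mod_cast h3
            linarith [ht.1]
          · exact hd h3
      · exact hqp (T.eq_of_mem_hseg hqN hp ⟨hz, hzq⟩ hmem))
  refine ⟨r / ‖T.par p - p‖, by positivity, fun z hz => ?_⟩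
  set ζ := (z - p) / (T.par p - p) with hζ
  have hzζ : z = p + ζ * (T.par p - p) := by rw [hζ]; field_simp; ring
  obtain ⟨h1, h2, h3⟩ := hz
  constructor
  · intro hzT
    have hnot : z ∉ rightRay ρ ∪ ⋃ q ∈ T.N.erase p, segment ℝ q (T.par q) := by
      intro hzc
      have := h _ ⟨ζ.re, ⟨h1.le, h2.le⟩, rfl⟩ z hzc
      have heq : z - (p + ζ.re * (T.par p - p)) = (ζ.im * Complex.I) * (T.par p - p) := by
        conv_lhs => rw [hzζ]
        have := Complex.re_add_im ζ
        linear_combination (-(T.par p - p)) * this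
      rw [heq, norm_mul, norm_mul, Complex.norm_I, mul_one, Complex.norm_real, Real.norm_eq_abs] at this
      rw [lt_div_iff₀ hdn] at h3
      linarith
    rcases mem_carrier.1 hzT with hz | ⟨q, hq, hz⟩
    · exact absurd (Or.inl hz) hnot
    · by_cases hqp : q = p
      · subst hqp
        obtain ⟨t, -, -, hzt⟩ := (mem_hseg_iff_exists (T.ne_par hq)).1 hz
        have : ζ = t := by rw [hζ, hzt]; field_simp; ring
        simp [this]
      · exact absurd (Or.inr (Set.mem_biUnion (Finset.mem_coe.2 (Finset.mem_erase.2 ⟨hqp, hq⟩)) hz.1)) hnot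
  · intro him
    refine T.hseg_subset hp ((mem_hseg_iff_exists (T.ne_par hp)).2 ⟨ζ.re, by linarith, by linarith, ?_⟩)
    conv_lhs => rw [hzζ]
    rw [show (ζ.re : ℂ) = ζ from Complex.ext (by simp) (by simp [him])]

end PTree

/-- The plane punctured at the points of `V`. -/
abbrev Punc (V : Finset ℂ) := {z : ℂ // z ∉ V}

/-- A subset of the plane seen in the punctured plane. -/
def pLift (V : Finset ℂ) (S : Set ℂ) : Set (Punc V) := Subtype.val ⁻¹' S

theorem JoinedIn.exists_inS {V : Finset ℂ} {S : Set ℂ} (hS : ∀ v ∈ V, v ∉ S) {x y : Punc V}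
    (h : JoinedIn S (x : ℂ) y) : ∃ δ : Path.Homotopic.Quotient x y, InS (pLift V S) δ := by
  obtain ⟨γ, hγ⟩ := h
  exact ⟨_, ⟨⟨⟨fun t => ⟨γ t, fun hv => hS _ hv (hγ t)⟩, by fun_prop⟩, by simp, by simp⟩, hγ, rfl⟩⟩

theorem joinedIn_of_segment_subset {S : Set ℂ} {x y : ℂ} (h : segment ℝ x y ⊆ S) :
    JoinedIn S x y :=
  (((convex_segment x y).isPathConnected ⟨x, left_mem_segment ℝ x y⟩).joinedIn x
    (left_mem_segment ℝ x y) y (right_mem_segment ℝ x y)).mono h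

theorem thin_lift {V : Finset ℂ} {S : Set ℂ} [SimplyConnectedSpace S] (hS : ∀ v ∈ V, v ∉ S) :
    Thin (pLift V S) := by
  let i : C(S, Punc V) := ⟨fun z => ⟨z, fun hv => hS _ hv z.2⟩, by fun_prop⟩
  refine thin_of_simplyConnectedSpace i ?_ (fun z hz => ⟨⟨z, hz⟩, rfl⟩) ?_
  · refine ⟨?_⟩
    exact (induced_compose (f := i) (g := (Subtype.val : Punc V → ℂ))).symm
  · intro a b h
    exact Subtype.ext (congrArg (Subtype.val : Punc V → ℂ) h)

theorem thin_lift_of_convex {V : Finset ℂ} {S : Set ℂ} (hc : Convex ℝ S) (hS : ∀ v ∈ V, v ∉ S) :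
    Thin (pLift V S) := by
  intro x y m m' hm hm'
  have := hc.contractibleSpace ⟨x, hm.source⟩
  exact thin_lift hS m m' hm hm'

theorem exists_inS_of_convex {V : Finset ℂ} {S : Set ℂ} (hc : Convex ℝ S) (hS : ∀ v ∈ V, v ∉ S)
    {x y : Punc V} (hx : x ∈ pLift V S) (hy : y ∈ pLift V S) :
    ∃ δ : Path.Homotopic.Quotient x y, InS (pLift V S) δ :=
  (joinedIn_of_segment_subset (hc.segment_subset hx hy)).exists_inS hS

namespace PTree

variable {ρ : ℂ}

theorem thin_compl (T : PTree ρ) {V : Finset ℂ} (hV : ∀ v ∈ V, v ∈ insert ρ T.N) :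
    Thin (pLift V T.carrierᶜ) := by
  have h := isSimplyConnected_compl _ T rfl
  have : SimplyConnectedSpace ↥(T.carrierᶜ) := h.simplyConnectedSpace
  exact thin_lift fun v hv hvT => hvT (T.node_mem (hV v hv))

/-- The loop classes obtained by crossing the tree near a node outside `V`. -/
def gens (T : PTree ρ) (V : Finset ℂ) (r : ℝ) (b : Punc V) : Set (Path.Homotopic.Quotient b b) :=
  {Path.Homotopic.Quotient.refl b} ∪ ⋃ q ∈ {q | q ∈ insert ρ T.N ∧ q ∉ V},
    crossSet (pLift V T.carrierᶜ) (pLift V (Metric.ball q r)) b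

/-- A bound for the number of generators. -/
def genBound (n : ℕ) : ℕ := 1 + 2 ^ n * ((3 ^ (n + 1)) ^ 2 + 3 ^ 2)

theorem finite_crossSet_ball (T : PTree ρ) {V : Finset ℂ} (hV : ∀ v ∈ V, v ∈ insert ρ T.N)
    (hprune : T.Pruned V) {r : ℝ} {q : ℂ} (hq : q ∈ insert ρ T.N) (hconic : T.Conic q r)
    (hfree : ∀ v ∈ V, v ∉ Metric.ball q r) (b : Punc V) :
    (crossSet (pLift V T.carrierᶜ) (pLift V (Metric.ball q r)) b).Finite ∧
    (crossSet (pLift V T.carrierᶜ) (pLift V (Metric.ball q r)) b).ncard ≤ (3 ^ (V.card + 1)) ^ 2 := by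
  classical
  obtain ⟨h1, h2⟩ := finite_crossSet (T.thin_compl hV)
    (thin_lift_of_convex (convex_ball q r) hfree) b (fun x => T.code q x.1) (by
      intro x hx y hy hc
      have hx1 : ‖x.1 - q‖ < r := by simpa [pLift, dist_eq_norm] using hx.1
      have hy1 : ‖y.1 - q‖ < r := by simpa [pLift, dist_eq_norm] using hy.1
      have hseg := hconic.segment_disjoint hq hx1 hy1 hx.2 hy.2 hc
      refine JoinedIn.exists_inS (S := Metric.ball q r ∩ T.carrierᶜ) (fun v hv h => hfree v hv h.1)
        (joinedIn_of_segment_subset fun z hz => ⟨?_, hseg z hz⟩)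
      exact (convex_ball q r).segment_subset hx.1 hy.1 hz)
  refine ⟨h1, h2.trans (Nat.pow_le_pow_left ?_ 2)⟩
  rw [Fintype.card_fun, Fintype.card_coe]
  have : Fintype.card SignType = 3 := rfl
  rw [this]
  exact Nat.pow_le_pow_right (by norm_num)
    ((T.card_dirs_le q).trans (Nat.add_le_add_right (hprune.card_kids_le q) 1))

theorem sub_div_smul_add {p d x y : ℂ} (a b : ℝ) (hab : a + b = 1) :
    ((a • x + b • y - p) / d).im = a * ((x - p) / d).im + b * ((y - p) / d).im := by
  have : (a • x + b • y - p) / d = a * ((x - p) / d) + b * ((y - p) / d) := by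
    have h : (a : ℂ) + b = 1 := by exact_mod_cast hab
    simp only [Complex.real_smul]
    linear_combination (p / d) * h
  rw [this]
  simp

theorem segment_tube {T : PTree ρ} {p : ℂ} {s ε : ℝ}
    (htube : ∀ z ∈ T.tube p s ε, (z ∈ T.carrier ↔ ((z - p) / (T.par p - p)).im = 0)) {x y : ℂ}
    (hx : x ∈ T.tube p s ε) (hy : y ∈ T.tube p s ε)
    (h : 0 < ((x - p) / (T.par p - p)).im * ((y - p) / (T.par p - p)).im) :
    segment ℝ x y ⊆ T.tube p s ε ∩ T.carrierᶜ := by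
  intro z hz
  have hzt := (T.convex_tube p s ε).segment_subset hx hy hz
  refine ⟨hzt, fun hzT => ?_⟩
  have h0 := (htube z hzt).1 hzT
  obtain ⟨a, b, ha, hb, hab, rfl⟩ := hz
  rw [sub_div_smul_add a b hab] at h0
  set u := ((x - p) / (T.par p - p)).im
  set v := ((y - p) / (T.par p - p)).im
  have hb' : b = 1 - a := by linarith
  subst hb'
  rcases pos_and_pos_or_neg_and_neg_of_mul_pos h with ⟨h1, h2⟩ | ⟨h1, h2⟩
  · rcases ha.eq_or_lt with rfl | ha
    · simp at h0; linarith
    · nlinarith [mul_pos ha h1, mul_nonneg hb h2.le]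
  · rcases ha.eq_or_lt with rfl | ha
    · simp at h0; linarith
    · nlinarith [mul_neg_of_pos_of_neg ha h1, mul_nonpos_of_nonneg_of_nonpos hb h2.le]

theorem finite_crossSet_tube (T : PTree ρ) {V : Finset ℂ} (hV : ∀ v ∈ V, v ∈ insert ρ T.N)
    {p : ℂ} {s ε : ℝ} (htube : ∀ z ∈ T.tube p s ε, (z ∈ T.carrier ↔ ((z - p) / (T.par p - p)).im = 0))
    (hfree : ∀ v ∈ V, v ∉ T.tube p s ε) (b : Punc V) :
    (crossSet (pLift V T.carrierᶜ) (pLift V (T.tube p s ε)) b).Finite ∧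
    (crossSet (pLift V T.carrierᶜ) (pLift V (T.tube p s ε)) b).ncard ≤ 3 ^ 2 := by
  classical
  obtain ⟨h1, h2⟩ := finite_crossSet (T.thin_compl hV)
    (thin_lift_of_convex (T.convex_tube p s ε) hfree) b
    (fun x => SignType.sign ((x.1 - p) / (T.par p - p)).im) (by
      intro x hx y hy hc
      have hx0 : ((x.1 - p) / (T.par p - p)).im ≠ 0 := fun h => hx.2 ((htube _ hx.1).2 h)
      refine JoinedIn.exists_inS (S := T.tube p s ε ∩ T.carrierᶜ) (fun v hv h => hfree v hv h.1)
        (joinedIn_of_segment_subset (segment_tube htube hx.1 hy.1 ?_))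
      rcases hx0.lt_or_gt with h | h
      · rw [sign_neg h, eq_comm, sign_eq_neg_one_iff] at hc
        exact mul_pos_of_neg_of_neg h hc
      · rw [sign_pos h, eq_comm, sign_eq_one_iff] at hc
        exact mul_pos h hc)
  exact ⟨h1, h2⟩

/-- The half width of the end pieces of an edge not covered by a tube. -/
noncomputable def gap (T : PTree ρ) (r : ℝ) (p : ℂ) : ℝ := min (1 / 4) (r / (4 * ‖T.par p - p‖))

theorem gap_pos (T : PTree ρ) {r : ℝ} (hr : 0 < r) {p : ℂ} (hp : p ∈ T.N) : 0 < T.gap r p := by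
  have : 0 < ‖T.par p - p‖ := norm_pos_iff.2 (sub_ne_zero.2 (T.ne_par hp).symm)
  unfold gap
  positivity

theorem gap_mul_lt (T : PTree ρ) {r : ℝ} (hr : 0 < r) {p : ℂ} (hp : p ∈ T.N) :
    2 * T.gap r p * ‖T.par p - p‖ < r := by
  have h : 0 < ‖T.par p - p‖ := norm_pos_iff.2 (sub_ne_zero.2 (T.ne_par hp).symm)
  have : T.gap r p ≤ r / (4 * ‖T.par p - p‖) := min_le_right _ _
  rw [le_div_iff₀ (by positivity)] at this
  linarith

theorem gap_le (T : PTree ρ) (r : ℝ) (p : ℂ) : T.gap r p ≤ 1 / 4 := min_le_left _ _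

theorem crossSet_ball_subset (T : PTree ρ) {V : Finset ℂ} (hV : ∀ v ∈ V, v ∈ insert ρ T.N) {r : ℝ}
    (hr : 0 < r) {p q : ℂ} (hq : q ∈ insert ρ T.N) (hkids : T.kids q = {p}) (hconic : T.Conic q r)
    {ε : ℝ} (hε : 0 < ε) (hfree : ∀ v ∈ V, v ∉ Metric.ball q r) (b : Punc V) :
    crossSet (pLift V T.carrierᶜ) (pLift V (Metric.ball q r)) b ⊆
      crossSet (pLift V T.carrierᶜ) (pLift V (T.tube p (T.gap r p) ε)) b := by
  have hpk : p ∈ T.kids q := by simp [hkids]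
  obtain ⟨hp, hpq⟩ := mem_kids.1 hpk
  have hd : T.par p - p ≠ 0 := sub_ne_zero.2 (T.ne_par hp).symm
  refine crossSet_subset (T.thin_compl hV) (thin_lift_of_convex (convex_ball q r) hfree) b ?_ ?_
  · intro x hx y hy
    exact exists_inS_of_convex (S := Metric.ball q r ∩ T.tube p (T.gap r p) ε)
      ((convex_ball q r).inter (T.convex_tube _ _ _)) (fun v hv h => hfree v hv h.1) hx hy
  · intro x hx
    have hx1 : ‖x.1 - q‖ < r := by simpa [pLift, dist_eq_norm] using hx.1
    have hg := T.gap_pos hr hp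
    have hU : T.tube p (T.gap r p) ε ∈ nhds (q + ((2 * T.gap r p : ℝ) : ℂ) * (p - q)) := by
      refine (T.isOpen_tube _ _ _).mem_nhds ?_
      have : (q + ((2 * T.gap r p : ℝ) : ℂ) * (p - q) - p) / (T.par p - p) =
          ((1 - 2 * T.gap r p : ℝ) : ℂ) := by
        rw [div_eq_iff hd, hpq]
        push_cast
        ring
      have h4 := T.gap_le r p
      refine ⟨?_, ?_, ?_⟩ <;> rw [this]
      · rw [Complex.ofReal_re]; linarith
      · rw [Complex.ofReal_re]; linarith
      · simpa using hε
    obtain ⟨y, hyU, hy⟩ := hconic.exists_joinedIn hq hkids hx1 hx.2 (s := 2 * T.gap r p)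
      (by linarith) (by
        have := T.gap_mul_lt hr hp
        rwa [hpq, norm_sub_rev] at this) hU
    have hyV : y ∉ V := fun hv => hfree y hv hy.target_mem.1
    exact ⟨⟨y, hyV⟩, hyU, JoinedIn.exists_inS (S := Metric.ball q r ∩ T.carrierᶜ)
      (y := ⟨y, hyV⟩) (fun v hv h => hfree v hv h.1) hy⟩

theorem crossSet_tube_subset (T : PTree ρ) {V : Finset ℂ} (hV : ∀ v ∈ V, v ∈ insert ρ T.N) {r : ℝ}
    (hr : 0 < r) {p : ℂ} (hp : p ∈ T.N)
    {ε : ℝ} (htube : ∀ z ∈ T.tube p (T.gap r p) ε, (z ∈ T.carrier ↔ ((z - p) / (T.par p - p)).im = 0))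
    (hfree : ∀ v ∈ V, v ∉ T.tube p (T.gap r p) ε) (b : Punc V) :
    crossSet (pLift V T.carrierᶜ) (pLift V (T.tube p (T.gap r p) ε)) b ⊆
      crossSet (pLift V T.carrierᶜ) (pLift V (Metric.ball p r)) b := by
  have hd : T.par p - p ≠ 0 := sub_ne_zero.2 (T.ne_par hp).symm
  have hdn : 0 < ‖T.par p - p‖ := norm_pos_iff.2 hd
  refine crossSet_subset (T.thin_compl hV) (thin_lift_of_convex (T.convex_tube _ _ _) hfree) b ?_ ?_
  · intro x hx y hy
    exact exists_inS_of_convex (S := T.tube p (T.gap r p) ε ∩ Metric.ball p r)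
      ((T.convex_tube _ _ _).inter (convex_ball p r)) (fun v hv h => hfree v hv h.1) hx hy
  · intro x hx
    have hg := T.gap_pos hr hp
    have hgr := T.gap_mul_lt hr hp
    have hg4 := T.gap_le r p
    set g := T.gap r p
    have hx0 : ((x.1 - p) / (T.par p - p)).im ≠ 0 := fun h => hx.2 ((htube _ hx.1).2 h)
    set u := ((x.1 - p) / (T.par p - p)).im with hu
    have hxε : |u| < ε := hx.1.2.2
    have hu0 : 0 < |u| := abs_pos.2 hx0
    have hgap : 0 < r / ‖T.par p - p‖ - 2 * g := by
      rw [sub_pos, lt_div_iff₀ hdn]; exact hgr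
    obtain ⟨c, hc0, hc1, hcu⟩ : ∃ c : ℝ, 0 < c ∧ c ≤ 1 ∧ c * |u| < r / ‖T.par p - p‖ - 2 * g := by
      refine ⟨min 1 ((r / ‖T.par p - p‖ - 2 * g) / (2 * |u|)), by positivity, min_le_left _ _, ?_⟩
      have := min_le_right 1 ((r / ‖T.par p - p‖ - 2 * g) / (2 * |u|))
      rw [le_div_iff₀ (by positivity)] at this
      linarith
    set y : ℂ := p + ((2 * g : ℝ) + ((c * u : ℝ) : ℂ) * Complex.I) * (T.par p - p) with hy
    have hyζ : (y - p) / (T.par p - p) = (2 * g : ℝ) + ((c * u : ℝ) : ℂ) * Complex.I := by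
      rw [hy]; field_simp; ring
    have hyre : ((y - p) / (T.par p - p)).re = 2 * g := by
      rw [hyζ]; simp
    have hyim : ((y - p) / (T.par p - p)).im = c * u := by
      rw [hyζ]; simp
    have hyT : y ∈ T.tube p g ε := by
      refine ⟨by rw [hyre]; linarith, by rw [hyre]; linarith, ?_⟩
      rw [hyim, abs_mul, abs_of_pos hc0]
      nlinarith
    have hyB : y ∈ Metric.ball p r := by
      rw [Metric.mem_ball, dist_eq_norm]
      have : y - p = ((2 * g : ℝ) + ((c * u : ℝ) : ℂ) * Complex.I) * (T.par p - p) := by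
        rw [hy]; ring
      rw [this, norm_mul, ← lt_div_iff₀ hdn]
      refine (norm_add_le _ _).trans_lt ?_
      rw [norm_mul, Complex.norm_I, mul_one, Complex.norm_real, Complex.norm_real,
        Real.norm_eq_abs, Real.norm_eq_abs, abs_of_pos (by linarith), abs_mul, abs_of_pos hc0]
      linarith
    refine ⟨⟨y, fun hv => hfree y hv hyT⟩, hyB, JoinedIn.exists_inS (S := T.tube p g ε ∩ T.carrierᶜ)
      (fun v hv h => hfree v hv h.1) (joinedIn_of_segment_subset (segment_tube htube hx.1 hyT ?_))⟩
    rw [hyim, ← hu]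
    have := mul_pos hc0 (mul_self_pos.2 hx0)
    linarith

theorem finite_gens (T : PTree ρ) {V : Finset ℂ} (hV : ∀ v ∈ V, v ∈ insert ρ T.N)
    (hprune : T.Pruned V) {r : ℝ} (hr : 0 < r) (hconic : ∀ q ∈ insert ρ T.N, T.Conic q r)
    (hfree : ∀ q ∈ insert ρ T.N, q ∉ V → ∀ v ∈ V, v ∉ Metric.ball q r) (b : Punc V) :
    (T.gens V r b).Finite ∧ (T.gens V r b).ncard ≤ genBound V.card := by
  classical
  have htubes : ∀ p, ∃ ε > 0, p ∈ T.N →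
      ∀ z ∈ T.tube p (T.gap r p) ε, (z ∈ T.carrier ↔ ((z - p) / (T.par p - p)).im = 0) := by
    intro p
    by_cases hp : p ∈ T.N
    · obtain ⟨ε, hε, h⟩ := T.exists_tube hp (T.gap_pos hr hp)
      exact ⟨ε, hε, fun _ => h⟩
    · exact ⟨1, one_pos, fun h => absurd h hp⟩
  choose ε hε htube using htubes
  set D : ℂ → Set ℂ := fun p => T.tube p (T.gap r p) (ε p) with hDdef
  have hDfree : ∀ p ∈ T.N, ∀ v ∈ V, v ∉ D p := by
    intro p hp v hv hvD
    have hd : T.par p - p ≠ 0 := sub_ne_zero.2 (T.ne_par hp).symm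
    have him := (htube p hp v hvD).1 (T.node_mem (hV v hv))
    obtain ⟨h1, h2, -⟩ := hvD
    have hg := T.gap_pos hr hp
    have hmem : v ∈ hseg p (T.par p) := by
      refine (mem_hseg_iff_exists (T.ne_par hp)).2 ⟨((v - p) / (T.par p - p)).re, by linarith,
        by linarith, ?_⟩
      rw [show (((v - p) / (T.par p - p)).re : ℂ) = (v - p) / (T.par p - p) from
        Complex.ext (by simp) (by simp [him])]
      field_simp
      ring
    rcases Finset.mem_insert.1 (hV v hv) with h | h
    · exact (T.disj_ray p hp).le_bot ⟨hmem, by rw [h]; exact self_mem_rightRay ρ⟩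
    · have := T.eq_of_mem_hseg h hp (left_mem_hseg (T.ne_par h)) hmem
      rw [this] at h1
      simp at h1
      linarith
  set CB : ℂ → Set (Path.Homotopic.Quotient b b) := fun q =>
    crossSet (pLift V T.carrierᶜ) (pLift V (Metric.ball q r)) b with hCB
  set CD : ℂ → Set (Path.Homotopic.Quotient b b) := fun q =>
    crossSet (pLift V T.carrierᶜ) (pLift V (D q)) b with hCD
  set Z : ℂ → Set (Path.Homotopic.Quotient b b) := fun e =>
    (if e ∈ V then ∅ else CB e) ∪ (if e ∈ T.N then CD e else ∅) with hZ
  have hZcard : ∀ e, T.IsEnd V e → (Z e).Finite ∧ (Z e).ncard ≤ (3 ^ (V.card + 1)) ^ 2 + 3 ^ 2 := by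
    intro e he
    have h1 : (if e ∈ V then ∅ else CB e).Finite ∧
        (if e ∈ V then ∅ else CB e).ncard ≤ (3 ^ (V.card + 1)) ^ 2 := by
      split_ifs with h
      · simp
      · exact T.finite_crossSet_ball hV hprune he.1 (hconic e he.1) (hfree e he.1 h) b
    have h2 : (if e ∈ T.N then CD e else ∅).Finite ∧ (if e ∈ T.N then CD e else ∅).ncard ≤ 3 ^ 2 := by
      split_ifs with h
      · exact T.finite_crossSet_tube hV (htube e h) (hDfree e h) b
      · simp
    exact ⟨h1.1.union h2.1, (Set.ncard_union_le _ _).trans (add_le_add h1.2 h2.2)⟩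
  obtain ⟨hEfin, hEcard⟩ := hprune.card_ends_le
  have hsub : T.gens V r b ⊆ {Path.Homotopic.Quotient.refl b} ∪ ⋃ e ∈ hEfin.toFinset, Z e := by
    refine Set.union_subset_union_right _ (Set.iUnion₂_subset fun q hq => ?_)
    obtain ⟨e, he, hqe⟩ := T.exists_end_of_step (V := V)
      (fun q e => q = e ∨ (q ∉ V ∧ e ∈ T.N ∧ CB q ⊆ CD e)) (fun q => Or.inl rfl) (by
        rintro x y z (rfl | ⟨h1, h2, h3⟩) h
        · exact h
        · rcases h with rfl | ⟨h4, h5, h6⟩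
          · exact Or.inr ⟨h1, h2, h3⟩
          · exact Or.inr ⟨h1, h5, h3.trans ((T.crossSet_tube_subset hV hr h2 (htube y h2)
              (hDfree y h2) b).trans h6)⟩) (by
        intro q hq hqV p hp
        have hpN : p ∈ T.N := (mem_kids.1 (by simp [hp] : p ∈ T.kids q)).1
        exact Or.inr ⟨hqV, hpN, T.crossSet_ball_subset hV hr hq hp (hconic q hq) (hε p)
          (hfree q hq hqV) b⟩) hq.1
    refine Set.Subset.trans ?_ (Set.subset_biUnion_of_mem (u := Z) (Finset.mem_coe.2 (hEfin.mem_toFinset.2 he)))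
    rcases hqe with rfl | ⟨-, h2, h3⟩
    · simp only [hZ, if_neg hq.2]
      exact Set.subset_union_left
    · simp only [hZ, if_pos h2]
      exact h3.trans Set.subset_union_right
  have hfin : ({Path.Homotopic.Quotient.refl b} ∪ ⋃ e ∈ hEfin.toFinset, Z e).Finite :=
    (Set.finite_singleton _).union (hEfin.toFinset.finite_toSet.biUnion fun e he =>
      (hZcard e (hEfin.mem_toFinset.1 he)).1)
  refine ⟨hfin.subset hsub, (Set.ncard_le_ncard hsub hfin).trans ?_⟩
  refine (Set.ncard_union_le _ _).trans ?_
  rw [Set.ncard_singleton]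
  refine Nat.add_le_add_left ((Finset.set_ncard_biUnion_le _ _).trans ?_) 1
  refine (Finset.sum_le_card_nsmul _ _ _ fun e he => (hZcard e (hEfin.mem_toFinset.1 he)).2).trans ?_
  rw [smul_eq_mul, ← Set.ncard_eq_toFinset_card _ hEfin]
  exact Nat.mul_le_mul_right _ hEcard

end PTree

theorem exists_last_exit {κ : ℝ → ℂ} (hκ : Continuous κ) {τ c : ℝ} (hτc : τ < c)
    (hne : ∀ t, τ < t → t ≤ c → κ t ≠ κ τ) :
    ∃ r₀ > 0, ∀ r, 0 < r → r ≤ r₀ → ∃ s, τ < s ∧ s ≤ c ∧ ‖κ s - κ τ‖ = r ∧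
      ∀ t, s ≤ t → t ≤ c → r ≤ ‖κ t - κ τ‖ := by
  have hc0 : 0 < ‖κ c - κ τ‖ := norm_pos_iff.2 (sub_ne_zero.2 (hne c hτc le_rfl))
  have hg : Continuous fun t => ‖κ t - κ τ‖ := by fun_prop
  refine ⟨‖κ c - κ τ‖, hc0, fun r hr hrc => ?_⟩
  have hK : IsCompact (Set.Icc τ c ∩ {t | ‖κ t - κ τ‖ = r}) :=
    isCompact_Icc.inter_right (isClosed_eq hg continuous_const)
  obtain ⟨s₀, hs₀, hs₀r⟩ := intermediate_value_Icc hτc.le hg.continuousOn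
    (show r ∈ Set.Icc ‖κ τ - κ τ‖ ‖κ c - κ τ‖ from ⟨by simpa using hr.le, hrc⟩)
  obtain ⟨s, hs, hmax⟩ := hK.exists_isGreatest ⟨s₀, hs₀, hs₀r⟩
  have hsr : ‖κ s - κ τ‖ = r := hs.2
  refine ⟨s, lt_of_le_of_ne hs.1.1 ?_, hs.1.2, hsr, fun t hst htc => ?_⟩
  · rintro rfl
    simp at hsr
    exact hr.ne hsr
  · by_contra! hlt
    obtain ⟨u, hu, hur⟩ := intermediate_value_Icc htc hg.continuousOn
      (show r ∈ Set.Icc ‖κ t - κ τ‖ ‖κ c - κ τ‖ from ⟨hlt.le, hrc⟩)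
    have hus : u ≤ s := hmax ⟨⟨(hs.1.1.trans hst).trans hu.1, hu.2⟩, hur⟩
    have : t = s := le_antisymm (hu.1.trans hus) hst
    rw [this, hsr] at hlt
    exact hlt.false

theorem exists_first_entry {κ : ℝ → ℂ} (hκ : Continuous κ) {τ c : ℝ} (hτc : c < τ)
    (hne : ∀ t, t < τ → c ≤ t → κ t ≠ κ τ) :
    ∃ r₀ > 0, ∀ r, 0 < r → r ≤ r₀ → ∃ s, s < τ ∧ c ≤ s ∧ ‖κ s - κ τ‖ = r ∧
      ∀ t, t ≤ s → c ≤ t → r ≤ ‖κ t - κ τ‖ := by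
  obtain ⟨r₀, hr₀, h⟩ := exists_last_exit (κ := fun t => κ (-t)) (by fun_prop) (neg_lt_neg hτc)
    (fun t h1 h2 => by
      rw [neg_neg]
      exact hne (-t) (by linarith) (by linarith))
  refine ⟨r₀, hr₀, fun r hr hrr => ?_⟩
  obtain ⟨s, h1, h2, h3, h4⟩ := h r hr hrr
  refine ⟨-s, by linarith, by linarith, by simpa using h3, fun t ht hct => ?_⟩
  simpa using h4 (-t) (by linarith) (by linarith)

/-- The times of `[0,1]` outside the chosen intervals around the times in `S`. -/
def goodTimes (S : Finset ℝ) (sm sp : ℝ → ℝ) : Set ℝ :=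
  {t | 0 ≤ t ∧ t ≤ 1 ∧ ∀ τ ∈ S, t ≤ sm τ ∨ sp τ ≤ t}

theorem isCompact_goodTimes (S : Finset ℝ) (sm sp : ℝ → ℝ) : IsCompact (goodTimes S sm sp) := by
  have : goodTimes S sm sp = Set.Icc 0 1 ∩ ⋂ τ ∈ S, (Set.Iic (sm τ) ∪ Set.Ici (sp τ)) := by
    ext t
    simp [goodTimes, and_assoc]
  rw [this]
  exact isCompact_Icc.inter_right
    (isClosed_biInter fun τ _ => isClosed_Iic.union isClosed_Ici)

/-- Disjoint intervals `(sm τ, sp τ)` around the times `τ ∈ S` when a curve visits `P`, at the ends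
of which the curve has distance exactly `r` from the visited point, such that the curve has distance
at least `r` from `P` outside these intervals. -/
structure Truncation (P : Finset ℂ) (κ : ℝ → ℂ) (S : Finset ℝ) (R r : ℝ) (sm sp : ℝ → ℝ) : Prop where
  lt_left : ∀ τ ∈ S, sm τ < τ
  lt_right : ∀ τ ∈ S, τ < sp τ
  left_pos : ∀ τ ∈ S, τ ≠ 0 → 0 < sm τ
  right_lt : ∀ τ ∈ S, τ ≠ 1 → sp τ < 1
  norm_left : ∀ τ ∈ S, τ ≠ 0 → ‖κ (sm τ) - κ τ‖ = r
  norm_right : ∀ τ ∈ S, τ ≠ 1 → ‖κ (sp τ) - κ τ‖ = r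
  mem_ball : ∀ τ ∈ S, ∀ t, 0 ≤ t → t ≤ 1 → sm τ ≤ t → t ≤ sp τ → ‖κ t - κ τ‖ < R
  disj : ∀ τ ∈ S, ∀ τ' ∈ S, τ < τ' → sp τ < sm τ'
  far : ∀ t ∈ goodTimes S sm sp, ∀ p ∈ P, r ≤ ‖κ t - p‖

theorem exists_truncation {P : Finset ℂ} {κ : ℝ → ℂ} (hκ : Continuous κ) {S : Finset ℝ}
    (hS : ∀ t, t ∈ S ↔ 0 ≤ t ∧ t ≤ 1 ∧ κ t ∈ P) (h0 : 0 ∈ S) (h1 : 1 ∈ S) {R : ℝ} (hR : 0 < R)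
    (hP : ∀ p ∈ P, ∀ q ∈ P, p ≠ q → 2 * R ≤ ‖p - q‖) :
    ∃ r₀ > 0, ∀ r, 0 < r → r ≤ r₀ → ∃ sm sp, Truncation P κ S R r sm sp := by
  classical
  obtain ⟨δ₁, hδ₁, hgap⟩ : ∃ δ > 0, ∀ τ ∈ S, ∀ τ' ∈ S, τ < τ' → 3 * δ ≤ τ' - τ := by
    have hfin : (((S ×ˢ S).filter fun p => p.1 < p.2).image fun p => (p.2 - p.1) / 3).Nonempty :=
      Finset.Nonempty.image ⟨((0 : ℝ), (1 : ℝ)), by simp [h0, h1]⟩ _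
    refine ⟨Finset.min' _ hfin, ?_, fun τ hτ τ' hτ' hlt => ?_⟩
    · obtain ⟨p, hp, h⟩ := Finset.mem_image.1 (Finset.min'_mem _ hfin)
      rw [← h]
      have := (Finset.mem_filter.1 hp).2
      exact div_pos (sub_pos.2 this) (by norm_num)
    · have h3 : (τ, τ') ∈ (S ×ˢ S).filter fun p => p.1 < p.2 :=
        Finset.mem_filter.2 ⟨Finset.mem_product.2 ⟨hτ, hτ'⟩, hlt⟩
      have := Finset.min'_le _ _ (Finset.mem_image_of_mem (fun p : ℝ × ℝ => (p.2 - p.1) / 3) h3)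
      linarith
  obtain ⟨δ₂, hδ₂, hball⟩ : ∃ δ > 0, ∀ τ ∈ S, ∀ t, |t - τ| ≤ δ → ‖κ t - κ τ‖ < R := by
    have hloc : ∀ τ, ∃ δ > 0, ∀ t, |t - τ| ≤ δ → ‖κ t - κ τ‖ < R := by
      intro τ
      obtain ⟨δ, hδ, h⟩ := Metric.continuous_iff.1 hκ τ R hR
      exact ⟨δ / 2, by positivity, fun t ht => by
        simpa [dist_eq_norm] using h t (by rw [Real.dist_eq]; linarith)⟩
    choose δ hδ h using hloc
    have hne : (S.image δ).Nonempty := ⟨δ 0, Finset.mem_image_of_mem _ h0⟩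
    refine ⟨(S.image δ).min' hne, ?_, fun τ hτ t ht => h τ t (ht.trans
      (Finset.min'_le _ _ (Finset.mem_image_of_mem _ hτ)))⟩
    obtain ⟨p, -, hp⟩ := Finset.mem_image.1 (Finset.min'_mem _ hne)
    rw [← hp]
    exact hδ p
  set δ := min δ₁ δ₂ with hδ
  have hδ0 : 0 < δ := lt_min hδ₁ hδ₂
  have hδ1 : δ ≤ δ₁ := min_le_left _ _
  have hδ2 : δ ≤ δ₂ := min_le_right _ _
  have hS01 : ∀ τ ∈ S, 0 ≤ τ ∧ τ ≤ 1 := fun τ hτ => ⟨((hS τ).1 hτ).1, ((hS τ).1 hτ).2.1⟩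
  have hne : ∀ τ ∈ S, ∀ t, 0 ≤ t → t ≤ 1 → |t - τ| ≤ δ → t ≠ τ → κ t ≠ κ τ := by
    intro τ hτ t ht0 ht1 htδ htτ heq
    have htS : t ∈ S := (hS t).2 ⟨ht0, ht1, heq ▸ ((hS τ).1 hτ).2.2⟩
    rw [abs_le] at htδ
    rcases htτ.lt_or_gt with h | h
    · have := hgap t htS τ hτ h; linarith
    · have := hgap τ hτ t htS h; linarith
  have hleft : ∀ τ, ∃ r₀ > 0, τ ∈ S → τ ≠ 0 → 0 < τ - δ ∧ ∀ r, 0 < r → r ≤ r₀ →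
      ∃ s, s < τ ∧ τ - δ ≤ s ∧ ‖κ s - κ τ‖ = r ∧ ∀ t, t ≤ s → τ - δ ≤ t → r ≤ ‖κ t - κ τ‖ := by
    intro τ
    by_cases h : τ ∈ S ∧ τ ≠ 0
    · have hpos : 0 < τ := lt_of_le_of_ne (hS01 τ h.1).1 h.2.symm
      have hτδ : 0 < τ - δ := by have := hgap 0 h0 τ h.1 hpos; linarith
      obtain ⟨r, hr, hh⟩ := exists_first_entry hκ (show τ - δ < τ by linarith)
        (fun t h1 h2 => hne τ h.1 t (by linarith) (by linarith [(hS01 τ h.1).2])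
          (by rw [abs_le]; constructor <;> linarith) h1.ne)
      exact ⟨r, hr, fun _ _ => ⟨hτδ, hh⟩⟩
    · exact ⟨1, one_pos, fun h1 h2 => absurd ⟨h1, h2⟩ h⟩
  have hright : ∀ τ, ∃ r₀ > 0, τ ∈ S → τ ≠ 1 → τ + δ < 1 ∧ ∀ r, 0 < r → r ≤ r₀ →
      ∃ s, τ < s ∧ s ≤ τ + δ ∧ ‖κ s - κ τ‖ = r ∧ ∀ t, s ≤ t → t ≤ τ + δ → r ≤ ‖κ t - κ τ‖ := by
    intro τ
    by_cases h : τ ∈ S ∧ τ ≠ 1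
    · have hlt : τ < 1 := lt_of_le_of_ne (hS01 τ h.1).2 h.2
      have hτδ : τ + δ < 1 := by have := hgap τ h.1 1 h1 hlt; linarith
      obtain ⟨r, hr, hh⟩ := exists_last_exit hκ (show τ < τ + δ by linarith)
        (fun t h1 h2 => hne τ h.1 t (by linarith [(hS01 τ h.1).1]) (by linarith)
          (by rw [abs_le]; constructor <;> linarith) h1.ne')
      exact ⟨r, hr, fun _ _ => ⟨hτδ, hh⟩⟩
    · exact ⟨1, one_pos, fun h1 h2 => absurd ⟨h1, h2⟩ h⟩
  choose rl hrl hl using hleft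
  choose rr hrr hrt using hright
  obtain ⟨r₁, hr₁, hfar⟩ : ∃ r > 0, ∀ t, 0 ≤ t → t ≤ 1 → (∀ τ ∈ S, δ ≤ |t - τ|) →
      ∀ p ∈ P, r ≤ ‖κ t - p‖ := by
    have hK : IsCompact (Set.Icc (0 : ℝ) 1 ∩ ⋂ τ ∈ S, {t | δ ≤ |t - τ|}) :=
      isCompact_Icc.inter_right (isClosed_biInter fun τ _ =>
        isClosed_le continuous_const (by fun_prop))
    obtain ⟨r, hr, h⟩ := exists_pos_forall_le_norm_sub (hK.image hκ) P.finite_toSet.isClosed (by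
      rw [Set.disjoint_left]
      rintro _ ⟨t, ⟨ht, htS⟩, rfl⟩ hP
      have : t ∈ S := (hS t).2 ⟨ht.1, ht.2, hP⟩
      have := Set.mem_iInter₂.1 htS t this
      simp at this
      linarith)
    refine ⟨r, hr, fun t h0 h1 ht p hp => ?_⟩
    rw [norm_sub_rev]
    exact h _ ⟨t, ⟨⟨h0, h1⟩, Set.mem_iInter₂.2 ht⟩, rfl⟩ p hp
  have hSne : (S.image fun τ => min (rl τ) (rr τ)).Nonempty := ⟨_, Finset.mem_image_of_mem _ h0⟩
  set r₂ := (S.image fun τ => min (rl τ) (rr τ)).min' hSne with hr₂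
  have hr₂0 : 0 < r₂ := by
    obtain ⟨p, -, hp⟩ := Finset.mem_image.1 (Finset.min'_mem _ hSne)
    rw [hr₂, ← hp]
    exact lt_min (hrl p) (hrr p)
  have hr₂le : ∀ τ ∈ S, r₂ ≤ rl τ ∧ r₂ ≤ rr τ := fun τ hτ =>
    le_min_iff.1 (Finset.min'_le _ _ (Finset.mem_image_of_mem (fun τ => min (rl τ) (rr τ)) hτ))
  refine ⟨min (min r₁ r₂) R, by positivity, fun r hr hrle => ?_⟩
  have hr1 : r ≤ r₁ := hrle.trans ((min_le_left _ _).trans (min_le_left _ _))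
  have hr2 : r ≤ r₂ := hrle.trans ((min_le_left _ _).trans (min_le_right _ _))
  have hrR : r ≤ R := hrle.trans (min_le_right _ _)
  have hsm : ∀ τ, ∃ s, τ ∈ S → s < τ ∧ τ - δ ≤ s ∧ (τ ≠ 0 → 0 < s ∧ ‖κ s - κ τ‖ = r) ∧
      ∀ t, 0 ≤ t → t ≤ s → τ - δ ≤ t → r ≤ ‖κ t - κ τ‖ := by
    intro τ
    by_cases h : τ ∈ S ∧ τ ≠ 0
    · obtain ⟨hpos, hh⟩ := hl τ h.1 h.2
      obtain ⟨s, h1, h2, h3, h4⟩ := hh r hr (hr2.trans (hr₂le τ h.1).1)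
      exact ⟨s, fun _ => ⟨h1, h2, fun _ => ⟨by linarith, h3⟩, fun t _ => h4 t⟩⟩
    · refine ⟨τ - δ, fun hτ => ⟨by linarith, le_rfl, fun h0 => absurd ⟨hτ, h0⟩ h, ?_⟩⟩
      have : τ = 0 := by
        by_contra h0
        exact h ⟨hτ, h0⟩
      intro t ht0 ht1
      linarith
  have hsp : ∀ τ, ∃ s, τ ∈ S → τ < s ∧ s ≤ τ + δ ∧ (τ ≠ 1 → s < 1 ∧ ‖κ s - κ τ‖ = r) ∧
      ∀ t, t ≤ 1 → s ≤ t → t ≤ τ + δ → r ≤ ‖κ t - κ τ‖ := by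
    intro τ
    by_cases h : τ ∈ S ∧ τ ≠ 1
    · obtain ⟨hpos, hh⟩ := hrt τ h.1 h.2
      obtain ⟨s, h1, h2, h3, h4⟩ := hh r hr (hr2.trans (hr₂le τ h.1).2)
      exact ⟨s, fun _ => ⟨h1, h2, fun _ => ⟨by linarith, h3⟩, fun t _ => h4 t⟩⟩
    · refine ⟨τ + δ, fun hτ => ⟨by linarith, le_rfl, fun h0 => absurd ⟨hτ, h0⟩ h, ?_⟩⟩
      have : τ = 1 := by
        by_contra h0
        exact h ⟨hτ, h0⟩
      intro t ht0 ht1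
      linarith
  choose sm hsm using hsm
  choose sp hsp using hsp
  refine ⟨sm, sp, fun τ hτ => (hsm τ hτ).1, fun τ hτ => (hsp τ hτ).1,
    fun τ hτ h => ((hsm τ hτ).2.2.1 h).1, fun τ hτ h => ((hsp τ hτ).2.2.1 h).1,
    fun τ hτ h => ((hsm τ hτ).2.2.1 h).2, fun τ hτ h => ((hsp τ hτ).2.2.1 h).2, ?_, ?_, ?_⟩
  · intro τ hτ t _ _ h2 h3
    refine hball τ hτ t ?_
    have := (hsm τ hτ).2.1
    have := (hsp τ hτ).2.1
    rw [abs_le]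
    constructor <;> linarith
  · intro τ hτ τ' hτ' hlt
    have := (hsp τ hτ).2.1
    have := (hsm τ' hτ').2.1
    have := hgap τ hτ τ' hτ' hlt
    linarith
  · rintro t ⟨ht0, ht1, ht⟩ p hp
    by_cases hw : ∀ τ ∈ S, δ ≤ |t - τ|
    · exact hr1.trans (hfar t ht0 ht1 hw p hp)
    · push Not at hw
      obtain ⟨τ, hτ, hτδ⟩ := hw
      have hτP := ((hS τ).1 hτ).2.2
      by_cases hpτ : p = κ τ
      · rw [abs_lt] at hτδ
        rw [hpτ]
        rcases ht τ hτ with h | h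
        · exact (hsm τ hτ).2.2.2 t ht0 h (by linarith)
        · exact (hsp τ hτ).2.2.2 t ht1 h (by linarith)
      · have h2 := hP p hp _ hτP hpτ
        have h3 := hball τ hτ t (hτδ.le.trans hδ2)
        have h4 : ‖p - κ τ‖ ≤ ‖κ t - p‖ + ‖κ t - κ τ‖ := by
          calc ‖p - κ τ‖ = ‖(κ t - κ τ) - (κ t - p)‖ := by ring_nf
            _ ≤ _ := (norm_sub_le _ _).trans (by linarith)
        linarith

namespace Truncation

variable {P : Finset ℂ} {κ : ℝ → ℂ} {S : Finset ℝ} {R r : ℝ} {sm sp : ℝ → ℝ}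

theorem le_sm_or_sp_le (h : Truncation P κ S R r sm sp) {τ τ' : ℝ} (hτ : τ ∈ S) (hτ' : τ' ∈ S) :
    sp τ ≤ sm τ' ∨ sp τ' ≤ sm τ ∨ τ = τ' := by
  rcases lt_trichotomy τ τ' with hlt | rfl | hlt
  · exact Or.inl (h.disj τ hτ τ' hτ' hlt).le
  · exact Or.inr (Or.inr rfl)
  · exact Or.inr (Or.inl (h.disj τ' hτ' τ hτ hlt).le)

theorem sm_mem (h : Truncation P κ S R r sm sp) (hS1 : ∀ τ ∈ S, τ ≤ 1) {τ : ℝ} (hτ : τ ∈ S) (h0 : τ ≠ 0) :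
    sm τ ∈ goodTimes S sm sp := by
  have h2 := h.lt_left τ hτ
  refine ⟨(h.left_pos τ hτ h0).le, by linarith [hS1 τ hτ], fun τ' hτ' => ?_⟩
  rcases h.le_sm_or_sp_le hτ hτ' with h3 | h3 | rfl
  · exact Or.inl (by linarith [h.lt_right τ hτ])
  · exact Or.inr h3
  · exact Or.inl le_rfl

theorem sp_mem (h : Truncation P κ S R r sm sp) (hS0 : ∀ τ ∈ S, 0 ≤ τ) {τ : ℝ} (hτ : τ ∈ S) (h0 : τ ≠ 1) :
    sp τ ∈ goodTimes S sm sp := by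
  have h2 := h.lt_right τ hτ
  refine ⟨by linarith [hS0 τ hτ], (h.right_lt τ hτ h0).le, fun τ' hτ' => ?_⟩
  rcases h.le_sm_or_sp_le hτ hτ' with h3 | h3 | rfl
  · exact Or.inl h3
  · exact Or.inr (by linarith [h.lt_left τ hτ])
  · exact Or.inr le_rfl

/-- Induction over the visits to `P` between two good times. -/
theorem induction_on (h : Truncation P κ S R r sm sp) (hS : ∀ τ ∈ S, 0 ≤ τ ∧ τ ≤ 1)
    (C : ℕ → ℝ → ℝ → Prop)
    (hgood : ∀ a b, a ≤ b → Set.Icc a b ⊆ goodTimes S sm sp → C 0 a b)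
    (hstep : ∀ j a τ b, τ ∈ S → τ ≠ 0 → τ ≠ 1 → a ∈ goodTimes S sm sp → a ≤ sm τ → C j a (sm τ) →
      sp τ ≤ b → Set.Icc (sp τ) b ⊆ goodTimes S sm sp → C (j + 1) a b)
    {a b : ℝ} (ha : a ∈ goodTimes S sm sp) (hb : b ∈ goodTimes S sm sp) (hab : a ≤ b) :
    C ((S.filter fun τ => a < τ ∧ τ < b).card) a b := by
  classical
  generalize hj : (S.filter fun τ => a < τ ∧ τ < b).card = j
  induction j generalizing b with
  | zero =>
    refine hgood a b hab fun t ht => ⟨ha.1.trans ht.1, ht.2.trans hb.2.1, fun τ hτ => ?_⟩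
    rw [Finset.card_eq_zero, Finset.filter_eq_empty_iff] at hj
    by_contra! hcon
    have h3 := ha.2.2 τ hτ
    have h4 := hb.2.2 τ hτ
    have := h.lt_left τ hτ
    have := h.lt_right τ hτ
    refine hj hτ ⟨?_, ?_⟩
    · rcases h3 with h3 | h3
      · linarith
      · linarith [ht.1]
    · rcases h4 with h4 | h4
      · linarith [ht.2]
      · linarith
  | succ j ih =>
    have hne : (S.filter fun τ => a < τ ∧ τ < b).Nonempty := by
      rw [← Finset.card_pos]; omega
    set τ := (S.filter fun τ => a < τ ∧ τ < b).max' hne with hτdef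
    have hmem := Finset.max'_mem _ hne
    rw [← hτdef] at hmem
    obtain ⟨hτS, haτ, hτb⟩ := Finset.mem_filter.1 hmem
    have hl := h.lt_left τ hτS
    have hr := h.lt_right τ hτS
    have h0 : τ ≠ 0 := (ha.1.trans_lt haτ).ne'
    have h1 : τ ≠ 1 := (hτb.trans_le hb.2.1).ne
    have ham : a ≤ sm τ := (ha.2.2 τ hτS).resolve_right (by linarith)
    have hbp : sp τ ≤ b := (hb.2.2 τ hτS).resolve_left (by linarith)
    refine hstep j a τ b hτS h0 h1 ha ham (ih (h.sm_mem (fun τ hτ => (hS τ hτ).2) hτS h0) ham ?_) hbp ?_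
    · have : (S.filter fun τ => a < τ ∧ τ < b) =
          insert τ (S.filter fun t => a < t ∧ t < sm τ) := by
        ext t
        simp only [Finset.mem_filter, Finset.mem_insert]
        constructor
        · rintro ⟨htS, hat, htb⟩
          have htτ : t ≤ τ := Finset.le_max' _ t (Finset.mem_filter.2 ⟨htS, hat, htb⟩)
          rcases htτ.eq_or_lt with h2 | h2
          · exact Or.inl h2
          · have := h.disj t htS τ hτS h2
            have := h.lt_right t htS
            exact Or.inr ⟨htS, hat, by linarith⟩
        · rintro (rfl | ⟨htS, hat, htb⟩)
          · exact ⟨hτS, haτ, hτb⟩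
          · exact ⟨htS, hat, by linarith⟩
      rw [this, Finset.card_insert_of_notMem (by simp only [Finset.mem_filter]; intro h3; linarith [h3.2.2])] at hj
      omega
    · intro t ht
      refine ⟨?_, ht.2.trans hb.2.1, fun τ' hτ' => ?_⟩
      · linarith [(hS τ hτS).1, ht.1]
      · rcases lt_trichotomy τ τ' with h2 | h2 | h2
        · have hτ'b : b ≤ τ' := by
            by_contra! hlt
            have : τ' ≤ τ := Finset.le_max' _ τ' (Finset.mem_filter.2 ⟨hτ', by linarith, hlt⟩)
            linarith
          refine Or.inl (ht.2.trans ((hb.2.2 τ' hτ').resolve_right ?_))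
          have := h.lt_right τ' hτ'
          linarith
        · exact Or.inr (h2 ▸ ht.1)
        · have := h.disj τ' hτ' τ hτS h2
          exact Or.inr (by linarith [ht.1])

end Truncation

/-- The union of the segments from points of `P` to points of `G` at distance `r`. -/
def spokes (P : Finset ℂ) (r : ℝ) (G : Set ℂ) : Set ℂ :=
  {z | ∃ p ∈ P, ∃ e ∈ G, ‖e - p‖ = r ∧ z ∈ segment ℝ p e}

theorem isCompact_spokes (P : Finset ℂ) (r : ℝ) {G : Set ℂ} (hG : IsCompact G) :
    IsCompact (spokes P r G) := by
  have h1 : IsCompact (((P : Set ℂ) ×ˢ G) ∩ {x | ‖x.2 - x.1‖ = r}) :=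
    (P.finite_toSet.isCompact.prod hG).inter_right (isClosed_eq (by fun_prop) (by fun_prop))
  have h2 := (isCompact_Icc (a := (0 : ℝ)) (b := 1)).prod h1
  have h3 := h2.image (f := fun x : ℝ × ℂ × ℂ => x.2.1 + x.1 * (x.2.2 - x.2.1)) (by fun_prop)
  convert h3 using 1
  ext z
  simp only [spokes, Set.mem_ofPred_eq, Set.mem_image, mem_segment_iff_exists]
  constructor
  · rintro ⟨p, hp, e, he, hr, c, h0, h1, rfl⟩
    exact ⟨(c, p, e), ⟨⟨h0, h1⟩, ⟨⟨hp, he⟩, hr⟩⟩, rfl⟩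
  · rintro ⟨⟨c, p, e⟩, ⟨⟨h0, h1⟩, ⟨⟨hp, he⟩, hr⟩⟩, rfl⟩
    exact ⟨p, hp, e, he, hr, c, h0, h1, rfl⟩

theorem norm_le_of_mem_spoke {p e z : ℂ} {r : ℝ} (h : ‖e - p‖ = r) (hz : z ∈ segment ℝ p e) :
    ‖z - p‖ ≤ r := (norm_sub_le_of_mem_segment hz).trans_eq h

theorem reflTransGen_segment_symm {K : Set ℂ} {a b : ℂ}
    (h : Relation.ReflTransGen (fun a b => segment ℝ a b ⊆ K) a b) :
    Relation.ReflTransGen (fun a b => segment ℝ a b ⊆ K) b a := by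
  induction h with
  | refl => exact .refl
  | tail _ h ih => exact ih.head (by rwa [segment_symm])

theorem eq_of_mem_segment_of_norm {p e e' z : ℂ} {r : ℝ} (hr : 0 < r) (h : ‖e - p‖ = r)
    (h' : ‖e' - p‖ = r) (hz : z ∈ segment ℝ p e) (hz' : z ∈ segment ℝ p e') (hzp : z ≠ p) : e = e' := by
  obtain ⟨c, h0, h1, rfl⟩ := mem_segment_iff_exists.1 hz
  obtain ⟨c', h0', h1', hc⟩ := mem_segment_iff_exists.1 hz'
  have hc2 : (c : ℂ) * (e - p) = c' * (e' - p) := add_left_cancel hc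
  have hc3 := congrArg norm hc2
  rw [norm_mul, norm_mul, h, h', Complex.norm_real, Complex.norm_real, Real.norm_of_nonneg h0,
    Real.norm_of_nonneg h0'] at hc3
  have hcc : c = c' := mul_right_cancel₀ hr.ne' hc3
  subst hcc
  have hc0 : (c : ℂ) ≠ 0 := by
    rintro h
    simp [h] at hzp
  have := mul_left_cancel₀ hc0 hc2
  exact sub_left_inj.1 this

theorem eq_of_mem_rightRay {ρ z : ℂ} (h : z ∈ rightRay ρ) (hz : z.re ≤ ρ.re) : z = ρ := by
  obtain ⟨t, h0, rfl⟩ := h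
  have : t = 0 := by
    simp at hz
    linarith
  simp [this]

theorem re_le_of_mem_segment {p e z : ℂ} {M : ℝ} (hp : p.re ≤ M) (he : e.re ≤ M)
    (hz : z ∈ segment ℝ p e) : z.re ≤ M := by
  obtain ⟨c, h0, h1, rfl⟩ := mem_segment_iff_exists.1 hz
  simp
  nlinarith

/-- Thickening one of two disjoint compact sets and joining it to nearby points of `P` without
creating new contacts. -/
theorem exists_thickening {P : Finset ℂ} {ρ : ℂ} (hρ : ρ ∈ P) (hP : ∀ p ∈ P, p.re ≤ ρ.re) {R r : ℝ}
    (hr : 0 < r) (hrR : r < R) (hsep : ∀ p ∈ P, ∀ q ∈ P, p ≠ q → 2 * R ≤ ‖p - q‖)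
    {G H : Set ℂ} (hG : IsCompact G) (hH : IsCompact H) (hGH : Disjoint G H)
    (hGr : ∀ z ∈ G, z.re ≤ ρ.re) (hHr : ∀ z ∈ H, z.re ≤ ρ.re)
    (hGP : ∀ z ∈ G, ∀ p ∈ P, r ≤ ‖z - p‖) (hHP : ∀ z ∈ H, ∀ p ∈ P, r ≤ ‖z - p‖) :
    ∃ K : Set ℂ, (∃ η > 0, ∀ y ∈ G, ∀ z, ‖z - y‖ < η → z ∈ K) ∧ spokes P r G ⊆ K ∧
      (∀ z ∈ K, z ∈ rightRay ρ → z = ρ) ∧ (∀ z ∈ H, z ∉ K ∪ rightRay ρ) ∧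
      ∀ p ∈ P, ∀ e ∈ H, ‖e - p‖ = r → ∀ z ∈ segment ℝ p e, z ≠ p → z ∉ K ∪ rightRay ρ := by
  have key : ∀ {p p' e e' z : ℂ}, p ∈ P → p' ∈ P → ‖e - p‖ = r → ‖e' - p'‖ = r →
      z ∈ segment ℝ p e → z ∈ segment ℝ p' e' → p = p' := by
    intro p p' e e' z hp hp' he he' hz hz'
    by_contra hne
    have h1 := hsep p hp p' hp' hne
    have h2 := norm_le_of_mem_spoke he hz
    have h3 := norm_le_of_mem_spoke he' hz'
    have h4 : ‖p - p'‖ ≤ ‖z - p'‖ + ‖z - p‖ := by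
      simpa using norm_sub_le (z - p') (z - p)
    linarith
  have far : ∀ {G' : Set ℂ}, (∀ z ∈ G', ∀ p ∈ P, r ≤ ‖z - p‖) → ∀ {z p e : ℂ}, z ∈ G' → p ∈ P →
      ‖e - p‖ = r → z ∈ segment ℝ p e → z = e := by
    intro G' hG' z p e hz hp he hzs
    have h1 := hG' z hz p hp
    have h2 := norm_le_of_mem_spoke he hzs
    refine eq_of_mem_segment_of_norm (p := p) (z := z) hr (le_antisymm h2 h1) he
      (right_mem_segment ℝ p z) hzs ?_
    rintro rfl
    simp at h1
    linarith
  have ray : ∀ {G' : Set ℂ}, (∀ z ∈ G', ∀ p ∈ P, r ≤ ‖z - p‖) → (∀ z ∈ G', z.re ≤ ρ.re) →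
      ∀ z ∈ G', z ∉ rightRay ρ := by
    intro G' hG' hre z hz hzr
    have := hG' z hz ρ hρ
    rw [eq_of_mem_rightRay hzr (hre z hz)] at this
    simp at this
    linarith
  have hB : IsClosed (H ∪ spokes P r H ∪ rightRay ρ) :=
    (hH.isClosed.union (isCompact_spokes P r hH).isClosed).union (isClosed_rightRay ρ)
  obtain ⟨η, hη, hGB⟩ := exists_pos_forall_le_norm_sub hG hB (by
    rw [Set.disjoint_left]
    rintro z hz ((hzH | ⟨p, hp, e, he, hpe, hze⟩) | hzr)
    · exact Set.disjoint_left.1 hGH hz hzH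
    · rw [far hGP hz hp hpe hze] at hz
      exact Set.disjoint_left.1 hGH hz he
    · exact ray hGP hGr z hz hzr)
  refine ⟨{z | ∃ y ∈ G, ‖z - y‖ < η} ∪ spokes P r G, ⟨η, hη, fun y hy z hz => Or.inl ⟨y, hy, hz⟩⟩,
    Set.subset_union_right, ?_, ?_, ?_⟩
  · rintro z (⟨y, hy, hz⟩ | ⟨p, hp, e, he, hpe, hze⟩) hzr
    · linarith [hGB y hy z (Or.inr hzr)]
    · exact eq_of_mem_rightRay hzr (re_le_of_mem_segment (hP p hp) (hGr e he) hze)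
  · rintro z hz ((⟨y, hy, hzy⟩ | ⟨p, hp, e, he, hpe, hze⟩) | hzr)
    · linarith [hGB y hy z (Or.inl (Or.inl hz))]
    · rw [far hHP hz hp hpe hze] at hz
      exact Set.disjoint_left.1 hGH he hz
    · exact ray hHP hHr z hz hzr
  · rintro p hp e he hpe z hze hzp ((⟨y, hy, hzy⟩ | ⟨p', hp', e', he', hpe', hze'⟩) | hzr)
    · linarith [hGB y hy z (Or.inl (Or.inr ⟨p, hp, e, he, hpe, hze⟩))]
    · obtain rfl := key hp hp' hpe hpe' hze hze'
      obtain rfl := eq_of_mem_segment_of_norm hr hpe hpe' hze hze' hzp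
      exact Set.disjoint_left.1 hGH he' he
    · have h1 := eq_of_mem_rightRay hzr (re_le_of_mem_segment (hP p hp) (hHr e he) hze)
      subst h1
      have h2 := hsep z hρ p hp hzp
      linarith [norm_le_of_mem_spoke hpe hze]

/-- A curve with finitely many visits to `P`, together with a truncation. -/
structure CutCurve (P : Finset ℂ) (R r : ℝ) where
  κ : ℝ → ℂ
  cont : Continuous κ
  S : Finset ℝ
  mem_S : ∀ t, t ∈ S ↔ 0 ≤ t ∧ t ≤ 1 ∧ κ t ∈ P
  zero_mem : 0 ∈ S
  one_mem : 1 ∈ S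
  sm : ℝ → ℝ
  sp : ℝ → ℝ
  trunc : Truncation P κ S R r sm sp

namespace CutCurve

variable {P : Finset ℂ} {R r : ℝ}

def good (c : CutCurve P R r) : Set ℝ := goodTimes c.S c.sm c.sp

theorem bounds (c : CutCurve P R r) : ∀ τ ∈ c.S, 0 ≤ τ ∧ τ ≤ 1 := fun τ h =>
  ⟨((c.mem_S τ).1 h).1, ((c.mem_S τ).1 h).2.1⟩

theorem apply_mem (c : CutCurve P R r) {τ : ℝ} (h : τ ∈ c.S) : c.κ τ ∈ P := ((c.mem_S τ).1 h).2.2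

theorem sm_good (c : CutCurve P R r) {τ : ℝ} (h : τ ∈ c.S) (h0 : τ ≠ 0) : c.sm τ ∈ c.good :=
  c.trunc.sm_mem (fun τ h => (c.bounds τ h).2) h h0

theorem sp_good (c : CutCurve P R r) {τ : ℝ} (h : τ ∈ c.S) (h0 : τ ≠ 1) : c.sp τ ∈ c.good :=
  c.trunc.sp_mem (fun τ h => (c.bounds τ h).1) h h0

/-- All visits to `P` of a curve are linked inside a set containing the spokes and a neighbourhood
of the good part. -/
theorem linked (c : CutCurve P R r) {K G : Set ℂ} (hG : ∀ t ∈ c.good, c.κ t ∈ G) {η : ℝ} (hη : 0 < η)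
    (hK : ∀ y ∈ G, ∀ z, ‖z - y‖ < η → z ∈ K) (hsp : spokes P r G ⊆ K) {τ τ' : ℝ} (hτ : τ ∈ c.S)
    (hτ' : τ' ∈ c.S) :
    Relation.ReflTransGen (fun a b => segment ℝ a b ⊆ K) (c.κ τ) (c.κ τ') := by
  have hspoke : ∀ p ∈ P, ∀ e ∈ G, ‖e - p‖ = r →
      Relation.ReflTransGen (fun a b => segment ℝ a b ⊆ K) p e := fun p hp e he h =>
    Relation.ReflTransGen.single fun z hz => hsp ⟨p, hp, e, he, h, hz⟩
  have hgood : ∀ a b, a ≤ b → Set.Icc a b ⊆ c.good →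
      Relation.ReflTransGen (fun a b => segment ℝ a b ⊆ K) (c.κ a) (c.κ b) := by
    intro a b hab hsub
    refine (isPreconnected_Icc (a := a) (b := b)).induction₂
      (fun s t => Relation.ReflTransGen (fun a b => segment ℝ a b ⊆ K) (c.κ s) (c.κ t)) ?_ ?_ ?_
      (Set.left_mem_Icc.2 hab) (Set.right_mem_Icc.2 hab)
    · intro s hs
      have := c.cont.continuousAt (x := s) |>.eventually (Metric.ball_mem_nhds (c.κ s) hη)
      refine (this.filter_mono nhdsWithin_le_nhds).mono fun t ht => ?_
      refine Relation.ReflTransGen.single fun z hz => hK (c.κ s) (hG s (hsub hs)) z ?_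
      rw [← dist_eq_norm]
      exact (convex_ball (c.κ s) η).segment_subset (Metric.mem_ball_self hη) ht hz
    · intro s t u _ _ _ h1 h2
      exact h1.trans h2
    · intro s t _ _ h
      exact reflTransGen_segment_symm h
  have main : ∀ {τ τ'}, τ ∈ c.S → τ' ∈ c.S → τ < τ' →
      Relation.ReflTransGen (fun a b => segment ℝ a b ⊆ K) (c.κ τ) (c.κ τ') := by
    intro τ τ' hτ hτ' hlt
    have h1 : τ ≠ 1 := (hlt.trans_le (c.bounds τ' hτ').2).ne
    have h0 : τ' ≠ 0 := ((c.bounds τ hτ).1.trans_lt hlt).ne'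
    have hmid := c.trunc.induction_on c.bounds
      (fun _ s t => Relation.ReflTransGen (fun a b => segment ℝ a b ⊆ K) (c.κ s) (c.κ t))
      hgood (fun j a u b hu hu0 hu1 _ _ hC hub hsub => by
        have e1 := hspoke _ (c.apply_mem hu) _ (hG _ (c.sm_good hu hu0)) (c.trunc.norm_left u hu hu0)
        have e2 := hspoke _ (c.apply_mem hu) _ (hG _ (c.sp_good hu hu1)) (c.trunc.norm_right u hu hu1)
        exact ((hC.trans (reflTransGen_segment_symm e1)).trans e2).trans (hgood _ _ hub hsub))
      (c.sp_good hτ h1) (c.sm_good hτ' h0) (c.trunc.disj τ hτ τ' hτ' hlt).le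
    exact ((hspoke _ (c.apply_mem hτ) _ (hG _ (c.sp_good hτ h1)) (c.trunc.norm_right τ hτ h1)).trans
      hmid).trans (reflTransGen_segment_symm (hspoke _ (c.apply_mem hτ') _ (hG _ (c.sm_good hτ' h0))
        (c.trunc.norm_left τ' hτ' h0)))
  rcases lt_trichotomy τ τ' with h | rfl | h
  · exact main hτ hτ' h
  · exact .refl
  · exact reflTransGen_segment_symm (main hτ' hτ h)

end CutCurve

/-- A curve avoiding a tree except at visited points of `P`. -/
def CutCurve.Avoids {P : Finset ℂ} {R r : ℝ} (c : CutCurve P R r) (T : Set ℂ) : Prop :=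
  (∀ t ∈ c.good, c.κ t ∉ T) ∧
    ∀ p ∈ P, ∀ t ∈ c.good, ‖c.κ t - p‖ = r → ∀ z ∈ segment ℝ p (c.κ t), z ≠ p → z ∉ T

open PTree in
theorem exists_tree {P V : Finset ℂ} (hVP : V ⊆ P) {ρ : ℂ} (hρ : ρ ∈ P) (hP : ∀ p ∈ P, p.re ≤ ρ.re)
    {R r : ℝ} (hr : 0 < r) (hrR : r < R) (hsep : ∀ p ∈ P, ∀ q ∈ P, p ≠ q → 2 * R ≤ ‖p - q‖)
    {ι ι' : Type*} [Finite ι] [Finite ι'] (A : ι → CutCurve P R r) (F : ι' → CutCurve P R r)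
    (hAre : ∀ i t, ((A i).κ t).re ≤ ρ.re) (hFre : ∀ i t, ((F i).κ t).re ≤ ρ.re)
    (hAF : ∀ i j s t, 0 ≤ s → s ≤ 1 → 0 ≤ t → t ≤ 1 → (A i).κ s = (F j).κ t → (A i).κ s ∈ P)
    (hconn : ∀ E : ℂ → ℂ → Prop, Equivalence E → (∀ i, ∀ s ∈ (A i).S, ∀ t ∈ (A i).S,
      E ((A i).κ s) ((A i).κ t)) → ∀ v ∈ V, E v ρ) :
    ∃ T : PTree ρ, (∀ v ∈ V, v ∈ insert ρ T.N) ∧ T.Pruned V ∧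
      (∀ p ∈ P, p ∈ T.carrier → p ∈ insert ρ T.N) ∧ ∀ j, (F j).Avoids T.carrier := by
  set G : Set ℂ := ⋃ i, (A i).κ '' (A i).good with hGdef
  set H : Set ℂ := ⋃ i, (F i).κ '' (F i).good with hHdef
  have hcpt : ∀ c : CutCurve P R r, IsCompact (c.κ '' c.good) := fun c =>
    (isCompact_goodTimes _ _ _).image c.cont
  have hG : IsCompact G := isCompact_iUnion fun i => hcpt _
  have hH : IsCompact H := isCompact_iUnion fun i => hcpt _
  have hGP : ∀ z ∈ G, ∀ p ∈ P, r ≤ ‖z - p‖ := by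
    intro z hz
    obtain ⟨i, t, ht, rfl⟩ := Set.mem_iUnion.1 hz
    exact (A i).trunc.far t ht
  have hHP : ∀ z ∈ H, ∀ p ∈ P, r ≤ ‖z - p‖ := by
    intro z hz
    obtain ⟨i, t, ht, rfl⟩ := Set.mem_iUnion.1 hz
    exact (F i).trunc.far t ht
  have hdisj : Disjoint G H := by
    rw [Set.disjoint_left]
    intro z hz hz'
    have hzP := hGP z hz
    obtain ⟨i, s, hs, rfl⟩ := Set.mem_iUnion.1 hz
    obtain ⟨j, t, ht, h⟩ := Set.mem_iUnion.1 hz'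
    have := hzP _ (hAF i j s t hs.1 hs.2.1 ht.1 ht.2.1 h.symm)
    simp at this
    linarith
  obtain ⟨K, ⟨η, hη, hK1⟩, hK2, hK3, hK4, hK5⟩ := exists_thickening hρ hP hr hrR hsep hG hH hdisj
    (fun z hz => by obtain ⟨i, t, ht, rfl⟩ := Set.mem_iUnion.1 hz; exact hAre i t)
    (fun z hz => by obtain ⟨i, t, ht, rfl⟩ := Set.mem_iUnion.1 hz; exact hFre i t) hGP hHP
  have hE : Equivalence (Relation.ReflTransGen fun a b => segment ℝ a b ⊆ K) :=
    ⟨fun _ => Relation.ReflTransGen.refl, fun h => reflTransGen_segment_symm h, fun h h' => h.trans h'⟩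
  have hray : ∀ z ∈ P, z ∈ rightRay ρ → z = ρ := fun z hz h => eq_of_mem_rightRay h (hP z hz)
  obtain ⟨T₁, hT₁, hVT₁⟩ := exists_of_links hK3 V (hconn _ hE fun i s hs t ht =>
    (A i).linked (G := G) (fun t ht => Set.mem_iUnion.2 ⟨i, t, ht, rfl⟩) hη hK1 hK2 hs ht)
  obtain ⟨T₂, hT₂, hPT₂⟩ := exists_nodes T₁ P hray
  obtain ⟨T₃, hT₃, hVT₃, hpr, hn⟩ := exists_prune T₂ (V : Set ℂ)
    fun v hv => hPT₂ v (hVP hv) (hVT₁ v hv)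
  have hsub : T₃.carrier ⊆ K ∪ rightRay ρ := hT₃.trans (hT₂ ▸ hT₁)
  refine ⟨T₃, hVT₃, hpr, fun p hp hpT => hn p (hPT₂ p hp (hT₂ ▸ hT₃ hpT)) hpT, fun j => ⟨fun t ht h =>
    hK4 _ (Set.mem_iUnion.2 ⟨j, t, ht, rfl⟩) (hsub h), fun p hp t ht hpt z hz hzp h =>
    hK5 p hp _ (Set.mem_iUnion.2 ⟨j, t, ht, rfl⟩) hpt z hz hzp (hsub h)⟩⟩

theorem exists_pos_forall_finset (s : Finset ℂ) (p : ℂ → ℝ → Prop)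
    (hmono : ∀ q r r', p q r → r' ≤ r → p q r') (h : ∀ q ∈ s, ∃ r > 0, p q r) {R : ℝ} (hR : 0 < R) :
    ∃ r > 0, r ≤ R ∧ ∀ q ∈ s, p q r := by
  classical
  induction s using Finset.induction_on with
  | empty => exact ⟨R, hR, le_rfl, by simp⟩
  | insert a s _ ih =>
    obtain ⟨r, hr, hrR, hs⟩ := ih fun q hq => h q (Finset.mem_insert_of_mem hq)
    obtain ⟨r', hr', ha⟩ := h a (Finset.mem_insert_self _ _)
    refine ⟨min r r', lt_min hr hr', (min_le_left _ _).trans hrR, fun q hq => ?_⟩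
    rcases Finset.mem_insert.1 hq with rfl | hq
    · exact hmono _ _ _ ha (min_le_right _ _)
    · exact hmono _ _ _ (hs q hq) (min_le_left _ _)

section Subpaths

variable {X : Type*} [TopologicalSpace X]

/-- The affine path between two points of the open unit interval. -/
def linPath (a b : Set.Ioo (0 : ℝ) 1) : Path a b where
  toFun t := ⟨a + t * (b - a), by
    have := (convex_Ioo (0 : ℝ) 1).add_smul_sub_mem a.2 b.2 t.2
    simpa using this⟩
  continuous_toFun := by fun_prop
  source' := by simp
  target' := by simp

/-- The restriction of a curve to a subinterval. -/
def subPath (γ : C(Set.Ioo (0 : ℝ) 1, X)) (a b : Set.Ioo (0 : ℝ) 1) : Path (γ a) (γ b) :=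
  (linPath a b).map γ.continuous

def subClass (γ : C(Set.Ioo (0 : ℝ) 1, X)) (a b : Set.Ioo (0 : ℝ) 1) :
    Path.Homotopic.Quotient (γ a) (γ b) := Path.Homotopic.Quotient.mk (subPath γ a b)

theorem subClass_trans (γ : C(Set.Ioo (0 : ℝ) 1, X)) (a b c : Set.Ioo (0 : ℝ) 1) :
    (subClass γ a b).trans (subClass γ b c) = subClass γ a c := by
  have : ContractibleSpace (Set.Ioo (0 : ℝ) 1) := (convex_Ioo (0 : ℝ) 1).contractibleSpace ⟨a, a.2⟩
  have h := SimplyConnectedSpace.paths_homotopic ((linPath a b).trans (linPath b c)) (linPath a c)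
  have h2 := h.map γ
  rw [subClass, subClass, subClass, ← Path.Homotopic.Quotient.mk_trans]
  refine Path.Homotopic.Quotient.eq.2 ?_
  rw [Path.map_trans] at h2
  exact h2

theorem inS_subClass (γ : C(Set.Ioo (0 : ℝ) 1, X)) {a b : Set.Ioo (0 : ℝ) 1} (hab : (a : ℝ) ≤ b)
    {S : Set X} (h : ∀ t : Set.Ioo (0 : ℝ) 1, (a : ℝ) ≤ t → (t : ℝ) ≤ b → γ t ∈ S) :
    InS S (subClass γ a b) := by
  refine ⟨subPath γ a b, fun t => h _ ?_ ?_, rfl⟩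
  · have := mul_nonneg t.2.1 (sub_nonneg.2 hab)
    simpa [linPath] using this
  · have := mul_le_mul_of_nonneg_right t.2.2 (sub_nonneg.2 hab)
    simp [linPath]
    linarith

theorem goodTimes_subset_Ioo {P : Finset ℂ} {R r : ℝ} (c : CutCurve P R r) {t : ℝ} (ht : t ∈ c.good) :
    t ∈ Set.Ioo (0 : ℝ) 1 := by
  obtain ⟨h0, h1, h⟩ := ht
  have e0 := c.trunc.lt_left 0 c.zero_mem
  have e1 := c.trunc.lt_right 0 c.zero_mem
  have e2 := c.trunc.lt_left 1 c.one_mem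
  have e3 := c.trunc.lt_right 1 c.one_mem
  constructor
  · rcases h 0 c.zero_mem with h | h <;> linarith
  · rcases h 1 c.one_mem with h | h <;> linarith

/-- A curve that stays in a thin set outside its visits to `P` spells a word whose letters come
from the visits. -/
theorem CutCurve.mem_wordSet {P : Finset ℂ} {R r : ℝ} (c : CutCurve P R r)
    (γ : C(Set.Ioo (0 : ℝ) 1, X)) {Ω : Set X} (hΩ : Thin Ω) {b₀ : X}
    (hconn : ∀ x ∈ Ω, ∃ α : Path.Homotopic.Quotient b₀ x, InS Ω α)
    (hgood : ∀ t : Set.Ioo (0 : ℝ) 1, (t : ℝ) ∈ c.good → γ t ∈ Ω)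
    {G : Set (Path.Homotopic.Quotient b₀ b₀)}
    (hmid : ∀ τ ∈ c.S, ∀ s t : Set.Ioo (0 : ℝ) 1, τ ≠ 0 → τ ≠ 1 → (s : ℝ) = c.sm τ → (t : ℝ) = c.sp τ →
      ∀ α β, InS Ω α → InS Ω β → α.trans ((subClass γ s t).trans β.symm) ∈ G)
    {a b : Set.Ioo (0 : ℝ) 1} (ha : (a : ℝ) ∈ c.good) (hb : (b : ℝ) ∈ c.good) (hab : (a : ℝ) ≤ b)
    {α : Path.Homotopic.Quotient b₀ (γ a)} {β : Path.Homotopic.Quotient b₀ (γ b)} (hα : InS Ω α) (hβ : InS Ω β) :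
    α.trans ((subClass γ a b).trans β.symm) ∈
      wordSet G ((c.S.filter fun τ => (a : ℝ) < τ ∧ τ < b).card) := by
  have hIn : ∀ a b : Set.Ioo (0 : ℝ) 1, (a : ℝ) ≤ b → Set.Icc (a : ℝ) b ⊆ c.good →
      InS Ω (subClass γ a b) := fun a b hab hsub =>
    inS_subClass γ hab fun t h1 h2 => hgood t (hsub ⟨h1, h2⟩)
  refine c.trunc.induction_on c.bounds (fun j a b => ∀ (ha : a ∈ Set.Ioo (0 : ℝ) 1) (hb : b ∈ Set.Ioo (0 : ℝ) 1)
    (α : Path.Homotopic.Quotient b₀ (γ ⟨a, ha⟩)) (β : Path.Homotopic.Quotient b₀ (γ ⟨b, hb⟩)),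
    InS Ω α → InS Ω β → α.trans ((subClass γ ⟨a, ha⟩ ⟨b, hb⟩).trans β.symm) ∈ wordSet G j)
    ?_ ?_ ha hb hab a.2 b.2 α β hα hβ
  · intro a b hab hsub ha hb α β hα hβ
    have h1 := hIn ⟨a, ha⟩ ⟨b, hb⟩ hab hsub
    exact hΩ _ _ (hα.trans (h1.trans hβ.symm)) (InS.refl hα.source)
  · intro j a τ b hτ h0 h1 hag ham hC hpb hsub ha hb α β hα hβ
    have hm := c.sm_good hτ h0
    have hp := c.sp_good hτ h1
    have hm' := goodTimes_subset_Ioo c hm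
    have hp' := goodTimes_subset_Ioo c hp
    obtain ⟨αm, hαm⟩ := hconn _ (hgood ⟨_, hm'⟩ hm)
    obtain ⟨αp, hαp⟩ := hconn _ (hgood ⟨_, hp'⟩ hp)
    have hlast : αp.trans (subClass γ ⟨_, hp'⟩ ⟨b, hb⟩) = β :=
      hΩ _ _ (hαp.trans (hIn ⟨_, hp'⟩ ⟨b, hb⟩ hpb hsub)) hβ
    refine ⟨_, hC ha hm' α αm hα hαm, _, hmid τ hτ ⟨_, hm'⟩ ⟨_, hp'⟩ h0 h1 rfl rfl αm αp hαm hαp, ?_⟩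
    rw [← hlast, ← subClass_trans γ ⟨a, ha⟩ ⟨c.sm τ, hm'⟩ ⟨b, hb⟩,
      ← subClass_trans γ ⟨c.sm τ, hm'⟩ ⟨c.sp τ, hp'⟩ ⟨b, hb⟩]
    simp only [Path.Homotopic.Quotient.trans_assoc, symm_trans_rev, symm_trans_cancel]
    congr 3
    rw [trans_symm_cancel]

end Subpaths

/-- The interior of a curve as a map into the punctured plane. -/
def innerCurve {V : Finset ℂ} {κ : ℝ → ℂ} (hκ : Continuous κ) (hV : ∀ t, 0 < t → t < 1 → κ t ∉ V) :
    C(Set.Ioo (0 : ℝ) 1, Punc V) where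
  toFun t := ⟨κ t, hV t t.2.1 t.2.2⟩
  continuous_toFun := by fun_prop

namespace PTree

variable {ρ : ℂ}

theorem exists_inS_compl (T : PTree ρ) {V : Finset ℂ} (hV : ∀ v ∈ V, v ∈ insert ρ T.N) {x y : Punc V}
    (hx : (x : ℂ) ∉ T.carrier) (hy : (y : ℂ) ∉ T.carrier) :
    ∃ α : Path.Homotopic.Quotient x y, InS (pLift V T.carrierᶜ) α := by
  have h := isSimplyConnected_compl _ T rfl
  exact (h.isPathConnected.joinedIn x hx y hy).exists_inS fun v hv (hvT : v ∉ T.carrier) => hvT (T.node_mem (hV v hv))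

/-- Radii at which the tree is conic at its nodes, misses the points of `P` that are not nodes, and
for which the discs around nodes outside `V` are free of `V`. -/
theorem exists_radius (T : PTree ρ) {V P : Finset ℂ} (hP : ∀ p ∈ P, p ∈ T.carrier → p ∈ insert ρ T.N)
    {R : ℝ} (hR : 0 < R) :
    ∃ r > 0, r ≤ R ∧ (∀ q ∈ insert ρ T.N, T.Conic q r) ∧
      (∀ q ∈ insert ρ T.N, q ∉ V → ∀ v ∈ V, v ∉ Metric.ball q r) ∧
      ∀ p ∈ P, p ∉ insert ρ T.N → ∀ z ∈ Metric.ball p r, z ∉ T.carrier := by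
  classical
  obtain ⟨r₁, hr₁, hrR, h₁⟩ := exists_pos_forall_finset (insert ρ T.N) (fun q r => T.Conic q r)
    (fun q r r' h hr => h.mono hr) (fun q hq => T.exists_conic hq) hR
  obtain ⟨r₂, hr₂, hrR₂, h₂⟩ := exists_pos_forall_finset (insert ρ T.N)
    (fun q r => q ∉ V → ∀ v ∈ V, v ∉ Metric.ball q r)
    (fun q r r' h hr hq v hv hvb => h hq v hv (Metric.ball_subset_ball hr hvb)) (fun q hq => by
      by_cases hqV : q ∈ V
      · exact ⟨1, one_pos, fun h => absurd hqV h⟩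
      · obtain ⟨r, hr, hb⟩ := Metric.isOpen_iff.1 V.finite_toSet.isClosed.isOpen_compl q hqV
        exact ⟨r, hr, fun _ v hv hvb => hb hvb hv⟩) hr₁
  obtain ⟨r₃, hr₃, hrR₃, h₃⟩ := exists_pos_forall_finset P
    (fun q r => q ∉ insert ρ T.N → ∀ z ∈ Metric.ball q r, z ∉ T.carrier)
    (fun q r r' h hr hq v hvb => h hq v (Metric.ball_subset_ball hr hvb)) (fun q hq => by
      by_cases hqT : q ∈ T.carrier
      · exact ⟨1, one_pos, fun h => absurd (hP q hq hqT) h⟩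
      · obtain ⟨r, hr, hb⟩ := Metric.isOpen_iff.1 T.isClosed_carrier.isOpen_compl q hqT
        exact ⟨r, hr, fun _ z hz => hb hz⟩) hr₂
  exact ⟨r₃, hr₃, by linarith, fun q hq => (h₁ q hq).mono (by linarith), fun q hq hqV v hv hvb =>
    h₂ q hq hqV v hv (Metric.ball_subset_ball hrR₃ hvb), h₃⟩

end PTree

/-- Sliding the end of a spoke towards its centre. -/
theorem exists_slide {V : Finset ℂ} {R r rT : ℝ} (hr : 0 < r) (hrR : r < R) (hrT : 0 < rT) {p e : ℂ}
    (he : ‖e - p‖ = r) {T : Set ℂ} (hT : ∀ z ∈ segment ℝ p e, z ≠ p → z ∉ T)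
    (hV : ∀ z ∈ Metric.ball p R, z ≠ p → z ∉ V) :
    ∃ (e' : ℂ), e' ∈ Metric.ball p rT ∧ e' ≠ p ∧ e' ∉ V ∧
      segment ℝ e e' ⊆ Metric.ball p R ∩ Tᶜ ∩ {z | z ∉ V} := by
  set c := min 1 (rT / (2 * r)) with hc
  have hc0 : 0 < c := lt_min one_pos (by positivity)
  have hc1 : c ≤ 1 := min_le_left _ _
  have hcr : c * r < rT := by
    have : c * r ≤ rT / (2 * r) * r := mul_le_mul_of_nonneg_right (min_le_right _ _) hr.le
    have h2 : rT / (2 * r) * r = rT / 2 := by field_simp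
    linarith
  have hep : e - p ≠ 0 := by
    rw [← norm_pos_iff, he]; exact hr
  have hmem : ∀ z ∈ segment ℝ e (p + c * (e - p)), z ∈ segment ℝ p e ∧ z ≠ p := by
    intro z hz
    obtain ⟨u, h0, h1, rfl⟩ := mem_segment_iff_exists.1 hz
    have hpos : 0 < 1 + u * (c - 1) := by nlinarith
    have hz : e + u * (p + c * (e - p) - e) = p + ((1 + u * (c - 1) : ℝ) : ℂ) * (e - p) := by
      push_cast; ring
    rw [hz]
    refine ⟨mem_segment_iff_exists.2 ⟨_, hpos.le, by nlinarith, rfl⟩, ?_⟩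
    have : (((1 + u * (c - 1) : ℝ) : ℂ)) ≠ 0 := by exact_mod_cast hpos.ne'
    rw [Ne, add_eq_left]
    exact mul_ne_zero this hep
  have hb : ∀ z ∈ segment ℝ e (p + c * (e - p)), z ∈ Metric.ball p R := fun z hz => by
    rw [Metric.mem_ball, dist_eq_norm]
    exact (norm_le_of_mem_spoke he (hmem z hz).1).trans_lt hrR
  have hr' := hmem _ (right_mem_segment ℝ _ _)
  refine ⟨p + c * (e - p), ?_, hr'.2, hV _ (hb _ (right_mem_segment ℝ _ _)) hr'.2, fun z hz =>
    ⟨⟨hb z hz, hT z (hmem z hz).1 (hmem z hz).2⟩, hV z (hb z hz) (hmem z hz).2⟩⟩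
  rw [Metric.mem_ball, dist_eq_norm, add_sub_cancel_left, norm_mul, he, Complex.norm_real,
    Real.norm_of_nonneg hc0.le]
  exact hcr

/-- Passing through a visited point is a generator. -/
theorem visit_mem_gens {V P : Finset ℂ} (hVP : V ⊆ P) {ρ : ℂ} {R r : ℝ} (hr : 0 < r) (hrR : r < R)
    (hsep : ∀ p ∈ P, ∀ q ∈ P, p ≠ q → 2 * R ≤ ‖p - q‖) (T : PTree ρ) (hV : ∀ v ∈ V, v ∈ insert ρ T.N)
    {rT : ℝ} (hrT : 0 < rT) (hrTR : rT ≤ R)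
    (hPT : ∀ p ∈ P, p ∉ insert ρ T.N → ∀ z ∈ Metric.ball p rT, z ∉ T.carrier)
    {p : ℂ} (hp : p ∈ P) (hpV : p ∉ V) {b₀ x x' : Punc V} (hx : ‖(x : ℂ) - p‖ = r) (hx' : ‖(x' : ℂ) - p‖ = r)
    (hxT : ∀ z ∈ segment ℝ p x, z ≠ p → z ∉ T.carrier) (hxT' : ∀ z ∈ segment ℝ p x', z ≠ p → z ∉ T.carrier)
    {μ : Path.Homotopic.Quotient x x'} (hμ : InS (pLift V (Metric.ball p R)) μ)
    {α : Path.Homotopic.Quotient b₀ x} {β : Path.Homotopic.Quotient b₀ x'}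
    (hα : InS (pLift V T.carrierᶜ) α) (hβ : InS (pLift V T.carrierᶜ) β) :
    α.trans (μ.trans β.symm) ∈ T.gens V rT b₀ := by
  have hfree : ∀ v ∈ V, v ∉ Metric.ball p R := by
    intro v hv hvb
    have := hsep v (hVP hv) p hp (fun h => hpV (h ▸ hv))
    rw [Metric.mem_ball, dist_eq_norm] at hvb
    linarith
  have hfree' : ∀ v ∈ V, v ∉ Metric.ball p rT := fun v hv hvb =>
    hfree v hv (Metric.ball_subset_ball hrTR hvb)
  have hΩ := T.thin_compl hV
  have hD := thin_lift_of_convex (convex_ball p R) hfree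
  have hslide : ∀ x : Punc V, ‖(x : ℂ) - p‖ = r → (∀ z ∈ segment ℝ p x, z ≠ p → z ∉ T.carrier) →
      ∃ y : Punc V, (y : ℂ) ∈ Metric.ball p rT ∧ ∃ δ : Path.Homotopic.Quotient x y,
        InS (pLift V (Metric.ball p R) ∩ pLift V T.carrierᶜ) δ := by
    intro x hx hxT
    obtain ⟨e', h1, h2, h3, h4⟩ := exists_slide (V := V) hr hrR hrT hx hxT
      fun z hz _ hzV => hfree z hzV hz
    obtain ⟨δ, hδ⟩ := JoinedIn.exists_inS (V := V) (S := Metric.ball p R ∩ T.carrierᶜ)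
      (fun v hv h => hfree v hv h.1) (x := x) (y := ⟨e', h3⟩)
      (joinedIn_of_segment_subset fun z hz => (h4 hz).1)
    exact ⟨⟨e', h3⟩, h1, δ, hδ⟩
  obtain ⟨y, hy, δ, hδ⟩ := hslide x hx hxT
  obtain ⟨y', hy', δ', hδ'⟩ := hslide x' hx' hxT'
  obtain ⟨ν, hν⟩ := exists_inS_of_convex (convex_ball p rT) hfree' (x := y) (y := y') hy hy'
  have h1 := hα.trans (hδ.mono Set.inter_subset_right)
  have h2 := hβ.trans (hδ'.mono Set.inter_subset_right)
  have hνD : InS (pLift V (Metric.ball p R)) ν :=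
    hν.mono fun z hz => Metric.ball_subset_ball hrTR hz
  rw [conj_eq_of_joined hΩ hD hα hμ hβ h1 hνD h2 hδ hδ']
  by_cases hpT : p ∈ insert ρ T.N
  · refine Or.inr (Set.mem_biUnion (x := p) ⟨hpT, hpV⟩ ?_)
    exact ⟨y, y', _, ν, _, h1, hν, h2, rfl⟩
  · have hνΩ : InS (pLift V T.carrierᶜ) ν := hν.mono fun z hz => hPT p hp hpT z hz
    exact Or.inl (hΩ _ _ (h1.trans (hνΩ.trans h2.symm)) (InS.refl h1.source))

theorem CutCurve.word_mem {V P : Finset ℂ} (hVP : V ⊆ P) {ρ : ℂ} {R r : ℝ} (hr : 0 < r) (hrR : r < R)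
    (hsep : ∀ p ∈ P, ∀ q ∈ P, p ≠ q → 2 * R ≤ ‖p - q‖) (T : PTree ρ) (hV : ∀ v ∈ V, v ∈ insert ρ T.N)
    {rT : ℝ} (hrT : 0 < rT) (hrTR : rT ≤ R)
    (hPT : ∀ p ∈ P, p ∉ insert ρ T.N → ∀ z ∈ Metric.ball p rT, z ∉ T.carrier)
    (c : CutCurve P R r) (hc : c.Avoids T.carrier) (hcV : ∀ t, 0 < t → t < 1 → c.κ t ∉ V) {k : ℕ}
    (hk : (c.S.filter fun τ => 0 < τ ∧ τ < 1).card ≤ k) {b₀ : Punc V} (hb₀ : (b₀ : ℂ) ∉ T.carrier)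
    {a b : Set.Ioo (0 : ℝ) 1} (ha : (a : ℝ) ∈ c.good) (hb : (b : ℝ) ∈ c.good) (hab : (a : ℝ) ≤ b)
    {α : Path.Homotopic.Quotient b₀ (innerCurve c.cont hcV a)}
    {β : Path.Homotopic.Quotient b₀ (innerCurve c.cont hcV b)}
    (hα : InS (pLift V T.carrierᶜ) α) (hβ : InS (pLift V T.carrierᶜ) β) :
    α.trans ((subClass (innerCurve c.cont hcV) a b).trans β.symm) ∈ wordSet (T.gens V rT b₀) k := by
  refine wordSet_mono (Or.inl rfl) (le_trans (Finset.card_le_card ?_) hk)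
    (c.mem_wordSet (innerCurve c.cont hcV) (T.thin_compl hV)
      (fun x hx => T.exists_inS_compl hV hb₀ hx) (fun t ht => hc.1 t ht) ?_ ha hb hab hα hβ)
  · intro τ hτ
    obtain ⟨h1, h2, h3⟩ := Finset.mem_filter.1 hτ
    exact Finset.mem_filter.2 ⟨h1, a.2.1.trans h2, h3.trans b.2.2⟩
  · intro τ hτ s t h0 h1 hs ht α β hα hβ
    have hb := c.bounds τ hτ
    have hs1 := c.sm_good hτ h0
    have ht1 := c.sp_good hτ h1
    have hl := c.trunc.norm_left τ hτ h0
    have hrr := c.trunc.norm_right τ hτ h1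
    have hlt : c.sm τ ≤ c.sp τ := ((c.trunc.lt_left τ hτ).trans (c.trunc.lt_right τ hτ)).le
    refine visit_mem_gens hVP hr hrR hsep T hV hrT hrTR hPT (c.apply_mem hτ)
      (hcV τ (lt_of_le_of_ne hb.1 h0.symm) (lt_of_le_of_ne hb.2 h1)) ((congrArg (fun u => ‖c.κ u - c.κ τ‖) hs).trans hl)
      ((congrArg (fun u => ‖c.κ u - c.κ τ‖) ht).trans hrr) (fun z hz => ?_) (fun z hz => ?_) ?_ hα hβ
    · refine hc.2 _ (c.apply_mem hτ) _ hs1 hl z ?_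
      rw [← hs]; exact hz
    · refine hc.2 _ (c.apply_mem hτ) _ ht1 hrr z ?_
      rw [← ht]; exact hz
    · refine inS_subClass _ (by rw [hs, ht]; exact hlt) fun u h1 h2 => ?_
      have := c.trunc.mem_ball τ hτ u u.2.1.le u.2.2.le (by rw [← hs]; exact h1) (by rw [← ht]; exact h2)
      rw [← dist_eq_norm] at this
      exact this

/-- A continuous curve from `v` to `w` whose interior avoids `V`. -/
def GoodArc (V : Set ℂ) (v w : ℂ) (g : I → ℂ) : Prop :=
  g 0 = v ∧ g 1 = w ∧ ∀ t, t ≠ 0 → t ≠ 1 → g t ∉ V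

/-- Homotopy through curves from `v` to `w` whose interiors avoid `V`. -/
def ArcHomotopic (V : Set ℂ) (v w : ℂ) (a b : I → ℂ) : Prop :=
  ∃ (ha : Continuous a) (hb : Continuous b),
    ContinuousMap.HomotopicWith ⟨a, ha⟩ ⟨b, hb⟩ fun g => GoodArc V v w g

namespace ArcHomotopic

variable {V : Set ℂ} {v w : ℂ} {a b c : I → ℂ}

theorem symm (h : ArcHomotopic V v w a b) : ArcHomotopic V v w b a := by
  obtain ⟨ha, hb, h⟩ := h
  exact ⟨hb, ha, h.symm⟩

theorem trans (h : ArcHomotopic V v w a b) (h' : ArcHomotopic V v w b c) : ArcHomotopic V v w a c := by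
  obtain ⟨ha, hb, h⟩ := h
  obtain ⟨hb', hc, h'⟩ := h'
  exact ⟨ha, hc, h.trans h'⟩

theorem of_family (F : I → I → ℂ) (hF : Continuous fun p : I × I => F p.1 p.2)
    (h : ∀ s, GoodArc V v w (F s)) : ArcHomotopic V v w (F 0) (F 1) := by
  refine ⟨by fun_prop, by fun_prop, ⟨⟨⟨⟨fun p => F p.1 p.2, hF⟩, fun t => rfl, fun t => rfl⟩, fun s => h s⟩⟩⟩

theorem exists_family (h : ArcHomotopic V v w a b) :
    ∃ F : I → I → ℂ, (Continuous fun p : I × I => F p.1 p.2) ∧ (∀ s, GoodArc V v w (F s)) ∧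
      F 0 = a ∧ F 1 = b := by
  obtain ⟨ha, hb, ⟨h⟩⟩ := h
  refine ⟨fun s t => h (s, t), h.toHomotopy.continuous, fun s => h.prop s, ?_, ?_⟩
  · ext t; exact h.map_zero_left t
  · ext t; exact h.map_one_left t

theorem homotopicIn (h : ArcHomotopic V v w a b) :
    ∃ g : I × I → ℂ, Continuous g ∧
      (∀ t, g (0, t) = a t) ∧ (∀ t, g (1, t) = b t) ∧
      (∀ s, g (s, 0) = a 0) ∧ (∀ s, g (s, 1) = a 1) ∧
      (∀ s t : I, s ≠ 0 → s ≠ 1 → t ≠ 0 → t ≠ 1 → g (s, t) ∉ V) := by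
  obtain ⟨F, hF, hg, rfl, rfl⟩ := h.exists_family
  exact ⟨fun p => F p.1 p.2, hF, fun _ => rfl, fun _ => rfl, fun s => (hg s).1.trans (hg 0).1.symm,
    fun s => (hg s).2.1.trans (hg 0).2.1.symm, fun s t _ _ => (hg s).2.2 t⟩

theorem reverse (h : ArcHomotopic V v w a b) :
    ArcHomotopic V w v (fun t => a (σ t)) (fun t => b (σ t)) := by
  obtain ⟨F, hF, hg, rfl, rfl⟩ := h.exists_family
  refine of_family (fun s t => F s (σ t)) (hF.comp (by fun_prop : Continuous fun p : I × I => (p.1, σ p.2)))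
    fun s => ⟨by simpa using (hg s).2.1, by simpa using (hg s).1, fun t h0 h1 => (hg s).2.2 _ ?_ ?_⟩
  · intro h
    exact h1 (by rw [← unitInterval.symm_symm t, h, unitInterval.symm_zero])
  · intro h
    exact h0 (by rw [← unitInterval.symm_symm t, h, unitInterval.symm_one])

end ArcHomotopic

theorem continuous_max_div_mul {κ : ℝ → ℂ} (hκ : Continuous κ) (a : ℝ) {v : ℂ} (hv : κ 0 = v) :
    Continuous fun p : I × I => v + ((p.2 / max (p.2 : ℝ) (p.1 * a) : ℝ) : ℂ) *
      (κ (max (p.2 : ℝ) (p.1 * a)) - v) := by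
  rw [continuous_iff_continuousAt]
  intro p
  by_cases hp : max (p.2 : ℝ) (p.1 * a) = 0
  · have hm : Continuous fun p : I × I => max (p.2 : ℝ) (p.1 * a) := by fun_prop
    have h1 : Filter.Tendsto (fun p : I × I => κ (max (p.2 : ℝ) (p.1 * a)) - v) (nhds p) (nhds 0) := by
      have : Continuous fun p : I × I => κ (max (p.2 : ℝ) (p.1 * a)) - v := by fun_prop
      convert this.tendsto p using 2
      rw [hp, hv, sub_self]
    have h2 : Filter.Tendsto (fun p : I × I => ((p.2 / max (p.2 : ℝ) (p.1 * a) : ℝ) : ℂ) *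
        (κ (max (p.2 : ℝ) (p.1 * a)) - v)) (nhds p) (nhds 0) := by
      refine squeeze_zero_norm (fun q => ?_) (by simpa using h1.norm)
      rw [norm_mul, Complex.norm_real]
      have hq : 0 ≤ (q.2 : ℝ) := q.2.2.1
      have : ‖(q.2 / max (q.2 : ℝ) (q.1 * a) : ℝ)‖ ≤ 1 := by
        rw [Real.norm_of_nonneg (div_nonneg hq (hq.trans (le_max_left _ _)))]
        exact div_le_one_of_le₀ (le_max_left _ _) (hq.trans (le_max_left _ _))
      exact mul_le_of_le_one_left (norm_nonneg _) this
    have h3 := h2.const_add v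
    rw [ContinuousAt]
    convert h3 using 2
    rw [hp, hv, sub_self, mul_zero]
  · have : ContinuousAt (fun p : I × I => ((p.2 / max (p.2 : ℝ) (p.1 * a) : ℝ) : ℂ)) p := by
      refine Complex.continuous_ofReal.continuousAt.comp ?_
      exact ContinuousAt.div (by fun_prop) (by fun_prop) hp
    have h2 : ContinuousAt (fun p : I × I => κ (max (p.2 : ℝ) (p.1 * a)) - v) p :=
      Continuous.continuousAt (by fun_prop)
    exact continuousAt_const.add (this.mul h2)

/-- Replace the beginning of a curve by a straight segment. -/
noncomputable def capLeft (v : ℂ) (a : ℝ) (κ : ℝ → ℂ) (t : ℝ) : ℂ :=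
  v + ((t / max t a : ℝ) : ℂ) * (κ (max t a) - v)

theorem capLeft_of_ge {v : ℂ} {a : ℝ} (ha : 0 < a) {κ : ℝ → ℂ} {t : ℝ} (h : a ≤ t) :
    capLeft v a κ t = κ t := by
  rw [capLeft, max_eq_left h, div_self (by linarith)]
  simp

theorem capLeft_of_le {v : ℂ} {a : ℝ} {κ : ℝ → ℂ} {t : ℝ} (h : t ≤ a) :
    capLeft v a κ t = v + ((t / a : ℝ) : ℂ) * (κ a - v) := by
  rw [capLeft, max_eq_right h]

theorem continuous_capLeft {v : ℂ} {a : ℝ} (ha : 0 < a) {κ : ℝ → ℂ} (hκ : Continuous κ) :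
    Continuous (capLeft v a κ) := by
  have : Continuous fun t : ℝ => t / max t a :=
    continuous_id.div (by fun_prop) fun t => (ha.trans_le (le_max_right _ _)).ne'
  unfold capLeft
  fun_prop

theorem add_mul_sub_mem_ball {v z : ℂ} {R c : ℝ} (hz : z ∈ Metric.ball v R) (h0 : 0 ≤ c) (h1 : c ≤ 1) :
    v + (c : ℂ) * (z - v) ∈ Metric.ball v R := by
  rw [Metric.mem_ball, dist_eq_norm] at *
  rw [add_sub_cancel_left, norm_mul, Complex.norm_real, Real.norm_of_nonneg h0]
  exact (mul_le_of_le_one_left (norm_nonneg _) h1).trans_lt hz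

theorem add_mul_sub_not_mem {V : Set ℂ} {v z : ℂ} {R c : ℝ} (hball : ∀ z ∈ Metric.ball v R, z ≠ v → z ∉ V)
    (hz : z ∈ Metric.ball v R) (hzv : z ≠ v) (h0 : 0 < c) (h1 : c ≤ 1) :
    v + (c : ℂ) * (z - v) ∉ V := by
  refine hball _ (add_mul_sub_mem_ball hz h0.le h1) ?_
  rw [Ne, add_eq_left]
  exact mul_ne_zero (by exact_mod_cast h0.ne') (sub_ne_zero.2 hzv)

theorem arcHomotopic_capLeft {V : Set ℂ} {v w : ℂ} {κ : ℝ → ℂ} (hκ : Continuous κ) (h0 : κ 0 = v)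
    (h1 : κ 1 = w) (hV : ∀ t, 0 < t → t < 1 → κ t ∉ V) (hv : v ∈ V) {a : ℝ} (ha : 0 < a) (ha1 : a < 1)
    {R : ℝ} (hball : ∀ z ∈ Metric.ball v R, z ≠ v → z ∉ V)
    (hκa : ∀ t, 0 ≤ t → t ≤ a → κ t ∈ Metric.ball v R) :
    ArcHomotopic V v w (fun t => κ t) (fun t => capLeft v a κ t) := by
  have h := ArcHomotopic.of_family (V := V) (v := v) (w := w)
    (fun s t => v + ((t / max (t : ℝ) (s * a) : ℝ) : ℂ) * (κ (max (t : ℝ) (s * a)) - v))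
    (continuous_max_div_mul hκ a h0) fun s => ?_
  · convert h using 1
    · ext t
      have ht : 0 ≤ (t : ℝ) := t.2.1
      simp only [Set.Icc.coe_zero, zero_mul, max_eq_left ht]
      rcases ht.eq_or_lt with h | h
      · simp [← h, h0]
      · rw [div_self h.ne']; simp
    · ext t
      simp [capLeft]
  have hsa : (s : ℝ) * a < 1 := (mul_le_of_le_one_left ha.le s.2.2).trans_lt ha1
  have hsa0 : 0 ≤ (s : ℝ) * a := mul_nonneg s.2.1 ha.le
  refine ⟨by simp, ?_, fun t ht0 ht1 => ?_⟩
  · simp [max_eq_left hsa.le, h1]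
  · have ht0' : 0 < (t : ℝ) := unitInterval.pos_iff_ne_zero.2 ht0
    have ht1' : (t : ℝ) < 1 := unitInterval.lt_one_iff_ne_one.2 ht1
    beta_reduce
    rcases le_total ((s : ℝ) * a) t with h | h
    · rw [max_eq_left h, div_self ht0'.ne']
      simpa using hV t ht0' ht1'
    · rw [max_eq_right h]
      have hpos := ht0'.trans_le h
      refine add_mul_sub_not_mem hball (hκa _ hsa0 (mul_le_of_le_one_left ha.le s.2.2)) ?_
        (div_pos ht0' hpos) ((div_le_one hpos).2 h)
      intro h
      exact hV _ hpos hsa (h ▸ hv)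

/-- A curve consisting of a segment from `v`, the curve `g`, and a segment to `w`. -/
noncomputable def capped (v w : ℂ) (α β : ℝ) (g : I → ℂ) (t : ℝ) : ℂ :=
  g (Set.projIcc 0 1 zero_le_one ((t - α) / (β - α))) +
    ((max 0 (1 - t / α) : ℝ) : ℂ) * (v - g 0) + ((max 0 (1 - (1 - t) / (1 - β)) : ℝ) : ℂ) * (w - g 1)

section capped

variable {v w : ℂ} {α β : ℝ} {g : I → ℂ} {t : ℝ}

theorem capped_of_le (hα : 0 < α) (hαβ : α < β) (hβ : β < 1) (h : t ≤ α) :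
    capped v w α β g t = v + ((t / α : ℝ) : ℂ) * (g 0 - v) := by
  have h1 : (t - α) / (β - α) ≤ 0 := div_nonpos_of_nonpos_of_nonneg (by linarith) (by linarith)
  have h2 : 0 ≤ 1 - t / α := sub_nonneg.2 ((div_le_one hα).2 h)
  have h3 : 1 - (1 - t) / (1 - β) ≤ 0 := sub_nonpos.2 ((one_le_div (by linarith)).2 (by linarith))
  rw [capped, Set.projIcc_of_le_left _ h1, max_eq_right h2, max_eq_left h3]
  change g 0 + _ + _ = _
  push_cast
  ring

theorem capped_of_mem (hα : 0 < α) (hβ : β < 1) (h : α ≤ t) (h' : t ≤ β) :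
    capped v w α β g t = g (Set.projIcc 0 1 zero_le_one ((t - α) / (β - α))) := by
  have h2 : 1 - t / α ≤ 0 := sub_nonpos.2 ((one_le_div hα).2 h)
  have h3 : 1 - (1 - t) / (1 - β) ≤ 0 := sub_nonpos.2 ((one_le_div (by linarith)).2 (by linarith))
  rw [capped, max_eq_left h2, max_eq_left h3]
  simp

theorem capped_of_ge (hα : 0 < α) (hαβ : α < β) (hβ : β < 1) (h : β ≤ t) :
    capped v w α β g t = w + (((1 - t) / (1 - β) : ℝ) : ℂ) * (g 1 - w) := by
  have h1 : 1 ≤ (t - α) / (β - α) := (one_le_div (by linarith)).2 (by linarith)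
  have h2 : 1 - t / α ≤ 0 := sub_nonpos.2 ((one_le_div hα).2 (by linarith))
  have h3 : 0 ≤ 1 - (1 - t) / (1 - β) := sub_nonneg.2 ((div_le_one (by linarith)).2 (by linarith))
  rw [capped, Set.projIcc_of_right_le _ h1, max_eq_left h2, max_eq_right h3]
  change g 1 + _ + _ = _
  push_cast
  ring

end capped

theorem arcHomotopic_capped {V : Set ℂ} {v w : ℂ} {R : ℝ}
    (hv : ∀ z ∈ Metric.ball v R, z ≠ v → z ∉ V) (hw : ∀ z ∈ Metric.ball w R, z ≠ w → z ∉ V)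
    (hvV : v ∈ V) (hwV : w ∈ V) {M : I → I → ℂ}
    (hM : Continuous fun p : I × I => M p.1 p.2) (hMV : ∀ s t, M s t ∉ V)
    (h0 : ∀ s, M s 0 ∈ Metric.ball v R) (h1 : ∀ s, M s 1 ∈ Metric.ball w R) {α β : I → ℝ}
    (hα : Continuous α) (hβ : Continuous β) (hα0 : ∀ s, 0 < α s) (hαβ : ∀ s, α s < β s) (hβ1 : ∀ s, β s < 1) :
    ArcHomotopic V v w (fun t => capped v w (α 0) (β 0) (M 0) t)
      (fun t => capped v w (α 1) (β 1) (M 1) t) := by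
  refine ArcHomotopic.of_family (fun s t => capped v w (α s) (β s) (M s) t) ?_ fun s => ⟨?_, ?_, ?_⟩
  · unfold capped
    have e1 : Continuous fun p : I × I => ((p.2 : ℝ) - α p.1) / (β p.1 - α p.1) :=
      Continuous.div (by fun_prop) (by fun_prop) fun p => (sub_pos.2 (hαβ p.1)).ne'
    have e2 : Continuous fun p : I × I => (p.2 : ℝ) / α p.1 :=
      Continuous.div (by fun_prop) (by fun_prop) fun p => (hα0 p.1).ne'
    have e3 : Continuous fun p : I × I => (1 - (p.2 : ℝ)) / (1 - β p.1) :=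
      Continuous.div (by fun_prop) (by fun_prop) fun p => (sub_pos.2 (hβ1 p.1)).ne'
    have e7 : Continuous fun p : I × I =>
        (p.1, Set.projIcc (0 : ℝ) 1 zero_le_one (((p.2 : ℝ) - α p.1) / (β p.1 - α p.1))) :=
      continuous_fst.prodMk (continuous_projIcc.comp e1)
    have e4 : Continuous fun p : I × I =>
        M p.1 (Set.projIcc 0 1 zero_le_one (((p.2 : ℝ) - α p.1) / (β p.1 - α p.1))) :=
      hM.comp e7
    have e5 : Continuous fun p : I × I => M p.1 0 :=
      hM.comp (by fun_prop : Continuous fun p : I × I => (p.1, (0 : I)))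
    have e6 : Continuous fun p : I × I => M p.1 1 :=
      hM.comp (by fun_prop : Continuous fun p : I × I => (p.1, (1 : I)))
    fun_prop
  · beta_reduce
    rw [Set.Icc.coe_zero, capped_of_le (hα0 s) (hαβ s) (hβ1 s) (hα0 s).le]
    simp
  · beta_reduce
    rw [Set.Icc.coe_one, capped_of_ge (hα0 s) (hαβ s) (hβ1 s) (hβ1 s).le]
    simp
  · intro t ht0 ht1
    have ht0' : 0 < (t : ℝ) := unitInterval.pos_iff_ne_zero.2 ht0
    have ht1' : (t : ℝ) < 1 := unitInterval.lt_one_iff_ne_one.2 ht1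
    beta_reduce
    rcases le_total (t : ℝ) (α s) with h | h
    · rw [capped_of_le (hα0 s) (hαβ s) (hβ1 s) h]
      exact add_mul_sub_not_mem hv (h0 s) (fun h => hMV s 0 (h ▸ hvV)) (div_pos ht0' (hα0 s))
        ((div_le_one (hα0 s)).2 h)
    · rcases le_total (t : ℝ) (β s) with h' | h'
      · rw [capped_of_mem (hα0 s) (hβ1 s) h h']
        exact hMV _ _
      · rw [capped_of_ge (hα0 s) (hαβ s) (hβ1 s) h']
        have := sub_pos.2 (hβ1 s)
        exact add_mul_sub_not_mem hw (h1 s) (fun h => hMV s 1 (h ▸ hwV))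
          (div_pos (sub_pos.2 ht1') this) ((div_le_one this).2 (by linarith))

/-- A curve is homotopic to the curve obtained by straightening both ends. -/
theorem arcHomotopic_capped_self {V : Set ℂ} {v w : ℂ} {κ : ℝ → ℂ} (hκ : Continuous κ) (h0 : κ 0 = v)
    (h1 : κ 1 = w) (hV : ∀ t, 0 < t → t < 1 → κ t ∉ V) (hvV : v ∈ V) (hwV : w ∈ V) {a b : ℝ} (ha : 0 < a)
    (hab : a < b) (hb : b < 1) {R : ℝ} (hv : ∀ z ∈ Metric.ball v R, z ≠ v → z ∉ V)
    (hw : ∀ z ∈ Metric.ball w R, z ≠ w → z ∉ V)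
    (hκa : ∀ t, 0 ≤ t → t ≤ a → κ t ∈ Metric.ball v R)
    (hκb : ∀ t, b ≤ t → t ≤ 1 → κ t ∈ Metric.ball w R) :
    ArcHomotopic V v w (fun t => κ t) (fun t => capped v w a b (fun u => κ (a + u * (b - a))) t) := by
  have ha1 : a < 1 := hab.trans hb
  have e1 := arcHomotopic_capLeft hκ h0 h1 hV hvV ha ha1 hv hκa
  have hc := continuous_capLeft (v := v) ha hκ
  have hge : ∀ t, a ≤ t → capLeft v a κ t = κ t := fun t ht => capLeft_of_ge ha ht
  have hcV : ∀ t, 0 < t → t < 1 → capLeft v a κ t ∉ V := by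
    intro t ht0 ht1
    obtain ⟨F, -, hg, -, hF⟩ := e1.exists_family
    have := (hg 1).2.2 ⟨t, ht0.le, ht1.le⟩ (by simpa [Subtype.ext_iff] using ht0.ne')
      (by simpa [Subtype.ext_iff] using ht1.ne)
    rwa [hF] at this
  have e2 := arcHomotopic_capLeft (V := V) (v := w) (w := v) (κ := fun t => capLeft v a κ (1 - t))
    (hc.comp (by fun_prop)) (by rw [sub_zero, hge 1 ha1.le, h1])
    (by rw [sub_self, capLeft_of_le ha.le]; simp) (fun t ht0 ht1 => hcV _ (by linarith) (by linarith))
    hwV (a := 1 - b) (by linarith) (by linarith) hw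
    (fun t ht0 ht1 => by rw [hge _ (by linarith)]; exact hκb _ (by linarith) (by linarith))
  have e3 := e2.reverse
  simp only [unitInterval.coe_symm_eq] at e3
  refine e1.trans ?_
  convert e3 using 1
  · ext t
    rw [_root_.sub_sub_cancel]
  ext t
  rcases le_total (t : ℝ) b with h' | h'
  · rw [capLeft_of_ge (by linarith) (by linarith), _root_.sub_sub_cancel]
    rcases le_total (t : ℝ) a with h | h
    · rw [capped_of_le ha hab hb h, capLeft_of_le h]
      simp
    · rw [capped_of_mem ha hb h h', capLeft_of_ge ha h, Set.projIcc_of_mem _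
        ⟨div_nonneg (by linarith) (by linarith), (div_le_one (by linarith)).2 (by linarith)⟩]
      have : b - a ≠ 0 := by linarith
      congr 1
      field_simp
      ring
  · rw [capped_of_ge ha hab hb h', capLeft_of_le (by linarith), _root_.sub_sub_cancel, hge b hab.le]
    simp

section PathHalves

variable {X : Type*} [TopologicalSpace X] {x y z : X}

theorem Path.trans_apply_half (p : Path x y) (q : Path y z) {t u : I} (h : (t : ℝ) = u / 2) :
    p.trans q t = p u := by
  rw [Path.trans_apply, dif_pos (by have := u.2.2; linarith)]
  congr 1
  ext
  change 2 * (t : ℝ) = u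
  linarith

theorem Path.trans_apply_half_add (p : Path x y) (q : Path y z) {t u : I} (h : (t : ℝ) = (1 + u) / 2) :
    p.trans q t = q u := by
  have hu := u.2.1
  rw [Path.trans_apply]
  split_ifs with h'
  · have hu0 : u = 0 := Subtype.ext (le_antisymm (by change (u : ℝ) ≤ 0; linarith) hu)
    have : (⟨2 * (t : ℝ), (unitInterval.mul_pos_mem_iff zero_lt_two).2 ⟨t.2.1, h'⟩⟩ : I) = 1 := by
      ext
      change 2 * (t : ℝ) = 1
      rw [h, hu0]
      simp
    rw [this, hu0, p.target, q.source]
  · congr 1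
    ext
    change 2 * (t : ℝ) - 1 = u
    linarith

end PathHalves

/-- Curves with the same ends are homotopic if, up to short connecting paths near the ends, their
middle parts are. -/
theorem arcHomotopic_of_subClass {V : Finset ℂ} {v w : ℂ} {R : ℝ}
    (hv : ∀ z ∈ Metric.ball v R, z ≠ v → z ∉ (V : Set ℂ)) (hw : ∀ z ∈ Metric.ball w R, z ≠ w → z ∉ (V : Set ℂ))
    (hvV : v ∈ (V : Set ℂ)) (hwV : w ∈ (V : Set ℂ)) {κ κ' : ℝ → ℂ} (hκ : Continuous κ) (hκ' : Continuous κ')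
    (hV : ∀ t, 0 < t → t < 1 → κ t ∉ V) (hV' : ∀ t, 0 < t → t < 1 → κ' t ∉ V)
    (h0 : κ 0 = v) (h1 : κ 1 = w) (h0' : κ' 0 = v) (h1' : κ' 1 = w)
    {a b a' b' : Set.Ioo (0 : ℝ) 1} (hab : (a : ℝ) < b) (hab' : (a' : ℝ) < b')
    (ha : ∀ t : ℝ, 0 ≤ t → t ≤ a → κ t ∈ Metric.ball v R) (hb : ∀ t : ℝ, b ≤ t → t ≤ 1 → κ t ∈ Metric.ball w R)
    (ha' : ∀ t : ℝ, 0 ≤ t → t ≤ a' → κ' t ∈ Metric.ball v R) (hb' : ∀ t : ℝ, b' ≤ t → t ≤ 1 → κ' t ∈ Metric.ball w R)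
    {δ : Path.Homotopic.Quotient (innerCurve hκ hV a) (innerCurve hκ' hV' a')}
    {δ' : Path.Homotopic.Quotient (innerCurve hκ hV b) (innerCurve hκ' hV' b')}
    (hδ : InS (pLift V (Metric.ball v R)) δ) (hδ' : InS (pLift V (Metric.ball w R)) δ')
    (h : subClass (innerCurve hκ hV) a b = δ.trans ((subClass (innerCurve hκ' hV') a' b').trans δ'.symm)) :
    ArcHomotopic V v w (fun t => κ t) (fun t => κ' t) := by
  obtain ⟨d, hd, rfl⟩ := hδ
  obtain ⟨d', hd', rfl⟩ := hδ'
  set p' := subPath (innerCurve hκ' hV') a' b' with hp'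
  have hq : (subPath (innerCurve hκ hV) a b).Homotopic (d.trans (p'.trans d'.symm)) := by
    refine Path.Homotopic.Quotient.eq.1 ?_
    rw [subClass, subClass] at h
    rw [h]
    rfl
  set q := d.trans (p'.trans d'.symm) with hqdef
  obtain ⟨H⟩ := hq
  have e1 := arcHomotopic_capped_self hκ h0 h1 hV hvV hwV a.2.1 hab b.2.2 hv hw ha hb
  have e1' := arcHomotopic_capped_self hκ' h0' h1' hV' hvV hwV a'.2.1 hab' b'.2.2 hv hw ha' hb'
  have e2 := arcHomotopic_capped (V := V) (v := v) (w := w) (R := R) hv hw hvV hwV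
    (M := fun s u => (H (s, u) : ℂ)) (continuous_subtype_val.comp H.continuous) (fun s t => (H (s, t)).2)
    (fun s => by rw [H.source]; exact ha a a.2.1.le le_rfl)
    (fun s => by rw [H.target]; exact hb b le_rfl b.2.2.le)
    (α := fun _ => a) (β := fun _ => b) continuous_const continuous_const
    (fun _ => a.2.1) (fun _ => hab) (fun _ => b.2.2)
  let ℓ : I → I → I := fun s u => ⟨(s : ℝ) / 2 + u * (1 - 3 * s / 4), by
    have hs0 := s.2.1; have hs1 := s.2.2; have hu0 := u.2.1; have hu1 := u.2.2
    constructor <;> nlinarith⟩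
  have hℓ0 : ∀ s, q (ℓ s 0) = d s := fun s => Path.trans_apply_half _ _ (by simp [ℓ])
  have hℓ1 : ∀ s, q (ℓ s 1) = d' s := fun s => by
    have h1 : q (ℓ s 1) = (p'.trans d'.symm) ⟨(1 + (1 - s)) / 2, by
        have hs0 := s.2.1; have hs1 := s.2.2
        constructor <;> linarith⟩ :=
      Path.trans_apply_half_add _ _ (by simp [ℓ]; ring)
    rw [h1, Path.trans_apply_half_add _ _ (u := σ s) (by simp)]
    simp
  have hℓu : ∀ u, q (ℓ 1 u) = p' u := fun u => by
    have h1 : q (ℓ 1 u) = (p'.trans d'.symm) ⟨u / 2, by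
        have hs0 := u.2.1; have hs1 := u.2.2
        constructor <;> linarith⟩ :=
      Path.trans_apply_half_add _ _ (by simp [ℓ]; ring)
    rw [h1, Path.trans_apply_half _ _ rfl]
  have hlin : ∀ s : I, ∀ x y : ℝ, 0 < x → 0 < y → 0 < x + s * (y - x) := fun s x y hx hy => by
    have hs0 := s.2.1; have hs1 := s.2.2
    rcases hs1.eq_or_lt with h | h
    · rw [h]; linarith
    · nlinarith [mul_pos (sub_pos.2 h) hx]
  have e3 := arcHomotopic_capped (V := V) (v := v) (w := w) (R := R) hv hw hvV hwV
    (M := fun s u => (q (ℓ s u) : ℂ)) (by fun_prop) (fun s t => (q (ℓ s t)).2)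
    (fun s => by rw [hℓ0]; exact hd s)
    (fun s => by rw [hℓ1]; exact hd' s)
    (α := fun s => a + s * (a' - a)) (β := fun s => b + s * (b' - b)) (by fun_prop) (by fun_prop)
    (fun s => hlin s _ _ a.2.1 a'.2.1)
    (fun s => by
      have := hlin s _ _ (sub_pos.2 hab) (sub_pos.2 hab')
      linarith)
    (fun s => by
      have := hlin s _ _ (sub_pos.2 b.2.2) (sub_pos.2 b'.2.2)
      linarith)
  refine e1.trans ?_
  have f1 : (fun u : I => ((H (0, u) : Punc V) : ℂ)) = fun u : I => κ (a + u * (b - a)) := by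
    ext u
    rw [H.apply_zero]
    rfl
  have f2 : (fun u : I => ((q (ℓ 0 u) : Punc V) : ℂ)) = fun u : I => ((H (1, u) : Punc V) : ℂ) := by
    ext u
    rw [H.apply_one]
    have : ℓ 0 u = u := by ext; simp [ℓ]
    rw [this]
    rfl
  have f3 : (fun u : I => ((q (ℓ 1 u) : Punc V) : ℂ)) = fun u : I => κ' (a' + u * (b' - a')) := by
    ext u
    rw [hℓu]
    rfl
  rw [f1] at e2
  rw [f2, f3] at e3
  simp only [Set.Icc.coe_zero, Set.Icc.coe_one, zero_mul, one_mul, add_zero, add_sub_cancel] at e3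
  exact e2.trans (e3.trans e1'.symm)

/-- Two points that can be slid along segments to points near a node with equal codes are joined near
the node and outside the tree. -/
theorem PTree.exists_join {ρ : ℂ} (T : PTree ρ) {V : Finset ℂ} (hV : ∀ v ∈ V, v ∈ insert ρ T.N) {v : ℂ}
    (hv : v ∈ insert ρ T.N) {R rT : ℝ} (hconic : T.Conic v rT) (hrTR : rT ≤ R) {x x' : Punc V} {e e' : ℂ}
    (he : e ∈ Metric.ball v rT) (hxe : segment ℝ (x : ℂ) e ⊆ Metric.ball v R ∩ T.carrierᶜ)
    (he' : e' ∈ Metric.ball v rT) (hxe' : segment ℝ (x' : ℂ) e' ⊆ Metric.ball v R ∩ T.carrierᶜ)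
    (hc : T.code v e = T.code v e') :
    ∃ δ : Path.Homotopic.Quotient x x', InS (pLift V (Metric.ball v R)) δ ∧ InS (pLift V T.carrierᶜ) δ := by
  have hmid : segment ℝ e e' ⊆ Metric.ball v R ∩ T.carrierᶜ := fun z hz =>
    ⟨Metric.ball_subset_ball hrTR ((convex_ball v rT).segment_subset he he' hz),
      hconic.segment_disjoint hv (by rwa [← dist_eq_norm]) (by rwa [← dist_eq_norm])
        (hxe (right_mem_segment ℝ _ _)).2 (hxe' (right_mem_segment ℝ _ _)).2 hc z hz⟩
  obtain ⟨δ, hδ⟩ := JoinedIn.exists_inS (V := V) (S := Metric.ball v R ∩ T.carrierᶜ)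
    (fun u hu h => h.2 (T.node_mem (hV u hu))) (x := x) (y := x')
    (((joinedIn_of_segment_subset hxe).trans (joinedIn_of_segment_subset hmid)).trans
      (joinedIn_of_segment_subset hxe').symm)
  exact ⟨δ, hδ.mono fun z hz => hz.1, hδ.mono fun z hz => hz.2⟩

namespace CutCurve

variable {P : Finset ℂ} {R r : ℝ}

theorem sp_zero_good (c : CutCurve P R r) : c.sp 0 ∈ c.good := c.sp_good c.zero_mem zero_ne_one

theorem sm_one_good (c : CutCurve P R r) : c.sm 1 ∈ c.good := c.sm_good c.one_mem one_ne_zero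

/-- The time when the curve leaves its starting point for good. -/
def first (c : CutCurve P R r) : Set.Ioo (0 : ℝ) 1 := ⟨c.sp 0, goodTimes_subset_Ioo c c.sp_zero_good⟩

/-- The time when the curve arrives near its end point. -/
def last (c : CutCurve P R r) : Set.Ioo (0 : ℝ) 1 := ⟨c.sm 1, goodTimes_subset_Ioo c c.sm_one_good⟩

theorem first_lt_last (c : CutCurve P R r) : (c.first : ℝ) < c.last :=
  c.trunc.disj 0 c.zero_mem 1 c.one_mem one_pos

theorem mem_ball_of_le_first (c : CutCurve P R r) (t : ℝ) (h0 : 0 ≤ t) (h : t ≤ c.first) :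
    c.κ t ∈ Metric.ball (c.κ 0) R := by
  rw [Metric.mem_ball, dist_eq_norm]
  exact c.trunc.mem_ball 0 c.zero_mem t h0 (h.trans c.first.2.2.le)
    ((c.trunc.lt_left 0 c.zero_mem).le.trans h0) h

theorem mem_ball_of_last_le (c : CutCurve P R r) (t : ℝ) (h : c.last ≤ t) (h1 : t ≤ 1) :
    c.κ t ∈ Metric.ball (c.κ 1) R := by
  rw [Metric.mem_ball, dist_eq_norm]
  exact c.trunc.mem_ball 1 c.one_mem t (c.last.2.1.le.trans h) h1 h
    (h1.trans (c.trunc.lt_right 1 c.one_mem).le)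

/-- Among sufficiently many curves avoiding the tree, two are homotopic. -/
theorem exists_arcHomotopic {V : Finset ℂ} (hVP : V ⊆ P) {ρ : ℂ} (hr : 0 < r) (hrR : r < R)
    (hsep : ∀ p ∈ P, ∀ q ∈ P, p ≠ q → 2 * R ≤ ‖p - q‖) (T : PTree ρ) (hV : ∀ v ∈ V, v ∈ insert ρ T.N)
    (hprune : T.Pruned V) (hPN : ∀ p ∈ P, p ∈ T.carrier → p ∈ insert ρ T.N) {ι : Type*} [Fintype ι]
    (F : ι → CutCurve P R r) (hF : ∀ i, (F i).Avoids T.carrier)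
    (hFV : ∀ i, ∀ t, 0 < t → t < 1 → (F i).κ t ∉ V)
    (h0 : ∀ i, (F i).κ 0 ∈ V) (h1 : ∀ i, (F i).κ 1 ∈ V) {k : ℕ}
    (hk : ∀ i, ((F i).S.filter fun τ => 0 < τ ∧ τ < 1).card ≤ k)
    (hcard : V.card ^ 2 * (3 ^ (V.card + 1)) ^ 2 * PTree.genBound V.card ^ k < Fintype.card ι) :
    ∃ i j, i ≠ j ∧ (F i).κ 0 = (F j).κ 0 ∧ (F i).κ 1 = (F j).κ 1 ∧
      ArcHomotopic V ((F i).κ 0) ((F i).κ 1) (fun t => (F i).κ t) (fun t => (F j).κ t) := by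
  classical
  obtain ⟨i₀⟩ : Nonempty ι := Fintype.card_pos_iff.1 ((Nat.zero_le _).trans_lt hcard)
  obtain ⟨rT, hrT, hrTR, hconic, hfree, hPT⟩ := T.exists_radius (V := V) hPN (hr.trans hrR)
  have hsepV : ∀ v ∈ V, ∀ z ∈ Metric.ball v R, z ≠ v → z ∉ V := by
    intro v hv z hz hzv hzV
    have := hsep z (hVP hzV) v (hVP hv) hzv
    rw [Metric.mem_ball, dist_eq_norm] at hz
    linarith
  let γ : ∀ i, C(Set.Ioo (0 : ℝ) 1, Punc V) := fun i => innerCurve (F i).cont (hFV i)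
  have hγ : ∀ i (t : Set.Ioo (0 : ℝ) 1), (t : ℝ) ∈ (F i).good → γ i t ∈ pLift V T.carrierᶜ := fun i t ht => (hF i).1 t ht
  set b₀ : Punc V := γ i₀ (F i₀).first with hb₀def
  have hb₀ : (b₀ : ℂ) ∉ T.carrier := hγ i₀ _ (F i₀).sp_zero_good
  have hα : ∀ i, ∃ α : Path.Homotopic.Quotient b₀ (γ i (F i).first), InS (pLift V T.carrierᶜ) α :=
    fun i => T.exists_inS_compl hV hb₀ (hγ i _ (F i).sp_zero_good)
  have hβ : ∀ i, ∃ β : Path.Homotopic.Quotient b₀ (γ i (F i).last), InS (pLift V T.carrierᶜ) β :=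
    fun i => T.exists_inS_compl hV hb₀ (hγ i _ (F i).sm_one_good)
  choose α hα using hα
  choose β hβ using hβ
  have he : ∀ i, ∃ e ∈ Metric.ball ((F i).κ 0) rT,
      segment ℝ ((γ i (F i).first : Punc V) : ℂ) e ⊆ Metric.ball ((F i).κ 0) R ∩ T.carrierᶜ := fun i => by
    have hn := (F i).trunc.norm_right 0 (F i).zero_mem zero_ne_one
    obtain ⟨e, h1, -, -, h4⟩ := exists_slide (V := V) hr hrR hrT hn
      ((hF i).2 _ (hVP (h0 i)) _ (F i).sp_zero_good hn) (hsepV _ (h0 i))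
    exact ⟨e, h1, fun z hz => (h4 hz).1⟩
  have he' : ∀ i, ∃ e ∈ Metric.ball ((F i).κ 1) rT,
      segment ℝ ((γ i (F i).last : Punc V) : ℂ) e ⊆ Metric.ball ((F i).κ 1) R ∩ T.carrierᶜ := fun i => by
    have hn := (F i).trunc.norm_left 1 (F i).one_mem one_ne_zero
    obtain ⟨e, h1, -, -, h4⟩ := exists_slide (V := V) hr hrR hrT hn
      ((hF i).2 _ (hVP (h1 i)) _ (F i).sm_one_good hn) (hsepV _ (h1 i))
    exact ⟨e, h1, fun z hz => (h4 hz).1⟩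
  choose e he hes using he
  choose e' he' hes' using he'
  obtain ⟨hGfin, hGcard⟩ := T.finite_gens hV hprune hrT hconic hfree b₀
  obtain ⟨hWfin, hWcard⟩ := finite_wordSet hGfin hGcard k
  have := hWfin.fintype
  have hemb : ∀ q, Nonempty ((T.dirs q → SignType) ↪ Fin (3 ^ (V.card + 1))) := fun q => by
    refine Function.Embedding.nonempty_of_card_le ?_
    rw [Fintype.card_fun, Fintype.card_fin, Fintype.card_coe]
    exact Nat.pow_le_pow_right (by decide)
      ((T.card_dirs_le q).trans (Nat.add_le_add_right (hprune.card_kids_le q) 1))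
  let em : ∀ q, (T.dirs q → SignType) ↪ Fin (3 ^ (V.card + 1)) := fun q => (hemb q).some
  let Φ : ι → (V × V) × (Fin (3 ^ (V.card + 1)) × Fin (3 ^ (V.card + 1))) × wordSet (T.gens V rT b₀) k :=
    fun i => ((⟨_, h0 i⟩, ⟨_, h1 i⟩), (em _ (T.code ((F i).κ 0) (e i)), em _ (T.code ((F i).κ 1) (e' i))),
      ⟨_, (F i).word_mem hVP hr hrR hsep T hV hrT hrTR hPT (hF i) (hFV i) (hk i) hb₀ (F i).sp_zero_good
        (F i).sm_one_good (F i).first_lt_last.le (hα i) (hβ i)⟩)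
  have hlt : Fintype.card ((V × V) × (Fin (3 ^ (V.card + 1)) × Fin (3 ^ (V.card + 1))) ×
      wordSet (T.gens V rT b₀) k) < Fintype.card ι := by
    refine lt_of_le_of_lt ?_ hcard
    rw [Fintype.card_prod, Fintype.card_prod, Fintype.card_prod, Fintype.card_prod, Fintype.card_fin,
      Fintype.card_coe, ← Nat.card_eq_fintype_card, Nat.card_coe_set_eq, ← pow_two, ← pow_two, ← mul_assoc]
    exact Nat.mul_le_mul_left _ hWcard
  obtain ⟨i, j, hij, hΦ⟩ := Fintype.exists_ne_map_eq_of_card_lt Φ hlt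
  simp only [Φ, Prod.mk.injEq, Subtype.mk.injEq] at hΦ
  obtain ⟨⟨e0, e1⟩, ⟨ec, ec'⟩, ew⟩ := hΦ
  rw [← e0] at ec
  rw [← e1] at ec'
  have hj := he j
  have hj' := he' j
  have hjs := hes j
  have hjs' := hes' j
  rw [← e0] at hj hjs
  rw [← e1] at hj' hjs'
  obtain ⟨δ, hδ, hδT⟩ := T.exists_join hV (hV _ (h0 i)) (hconic _ (hV _ (h0 i))) hrTR (he i) (hes i) hj hjs
    ((em _).injective ec)
  obtain ⟨δ', hδ', hδT'⟩ := T.exists_join hV (hV _ (h1 i)) (hconic _ (hV _ (h1 i))) hrTR (he' i) (hes' i) hj' hjs'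
    ((em _).injective ec')
  have hΩ := T.thin_compl hV
  have hαδ : α j = (α i).trans δ := hΩ _ _ (hα j) ((hα i).trans hδT)
  have hβδ : β j = (β i).trans δ' := hΩ _ _ (hβ j) ((hβ i).trans hδT')
  refine ⟨i, j, hij, e0, e1, arcHomotopic_of_subClass (hsepV _ (h0 i)) (hsepV _ (h1 i)) (h0 i) (h1 i)
    (F i).cont (F j).cont (hFV i) (hFV j) rfl rfl e0.symm e1.symm (F i).first_lt_last (F j).first_lt_last
    (F i).mem_ball_of_le_first (F i).mem_ball_of_last_le
    (fun t h h' => by rw [e0]; exact (F j).mem_ball_of_le_first t h h')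
    (fun t h h' => by rw [e1]; exact (F j).mem_ball_of_last_le t h h') hδ hδ' ?_⟩
  rw [hαδ, hβδ, symm_trans_rev] at ew
  have := congrArg (fun m => (α i).symm.trans (m.trans (β i))) ew
  simp only [Path.Homotopic.Quotient.trans_assoc, symm_trans_cancel, Path.Homotopic.Quotient.symm_trans,
    Path.Homotopic.Quotient.trans_refl] at this
  exact this

end CutCurve

theorem exists_separation (P : Finset ℂ) : ∃ R > 0, ∀ p ∈ P, ∀ q ∈ P, p ≠ q → 2 * R ≤ ‖p - q‖ := by
  obtain ⟨R, hR, -, h⟩ := exists_pos_forall_finset P (fun p R => ∀ q ∈ P, p ≠ q → 2 * R ≤ ‖p - q‖)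
    (fun p r r' h hr q hq hpq => by linarith [h q hq hpq]) (fun p _ => by
      obtain ⟨R, hR, -, h⟩ := exists_pos_forall_finset P (fun q R => p ≠ q → 2 * R ≤ ‖p - q‖)
        (fun q r r' h hr hpq => by linarith [h hpq]) (fun q _ => by
          by_cases hpq : p = q
          · exact ⟨1, one_pos, fun h => absurd hpq h⟩
          · exact ⟨‖p - q‖ / 2, half_pos (norm_pos_iff.2 (sub_ne_zero.2 hpq)), fun _ => by linarith⟩) one_pos
      exact ⟨R, hR, h⟩) one_pos
  exact ⟨R, hR, h⟩

theorem exists_cutCurves {P : Finset ℂ} {R : ℝ} (hR : 0 < R) (hP : ∀ p ∈ P, ∀ q ∈ P, p ≠ q → 2 * R ≤ ‖p - q‖)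
    {ι : Type*} [Finite ι] (γ : ι → C(I, ℂ)) (h0 : ∀ i, γ i 0 ∈ P) (h1 : ∀ i, γ i 1 ∈ P)
    (hfin : ∀ i, {t | γ i t ∈ P}.Finite) :
    ∃ r₀ > 0, ∀ r, 0 < r → r ≤ r₀ → ∃ c : ι → CutCurve P R r,
      ∀ i, (c i).κ = fun t => γ i (Set.projIcc 0 1 zero_le_one t) := by
  classical
  let κ : ι → ℝ → ℂ := fun i t => γ i (Set.projIcc 0 1 zero_le_one t)
  have hκ : ∀ i, Continuous (κ i) := fun i => (γ i).continuous.comp continuous_projIcc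
  let S : ι → Finset ℝ := fun i => (hfin i).toFinset.image Subtype.val
  have hS : ∀ i t, t ∈ S i ↔ 0 ≤ t ∧ t ≤ 1 ∧ κ i t ∈ P := by
    intro i t
    simp only [S, Finset.mem_image, Set.Finite.mem_toFinset, Set.mem_ofPred_eq, κ]
    constructor
    · rintro ⟨u, hu, rfl⟩
      exact ⟨u.2.1, u.2.2, by rwa [Set.projIcc_val]⟩
    · rintro ⟨h0, h1, h⟩
      exact ⟨⟨t, h0, h1⟩, by rwa [Set.projIcc_of_mem _ ⟨h0, h1⟩] at h, rfl⟩
  have hS0 : ∀ i, 0 ∈ S i := fun i => (hS i 0).2 ⟨le_rfl, zero_le_one, by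
    simpa [κ] using h0 i⟩
  have hS1 : ∀ i, 1 ∈ S i := fun i => (hS i 1).2 ⟨zero_le_one, le_rfl, by
    simpa [κ] using h1 i⟩
  have key := fun i => exists_truncation (hκ i) (hS i) (hS0 i) (hS1 i) hR hP
  choose r₀ hr₀ hT using key
  obtain ⟨r, hr, hle⟩ : ∃ r > 0, ∀ i, r ≤ r₀ i := by
    cases isEmpty_or_nonempty ι
    · exact ⟨1, one_pos, fun i => isEmptyElim i⟩
    · obtain ⟨i, hi⟩ := Finite.exists_min r₀
      exact ⟨r₀ i, hr₀ i, hi⟩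
  refine ⟨r, hr, fun s hs hsr => ?_⟩
  choose sm sp h using fun i => hT i s hs (hsr.trans (hle i))
  exact ⟨fun i => ⟨κ i, hκ i, S i, hS i, hS0 i, hS1 i, sm i, sp i, h i⟩, fun i => rfl⟩

/-- A large family of curves that meets a connected system of curves only in finitely many points, each
of its members only a bounded number of times, has two homotopic members. -/
theorem exists_homotopicIn {V P : Finset ℂ} (hVP : V ⊆ P) {ρ : ℂ} (hρ : ρ ∈ P) (hP : ∀ p ∈ P, p.re ≤ ρ.re)
    {ι ι' : Type*} [Finite ι] [Fintype ι'] (A : ι → C(I, ℂ)) (F : ι' → C(I, ℂ))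
    (hA0 : ∀ i, A i 0 ∈ P) (hA1 : ∀ i, A i 1 ∈ P) (hAfin : ∀ i, {t | A i t ∈ P}.Finite)
    (hF0 : ∀ j, F j 0 ∈ V) (hF1 : ∀ j, F j 1 ∈ V) (hFfin : ∀ j, {t | F j t ∈ P}.Finite)
    (hFV : ∀ j t, t ≠ 0 → t ≠ 1 → F j t ∉ V) {k : ℕ}
    (hk : ∀ j, {t | t ≠ 0 ∧ t ≠ 1 ∧ F j t ∈ P}.ncard ≤ k)
    (hAre : ∀ i t, (A i t).re ≤ ρ.re) (hFre : ∀ j t, (F j t).re ≤ ρ.re)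
    (hAF : ∀ i j s t, A i s = F j t → A i s ∈ P)
    (hconn : ∀ E : ℂ → ℂ → Prop, Equivalence E → (∀ i s t, A i s ∈ P → A i t ∈ P → E (A i s) (A i t)) →
      ∀ v ∈ V, E v ρ)
    (hcard : V.card ^ 2 * (3 ^ (V.card + 1)) ^ 2 * PTree.genBound V.card ^ k < Fintype.card ι') :
    ∃ i j, i ≠ j ∧ HomotopicIn V (F i) (F j) := by
  obtain ⟨R, hR, hsep⟩ := exists_separation P
  obtain ⟨r₁, hr₁, h₁⟩ := exists_cutCurves hR hsep A hA0 hA1 hAfin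
  obtain ⟨r₂, hr₂, h₂⟩ := exists_cutCurves hR hsep F (fun j => hVP (hF0 j)) (fun j => hVP (hF1 j)) hFfin
  set r := min (min r₁ r₂) (R / 2) with hrdef
  have hr : 0 < r := lt_min (lt_min hr₁ hr₂) (half_pos hR)
  have hrR : r < R := (min_le_right _ _).trans_lt (half_lt_self hR)
  obtain ⟨a, ha⟩ := h₁ r hr ((min_le_left _ _).trans (min_le_left _ _))
  obtain ⟨f, hf⟩ := h₂ r hr ((min_le_left _ _).trans (min_le_right _ _))
  obtain ⟨T, hVT, hprune, hPN, hav⟩ := exists_tree hVP hρ hP hr hrR hsep a f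
    (fun i t => by rw [ha]; exact hAre _ _) (fun i t => by rw [hf]; exact hFre _ _)
    (fun i j s t _ _ _ _ h => by
      rw [ha, hf] at h
      rw [ha]
      exact hAF _ _ _ _ h)
    (fun E hE h => hconn E hE fun i s t hs ht => by
      have := h i s (((a i).mem_S s).2 ⟨s.2.1, s.2.2, by simpa [ha] using hs⟩) t
        (((a i).mem_S t).2 ⟨t.2.1, t.2.2, by simpa [ha] using ht⟩)
      simpa [ha] using this)
  obtain ⟨i, j, hij, -, -, h⟩ := CutCurve.exists_arcHomotopic hVP hr hrR hsep T hVT hprune hPN f hav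
    (fun i t h0 h1 => by
      rw [hf]
      refine hFV i _ ?_ ?_
      · rw [Set.projIcc_of_mem _ ⟨h0.le, h1.le⟩]
        simpa [Subtype.ext_iff] using h0.ne'
      · rw [Set.projIcc_of_mem _ ⟨h0.le, h1.le⟩]
        simpa [Subtype.ext_iff] using h1.ne)
    (fun i => by simpa [hf] using hF0 i) (fun i => by simpa [hf] using hF1 i) (k := k)
    (fun i => by
      refine le_trans ?_ (hk i)
      have hsub : {t : I | t ≠ 0 ∧ t ≠ 1 ∧ F i t ∈ P}.Finite := (hFfin i).subset fun t h => h.2.2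
      rw [← Set.ncard_coe_finset]
      refine (Set.ncard_le_ncard (t := Subtype.val '' {t : I | t ≠ 0 ∧ t ≠ 1 ∧ F i t ∈ P}) ?_
        (hsub.image _)).trans (Set.ncard_image_le hsub)
      intro τ hτ
      obtain ⟨hτS, h0, h1⟩ := Finset.mem_filter.1 hτ
      have h := ((f i).mem_S τ).1 hτS
      rw [hf] at h
      beta_reduce at h
      rw [Set.projIcc_of_mem _ ⟨h0.le, h1.le⟩] at h
      exact ⟨⟨τ, h0.le, h1.le⟩, ⟨by simpa [Subtype.ext_iff] using h0.ne', by simpa [Subtype.ext_iff] using h1.ne,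
        h.2.2⟩, rfl⟩)
    hcard
  refine ⟨i, j, hij, ?_⟩
  have h' := h.homotopicIn
  simp only [hf, Set.projIcc_val] at h'
  exact h'

theorem exists_closest {K K' : Set ℂ} (hK : IsCompact K) (hK' : IsCompact K') (hne : K.Nonempty)
    (hne' : K'.Nonempty) :
    ∃ x ∈ K, ∃ y ∈ K', ∀ z ∈ segment ℝ x y, z ≠ x → z ≠ y → z ∉ K ∧ z ∉ K' := by
  obtain ⟨⟨x, y⟩, ⟨hx, hy⟩, hmin⟩ := (hK.prod hK').exists_isMinOn (hne.prod hne')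
    (f := fun p : ℂ × ℂ => ‖p.1 - p.2‖) (by fun_prop)
  refine ⟨x, hx, y, hy, fun z hz hzx hzy => ?_⟩
  obtain ⟨a, b, ha, hb, hab, rfl⟩ := hz
  have hxy : 0 < ‖x - y‖ := by
    rw [norm_pos_iff, sub_ne_zero]
    rintro rfl
    exact hzx (by rw [← add_smul, hab, one_smul])
  have ha0 : a ≠ 0 := by
    rintro rfl
    exact hzy (by rw [show b = 1 by linarith]; simp)
  have hb0 : b ≠ 0 := by
    rintro rfl
    exact hzx (by rw [show a = 1 by linarith]; simp)
  have ha' := lt_of_le_of_ne ha ha0.symm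
  have hb' := lt_of_le_of_ne hb hb0.symm
  have e1 : a • x + b • y - y = a • (x - y) := by
    rw [show b = 1 - a by linarith]; module
  have e2 : x - (a • x + b • y) = b • (x - y) := by
    rw [show a = 1 - b by linarith]; module
  constructor
  · intro h
    have : ‖x - y‖ ≤ ‖a • x + b • y - y‖ :=
      hmin (show (a • x + b • y, y) ∈ K ×ˢ K' from ⟨h, hy⟩)
    rw [e1, norm_smul, Real.norm_of_nonneg ha] at this
    nlinarith
  · intro h
    have : ‖x - y‖ ≤ ‖x - (a • x + b • y)‖ :=
      hmin (show (x, a • x + b • y) ∈ K ×ˢ K' from ⟨hx, h⟩)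
    rw [e2, norm_smul, Real.norm_of_nonneg hb] at this
    nlinarith

section Skeleton

variable {ι : Type*}

/-- Two points are linked by a system of curves and segments if every equivalence relation for which
curves and segments link their points of `P` links the two points. -/
def Links (γ : ι → C(I, ℂ)) (V : Finset ℂ) (B : Finset ι) (L : Finset (ℂ × ℂ)) (x y : ℂ) : Prop :=
  ∀ P : Set ℂ, ↑V ⊆ P → x ∈ P → y ∈ P → (∀ p ∈ L, p.1 ∈ P ∧ p.2 ∈ P) → ∀ E : ℂ → ℂ → Prop, Equivalence E →
    (∀ e ∈ B, ∀ s t, γ e s ∈ P → γ e t ∈ P → E (γ e s) (γ e t)) → (∀ p ∈ L, E p.1 p.2) → E x y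

/-- The point lies in `V` or on one of the curves in `B`. -/
def OnCurves (γ : ι → C(I, ℂ)) (V : Finset ℂ) (B : Finset ι) (z : ℂ) : Prop :=
  z ∈ V ∨ ∃ e ∈ B, ∃ s, γ e s = z

variable {γ : ι → C(I, ℂ)} {V : Finset ℂ} {B B' : Finset ι} {L L' : Finset (ℂ × ℂ)} {x y z : ℂ}

theorem OnCurves.mono (h : OnCurves γ V B z) (hB : B ⊆ B') : OnCurves γ V B' z :=
  h.imp_right fun ⟨e, he, h⟩ => ⟨e, hB he, h⟩

theorem Links.mono (h : Links γ V B L x y) (hB : B ⊆ B') (hL : L ⊆ L') : Links γ V B' L' x y :=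
  fun P hV hx hy hLP E hE h1 h2 => h P hV hx hy (fun p hp => hLP p (hL hp)) E hE
    (fun e he => h1 e (hB he)) fun p hp => h2 p (hL hp)

theorem Links.symm (h : Links γ V B L x y) : Links γ V B L y x :=
  fun P hV hx hy hLP E hE h1 h2 => hE.symm (h P hV hy hx hLP E hE h1 h2)

theorem Links.trans (h : Links γ V B L x y) (h' : Links γ V B L y z)
    (hy : y ∈ V ∨ ∃ p ∈ L, y = p.1 ∨ y = p.2) : Links γ V B L x z := by
  intro P hV hx hz hLP E hE h1 h2
  have hyP : y ∈ P := by
    rcases hy with hy | ⟨p, hp, rfl | rfl⟩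
    · exact hV hy
    · exact (hLP p hp).1
    · exact (hLP p hp).2
  exact hE.trans (h P hV hx hyP hLP E hE h1 h2) (h' P hV hyP hz hLP E hE h1 h2)

theorem Links.of_mem (h : (x, y) ∈ L) : Links γ V B L x y :=
  fun _ _ _ _ _ _ _ _ h2 => h2 _ h

theorem Links.refl : Links γ V B L x x := fun _ _ _ _ _ _ hE _ _ => hE.refl x

/-- The union of a set of vertices and of the curves in `E₁`. -/
def reach (γ : ι → C(I, ℂ)) (Q : Finset ℂ) (E₁ : Set ι) : Set ℂ := ↑Q ∪ ⋃ e ∈ E₁, Set.range (γ e)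

theorem isCompact_reach (γ : ι → C(I, ℂ)) (Q : Finset ℂ) {E₁ : Set ι} (h : E₁.Finite) :
    IsCompact (reach γ Q E₁) :=
  Q.finite_toSet.isCompact.union (h.isCompact_biUnion fun e _ => isCompact_range (γ e).continuous)

theorem exists_links_of_mem_reach [DecidableEq ι] {Q : Finset ℂ} (hQ : Q ⊆ V) {E₁ : Set ι}
    (hE : ∀ e ∈ E₁, γ e 0 ∈ Q ∨ γ e 1 ∈ Q) (hz : z ∈ reach γ Q E₁) :
    ∃ B : Finset ι, ↑B ⊆ E₁ ∧ B.card ≤ 1 ∧ OnCurves γ V B z ∧ ∃ q ∈ Q, Links γ V B ∅ q z := by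
  rcases hz with hz | hz
  · exact ⟨∅, by simp, by simp, Or.inl (hQ hz), z, hz, Links.refl⟩
  · obtain ⟨e, he, s, rfl⟩ := Set.mem_iUnion₂.1 hz
    refine ⟨{e}, by simpa using he, by simp, Or.inr ⟨e, by simp, s, rfl⟩, ?_⟩
    rcases hE e he with h | h
    · exact ⟨_, h, fun P hV hx hy _ E _ h1 _ => h1 e (by simp) _ _ hx hy⟩
    · exact ⟨_, h, fun P hV hx hy _ E _ h1 _ => h1 e (by simp) _ _ hx hy⟩

theorem exists_skeleton (hV : V.Nonempty) (E₀ : Finset ι) (h0 : ∀ e, γ e 0 ∈ V) (h1 : ∀ e, γ e 1 ∈ V) :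
    ∃ B ⊆ E₀, B.card ≤ 2 * V.card ∧ ∃ (L : Finset (ℂ × ℂ)) (ρ : ℂ), OnCurves γ V B ρ ∧ OnCurves γ V E₀ ρ ∧
      (∀ z, OnCurves γ V E₀ z → z.re ≤ ρ.re) ∧
      (∀ p ∈ L, OnCurves γ V B p.1 ∧ OnCurves γ V B p.2 ∧
        ∀ z ∈ segment ℝ p.1 p.2, z ≠ p.1 → z ≠ p.2 → ¬ OnCurves γ V E₀ z) ∧
      ∀ v ∈ V, Links γ V B L v ρ := by
  classical
  obtain ⟨v₀, hv₀⟩ := hV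
  have grow : ∀ j, j + 1 ≤ V.card → ∃ Q ⊆ V, v₀ ∈ Q ∧ Q.card = j + 1 ∧ ∃ B ⊆ E₀, B.card ≤ 2 * j ∧
      ∃ L : Finset (ℂ × ℂ), (∀ p ∈ L, OnCurves γ V B p.1 ∧ OnCurves γ V B p.2 ∧
        ∀ z ∈ segment ℝ p.1 p.2, z ≠ p.1 → z ≠ p.2 → ¬ OnCurves γ V E₀ z) ∧
      ∀ v ∈ Q, Links γ V B L v v₀ := by
    intro j
    induction j with
    | zero =>
      refine fun _ => ⟨{v₀}, by simpa using hv₀, by simp, by simp, ∅, by simp, by simp, ∅, by simp, ?_⟩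
      intro v hv
      rw [Finset.mem_singleton.1 hv]
      exact Links.refl
    | succ j ih =>
      intro hj
      obtain ⟨Q, hQ, hvQ, hQc, B, hB, hBc, L, hL, hlink⟩ := ih (by omega)
      have hQ' : (V \ Q).Nonempty := by
        rw [← Finset.card_pos, Finset.card_sdiff_of_subset hQ]
        omega
      have hK := isCompact_reach γ Q (E₀.finite_toSet.subset
        (Set.sep_subset (E₀ : Set ι) fun e => γ e 0 ∈ Q ∨ γ e 1 ∈ Q))
      have hK' := isCompact_reach γ (V \ Q) (E₀.finite_toSet.subset
        (Set.sep_subset (E₀ : Set ι) fun e => ¬ (γ e 0 ∈ Q ∨ γ e 1 ∈ Q)))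
      obtain ⟨x, hx, y, hy, hxy⟩ := exists_closest hK hK' ⟨v₀, Or.inl hvQ⟩
        (hQ'.imp fun q hq => Or.inl hq)
      obtain ⟨B₁, hB₁, hB₁c, hx', q, hq, hqx⟩ := exists_links_of_mem_reach hQ (fun e he => he.2) hx
      obtain ⟨B₂, hB₂, hB₂c, hy', q', hq', hqy⟩ := exists_links_of_mem_reach Finset.sdiff_subset
        (fun e he => Or.inl (Finset.mem_sdiff.2 ⟨h0 e, fun h => he.2 (Or.inl h)⟩)) hy
      have hq'' := Finset.mem_sdiff.1 hq'
      have hs : B ⊆ B ∪ (B₁ ∪ B₂) := Finset.subset_union_left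
      have hs₁ : B₁ ⊆ B ∪ (B₁ ∪ B₂) := Finset.subset_union_left.trans Finset.subset_union_right
      have hs₂ : B₂ ⊆ B ∪ (B₁ ∪ B₂) := Finset.subset_union_right.trans Finset.subset_union_right
      have hLs : L ⊆ insert (x, y) L := Finset.subset_insert _ _
      refine ⟨insert q' Q, Finset.insert_subset hq''.1 hQ, Finset.mem_insert_of_mem hvQ,
        by rw [Finset.card_insert_of_notMem hq''.2, hQc], B ∪ (B₁ ∪ B₂),
        Finset.union_subset hB (Finset.union_subset (fun e he => (hB₁ he).1) fun e he => (hB₂ he).1), ?_,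
        insert (x, y) L, ?_, ?_⟩
      · have e1 := Finset.card_union_le B (B₁ ∪ B₂)
        have e2 := Finset.card_union_le B₁ B₂
        omega
      · intro p hp
        rcases Finset.mem_insert.1 hp with rfl | hp
        · refine ⟨hx'.mono hs₁, hy'.mono hs₂, fun z hz hzx hzy h => ?_⟩
          obtain ⟨n1, n2⟩ := hxy z hz hzx hzy
          rcases h with h | ⟨e, he, s, rfl⟩
          · by_cases hzQ : z ∈ Q
            · exact n1 (Or.inl hzQ)
            · exact n2 (Or.inl (Finset.mem_coe.2 (Finset.mem_sdiff.2 ⟨h, hzQ⟩)))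
          · by_cases heQ : γ e 0 ∈ Q ∨ γ e 1 ∈ Q
            · exact n1 (Or.inr (Set.mem_biUnion (x := e) ⟨he, heQ⟩ ⟨s, rfl⟩))
            · exact n2 (Or.inr (Set.mem_biUnion (x := e) ⟨he, heQ⟩ ⟨s, rfl⟩))
        · obtain ⟨h1, h2, h3⟩ := hL p hp
          exact ⟨h1.mono hs, h2.mono hs, h3⟩
      · intro v hv
        rcases Finset.mem_insert.1 hv with rfl | hv
        · have e1 : Links γ V (B ∪ (B₁ ∪ B₂)) (insert (x, y) L) x y := Links.of_mem (Finset.mem_insert_self _ _)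
          have e2 := hqy.mono hs₂ (Finset.empty_subset (insert (x, y) L))
          have e3 := hqx.mono hs₁ (Finset.empty_subset (insert (x, y) L))
          have e4 := (hlink q hq).mono hs hLs
          exact ((e2.trans e1.symm (Or.inr ⟨_, Finset.mem_insert_self _ _, Or.inr rfl⟩)).trans e3.symm
            (Or.inr ⟨_, Finset.mem_insert_self _ _, Or.inl rfl⟩)).trans e4 (Or.inl (hQ hq))
        · exact (hlink v hv).mono hs hLs
  have hcard : 0 < V.card := Finset.card_pos.2 ⟨v₀, hv₀⟩
  obtain ⟨Q, hQ, -, hQc, B, hB, hBc, L, hL, hlink⟩ := grow (V.card - 1) (by omega)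
  obtain rfl : Q = V := Finset.eq_of_subset_of_card_le hQ (by omega)
  have hOn : ∀ z, OnCurves γ Q E₀ z ↔ z ∈ reach γ Q (E₀ : Set ι) := by
    intro z
    simp [OnCurves, reach]
  obtain ⟨ρ, hρ, hmax⟩ := (isCompact_reach γ Q E₀.finite_toSet).exists_isMaxOn ⟨v₀, Or.inl hv₀⟩
    (f := Complex.re) Complex.continuous_re.continuousOn
  obtain ⟨B₁, hB₁, hB₁c, hρ', q, hq, hqρ⟩ := exists_links_of_mem_reach hQ (fun e _ => Or.inl (h0 e)) hρ
  refine ⟨B ∪ B₁, Finset.union_subset hB (by exact_mod_cast hB₁), ?_, L, ρ,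
    hρ'.mono Finset.subset_union_right, (hOn ρ).2 hρ, fun z hz => hmax ((hOn z).1 hz), ?_, ?_⟩
  · have := Finset.card_union_le B B₁
    omega
  · intro p hp
    obtain ⟨h1, h2, h3⟩ := hL p hp
    exact ⟨h1.mono Finset.subset_union_left, h2.mono Finset.subset_union_left, h3⟩
  · intro v hv
    have e1 := (hlink v hv).mono (B' := B ∪ B₁) Finset.subset_union_left (subset_refl L)
    have e2 := (hlink q hq).mono (B' := B ∪ B₁) Finset.subset_union_left (subset_refl L)
    have e3 := hqρ.mono (B' := B ∪ B₁) Finset.subset_union_right (Finset.empty_subset L)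
    exact (e1.trans e2.symm (Or.inl hv₀)).trans e3 (Or.inl hq)

end Skeleton

theorem card_filter_lt_card_fiber_mul_le {α ι : Type*} [Fintype ι] [DecidableEq ι] (S : Finset α) (f : α → ι)
    {k : ℝ} (s : Finset ι) (hs : ∀ i ∈ s, k ≤ (S.filter (f · = i)).card) :
    s.card * k ≤ S.card := by
  have h1 : ∑ i ∈ s, ((S.filter (f · = i)).card : ℝ) ≤ ∑ i, ((S.filter (f · = i)).card : ℝ) :=
    Finset.sum_le_sum_of_subset_of_nonneg (Finset.subset_univ s) fun _ _ _ => Nat.cast_nonneg _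
  have h2 : (S.card : ℝ) = ∑ i, ((S.filter (f · = i)).card : ℝ) := by
    exact_mod_cast Finset.card_eq_sum_card_fiberwise (s := S) (t := Finset.univ) (f := f) (by simp)
  have h3 := Finset.card_nsmul_le_sum s _ k hs
  rw [nsmul_eq_mul] at h3
  linarith

theorem card_filter_mem_le {α ι : Type*} [DecidableEq ι] (S : Finset α) (f : α → ι)
    {k : ℝ} (s : Finset ι) (hs : ∀ i ∈ s, ((S.filter (f · = i)).card : ℝ) ≤ k) :
    ((S.filter (f · ∈ s)).card : ℝ) ≤ s.card * k := by
  have h2 : ((S.filter (f · ∈ s)).card : ℝ) ≤ ∑ i ∈ s, ((S.filter (f · = i)).card : ℝ) := by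
    rw [← Nat.cast_sum, Nat.cast_le, Finset.card_eq_sum_card_fiberwise (s := S.filter (f · ∈ s)) (t := s) (f := f)
      (fun x hx => (Finset.mem_filter.1 hx).2)]
    exact Finset.sum_le_sum fun i _ => Finset.card_le_card fun x hx => by
      simp only [Finset.mem_filter] at hx ⊢
      exact ⟨hx.1.1, hx.2⟩
  have h3 := Finset.sum_le_card_nsmul s _ k hs
  rw [nsmul_eq_mul] at h3
  linarith

namespace PlaneDrawing

variable {n m : ℕ} (D : PlaneDrawing n m)

/-- The ordered pairs of distinct interior edge parameters at which the drawing crosses. -/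
def crossings : Set ((Fin m × I) × (Fin m × I)) :=
  {p | p.1 ≠ p.2 ∧ p.1.2 ≠ 0 ∧ p.1.2 ≠ 1 ∧ p.2.2 ≠ 0 ∧ p.2.2 ≠ 1 ∧ D.f p.1.1 p.1.2 = D.f p.2.1 p.2.2}

/-- The edges as bundled continuous maps. -/
def edge (e : Fin m) : C(I, ℂ) := ⟨D.f e, D.cont e⟩

/-- The vertices as a `Finset`. -/
noncomputable def verts : Finset ℂ := D.finV.toFinset

variable {D}

theorem mem_verts {z : ℂ} : z ∈ D.verts ↔ z ∈ D.V := D.finV.mem_toFinset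

theorem card_verts : D.verts.card = n := by
  rw [verts, ← Set.ncard_eq_toFinset_card _ D.finV, D.cardV]

theorem eq_zero_or_eq_one {e : Fin m} {t : I} (h : D.f e t ∈ D.V) : t = 0 ∨ t = 1 := by
  by_contra! h'
  exact D.interior_not_mem e t h'.1 h'.2 h

theorem ne_zero_of_notMem {e : Fin m} {t : I} (h : D.f e t ∉ D.V) : t ≠ 0 ∧ t ≠ 1 :=
  ⟨fun h' => h (h' ▸ D.source_mem e), fun h' => h (h' ▸ D.target_mem e)⟩

theorem mem_crossings {e e' : Fin m} {s t : I} (hst : (e, s) ≠ (e', t)) (h : D.f e s = D.f e' t)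
    (hV : D.f e s ∉ D.V) : ((e, s), (e', t)) ∈ D.crossings := by
  have h1 := ne_zero_of_notMem hV
  rw [h] at hV
  have h2 := ne_zero_of_notMem hV
  exact ⟨hst, h1.1, h1.2, h2.1, h2.2, h⟩

theorem finite_preimage (hS : D.crossings.Finite) (e : Fin m) {P : Set ℂ} (hP : P.Finite) :
    {t | D.edge e t ∈ P}.Finite := by
  refine Set.Finite.preimage' hP fun z _ => ?_
  by_cases hz : z ∈ D.V
  · refine (Set.toFinite {0, 1}).subset fun t ht => ?_
    have ht : D.f e t = z := ht
    exact eq_zero_or_eq_one (by rwa [ht])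
  · by_contra hinf
    obtain ⟨t₀, ht₀⟩ := Set.Infinite.nonempty hinf
    refine (Set.Infinite.sdiff hinf (Set.finite_singleton t₀))
      ((hS.image fun p => p.2.2).subset fun t ht => ?_)
    have e0 : D.f e t₀ = z := ht₀
    have e1 : D.f e t = z := ht.1
    refine ⟨((e, t₀), (e, t)), mem_crossings ?_ (e0.trans e1.symm) (by rwa [e0]), rfl⟩
    simpa [eq_comm] using ht.2

/-- Edges crossing a connecting system of curves rarely enough are pairwise homotopic somewhere. -/
theorem exists_homotopicIn_of_skeleton (hS : D.crossings.Finite) {B E₀ F : Finset (Fin m)} (hB : B ⊆ E₀)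
    (hF : F ⊆ E₀) (hBF : Disjoint B F) {L : Finset (ℂ × ℂ)} {ρ : ℂ}
    (hρB : OnCurves D.edge D.verts B ρ) (hmax : ∀ z, OnCurves D.edge D.verts E₀ z → z.re ≤ ρ.re)
    (hL : ∀ p ∈ L, OnCurves D.edge D.verts B p.1 ∧ OnCurves D.edge D.verts B p.2 ∧
        ∀ z ∈ segment ℝ p.1 p.2, z ≠ p.1 → z ≠ p.2 → ¬ OnCurves D.edge D.verts E₀ z)
    (hlink : ∀ v ∈ D.verts, Links D.edge D.verts B L v ρ) {k : ℕ}
    (hk : ∀ j ∈ F, {p ∈ D.crossings | p.2.1 = j ∧ p.1.1 ∈ B}.ncard ≤ k)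
    (hcard : n ^ 2 * (3 ^ (n + 1)) ^ 2 * PTree.genBound n ^ k < F.card) :
    ∃ i j, i ≠ j ∧ HomotopicIn D.V (D.f i) (D.f j) := by
  classical
  set X : Set ℂ := {z | (∃ e ∈ B, ∃ s, D.f e s = z) ∧ ∃ j ∈ F, ∃ t, D.f j t = z} with hX
  have hXfin : (X \ D.V).Finite := by
    refine (hS.image fun p => D.f p.1.1 p.1.2).subset ?_
    rintro z ⟨⟨⟨e, he, s, rfl⟩, j, hj, t, h⟩, hz⟩
    refine ⟨((e, s), (j, t)), mem_crossings ?_ h.symm hz, rfl⟩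
    intro h'
    obtain rfl : e = j := congrArg Prod.fst h'
    exact Finset.disjoint_left.1 hBF he hj
  set Q : Finset ℂ := L.image Prod.fst ∪ (L.image Prod.snd ∪ {ρ}) with hQ
  have hQB : ∀ z ∈ Q, OnCurves D.edge D.verts B z := by
    intro z hz
    simp only [hQ, Finset.mem_union, Finset.mem_image, Finset.mem_singleton] at hz
    rcases hz with ⟨p, hp, rfl⟩ | ⟨p, hp, rfl⟩ | rfl
    · exact (hL p hp).1
    · exact (hL p hp).2.1
    · exact hρB
  set P : Finset ℂ := D.verts ∪ (hXfin.toFinset ∪ Q) with hP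
  have hPmem : ∀ z, z ∈ P ↔ z ∈ D.V ∨ z ∈ X ∨ z ∈ Q := by
    intro z
    simp only [hP, Finset.mem_union, mem_verts, Set.Finite.mem_toFinset, Set.mem_sdiff]
    tauto
  have hPB : ∀ z ∈ P, OnCurves D.edge D.verts B z := by
    intro z hz
    rcases (hPmem z).1 hz with h | h | h
    · exact Or.inl (mem_verts.2 h)
    · exact Or.inr h.1
    · exact hQB z h
  have hVP : D.verts ⊆ P := Finset.subset_union_left
  have hρP : ρ ∈ P := (hPmem ρ).2 (Or.inr (Or.inr (by simp [hQ])))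
  have hL1 : ∀ p ∈ L, p.1 ∈ P := fun p hp =>
    (hPmem _).2 (Or.inr (Or.inr (Finset.mem_union_left _ (Finset.mem_image_of_mem _ hp))))
  have hL2 : ∀ p ∈ L, p.2 ∈ P := fun p hp =>
    (hPmem _).2 (Or.inr (Or.inr (Finset.mem_union_right _ (Finset.mem_union_left _ (Finset.mem_image_of_mem _ hp)))))
  have hE₀re : ∀ e ∈ E₀, ∀ t, (D.edge e t).re ≤ ρ.re := fun e he t => hmax _ (Or.inr ⟨e, he, t, rfl⟩)
  let seg : ℂ × ℂ → C(I, ℂ) := fun p => ⟨fun t => AffineMap.lineMap p.1 p.2 (t : ℝ), by fun_prop⟩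
  have hseg : ∀ p t, seg p t = AffineMap.lineMap p.1 p.2 (t : ℝ) := fun _ _ => rfl
  have hsegm : ∀ p t, seg p t ∈ segment ℝ p.1 p.2 := fun p t => by
    rw [segment_eq_image_lineMap]
    exact ⟨t, t.2, rfl⟩
  let A : {e // e ∈ B} ⊕ {p // p ∈ L.filter fun p => p.1 ≠ p.2} → C(I, ℂ) :=
    Sum.elim (fun e => D.edge e) (fun p => seg p)
  have hfin := fun e => finite_preimage hS e (P := (P : Set ℂ)) P.finite_toSet
  suffices H : ∃ i j : {j // j ∈ F}, i ≠ j ∧ HomotopicIn D.verts (D.edge i) (D.edge j) by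
    obtain ⟨i, j, hij, h⟩ := H
    refine ⟨i, j, fun h => hij (Subtype.ext h), ?_⟩
    rw [verts, Set.Finite.coe_toFinset] at h
    exact h
  refine exists_homotopicIn hVP hρP (fun p hp => hmax p ((hPB p hp).mono hB)) A
    (fun j : {j // j ∈ F} => D.edge j) (k := k) ?_ ?_ ?_ ?_ ?_ ?_ ?_ ?_ ?_ ?_ ?_ ?_ ?_
  · rintro (e | ⟨p, hp⟩)
    · exact hVP (mem_verts.2 (D.source_mem e))
    · change seg p 0 ∈ P
      simpa [hseg] using hL1 p (Finset.mem_filter.1 hp).1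
  · rintro (e | ⟨p, hp⟩)
    · exact hVP (mem_verts.2 (D.target_mem e))
    · change seg p 1 ∈ P
      simpa [hseg] using hL2 p (Finset.mem_filter.1 hp).1
  · rintro (e | ⟨p, hp⟩)
    · exact hfin e
    · refine P.finite_toSet.preimage (f := seg p) (Function.Injective.injOn fun s t hst => ?_)
      exact Subtype.ext (AffineMap.lineMap_injective ℝ (Finset.mem_filter.1 hp).2 hst)
  · exact fun j => mem_verts.2 (D.source_mem j)
  · exact fun j => mem_verts.2 (D.target_mem j)
  · exact fun j => hfin j
  · exact fun j t h0 h1 h => D.interior_not_mem j t h0 h1 (mem_verts.1 h)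
  · rintro ⟨j, hj⟩
    refine le_trans ?_ (hk j hj)
    refine (Set.ncard_le_ncard (t := (fun p => p.2.2) '' {p ∈ D.crossings | p.2.1 = j ∧ p.1.1 ∈ B}) ?_
      ((hS.subset (Set.sep_subset _ _)).image _)).trans (Set.ncard_image_le (hS.subset (Set.sep_subset _ _)))
    rintro t ⟨h0, h1, ht⟩
    have hjV := D.interior_not_mem j t h0 h1
    rcases hPB _ ht with h | ⟨e, he, s, h⟩
    · exact absurd (mem_verts.1 h) hjV
    · have h : D.f e s = D.f j t := h
      refine ⟨((e, s), (j, t)), ⟨mem_crossings ?_ h (by rwa [h]), rfl, he⟩, rfl⟩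
      intro h'
      obtain rfl : e = j := congrArg Prod.fst h'
      exact Finset.disjoint_left.1 hBF he hj
  · rintro (⟨e, he⟩ | ⟨p, hp⟩) t
    · exact hE₀re e (hB he) t
    · obtain ⟨h1, h2, -⟩ := hL p (Finset.mem_filter.1 hp).1
      exact (convex_halfSpace_re_le ρ.re).segment_subset (hmax _ (h1.mono hB)) (hmax _ (h2.mono hB)) (hsegm p t)
  · exact fun j t => hE₀re j (hF j.2) t
  · rintro (⟨e, he⟩ | ⟨p, hp⟩) ⟨j, hj⟩ s t hst
    · exact (hPmem _).2 (Or.inr (Or.inl ⟨⟨e, he, s, rfl⟩, j, hj, t, hst.symm⟩))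
    · have hp := (Finset.mem_filter.1 hp).1
      change seg p s ∈ P
      change seg p s = D.edge j t at hst
      by_cases h1 : seg p s = p.1
      · rw [h1]
        exact hL1 p hp
      by_cases h2 : seg p s = p.2
      · rw [h2]
        exact hL2 p hp
      · exact absurd (Or.inr ⟨j, hF hj, t, hst.symm⟩) ((hL p hp).2.2 _ (hsegm p s) h1 h2)
  · intro E hE hA v hv
    refine hlink v hv (P : Set ℂ) (Finset.coe_subset.2 hVP) (hVP hv) hρP (fun p hp => ⟨hL1 p hp, hL2 p hp⟩) E hE ?_ ?_
    · exact fun e he s t hs ht => hA (Sum.inl ⟨e, he⟩) s t hs ht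
    · intro p hp
      by_cases hpp : p.1 = p.2
      · rw [hpp]
        exact hE.refl _
      · have e0 : seg p 0 = p.1 := by simp [hseg]
        have e1 : seg p 1 = p.2 := by simp [hseg]
        have := hA (Sum.inr ⟨p, Finset.mem_filter.2 ⟨hp, hpp⟩⟩) 0 1 (e0.symm ▸ hL1 p hp : seg p 0 ∈ P)
          (e1.symm ▸ hL2 p hp : seg p 1 ∈ P)
        change E (seg p 0) (seg p 1) at this
        rwa [e0, e1] at this
  · rw [card_verts, Fintype.card_coe]
    exact hcard

end PlaneDrawing

/-- For fixed `n ≥ 2`, the minimum crossing number of a non-homotopic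
drawing with `n` vertices and `m` edges is super-quadratic in `m`. -/
theorem crossing_number_superquadratic (n : ℕ) (hn : 2 ≤ n) (C : ℝ) (hC : 0 < C) :
    ∃ M : ℕ, ∀ m : ℕ, M ≤ m → ∀ D : PlaneDrawing n m, D.NonHomotopic →
      ENNReal.ofReal (C * (m : ℝ) ^ 2) ≤ D.crossingNumber := by
  classical
  set k := ⌈32 * n * C⌉₊
  set N := n ^ 2 * (3 ^ (n + 1)) ^ 2 * PTree.genBound n ^ k with hN
  refine ⟨4 * (N + 2 * n + 1), fun m hm D hD => ?_⟩
  by_contra! hlt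
  have hm0 : (0 : ℝ) < m := by
    have : 0 < m := by omega
    exact_mod_cast this
  have hlt' : (D.crossings.encard : ℝ≥0∞) < ENNReal.ofReal (2 * C * (m : ℝ) ^ 2) := by
    have h : (D.crossings.encard : ℝ≥0∞) / 2 < ENNReal.ofReal (C * (m : ℝ) ^ 2) := hlt
    rw [ENNReal.div_lt_iff (by simp) (by simp)] at h
    rwa [show 2 * C * (m : ℝ) ^ 2 = C * (m : ℝ) ^ 2 * 2 by ring, ENNReal.ofReal_mul (by positivity),
      ENNReal.ofReal_ofNat]
  have hS : D.crossings.Finite := by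
    rw [← Set.encard_ne_top_iff]
    intro h
    rw [h] at hlt'
    simp at hlt'
  set S := hS.toFinset with hSdef
  have hScard : (S.card : ℝ) < 2 * C * (m : ℝ) ^ 2 := by
    rw [hS.encard_eq_coe_toFinset_card] at hlt'
    have := (ENNReal.lt_ofReal_iff_toReal_lt (by simp)).1 hlt'
    simpa using this
  set E₀ : Finset (Fin m) := Finset.univ.filter fun e => ((S.filter (·.1.1 = e)).card : ℝ) ≤ 4 * C * m with hE₀
  have hE₀card : (m : ℝ) / 2 ≤ E₀.card := by
    have h1 := card_filter_lt_card_fiber_mul_le (k := 4 * C * m) S (·.1.1) E₀ᶜ fun e he => by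
      simp only [hE₀, Finset.mem_compl, Finset.mem_filter, Finset.mem_univ, true_and, not_le] at he
      exact he.le
    have h2 : (E₀.card : ℝ) + E₀ᶜ.card = m := by
      exact_mod_cast (Finset.card_add_card_compl E₀).trans (Fintype.card_fin m)
    have h3 : (E₀ᶜ.card : ℝ) * (4 * C * m) < (m / 2) * (4 * C * m) := by
      calc _ ≤ _ := h1
        _ < _ := hScard
        _ = _ := by ring
    have := lt_of_mul_lt_mul_right h3 (by positivity)
    linarith
  obtain ⟨B, hB, hBc, L, ρ, hρ, -, hmax, hL, hlink⟩ := exists_skeleton (γ := D.edge) (V := D.verts)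
    (Finset.card_pos.1 (by rw [PlaneDrawing.card_verts]; omega)) E₀
    (fun e => PlaneDrawing.mem_verts.2 (D.source_mem e)) (fun e => PlaneDrawing.mem_verts.2 (D.target_mem e))
  rw [PlaneDrawing.card_verts] at hBc
  set T := S.filter (·.1.1 ∈ B) with hT
  have hTc : (T.card : ℝ) ≤ 8 * n * C * m := by
    have h1 := card_filter_mem_le (k := 4 * C * m) S (·.1.1) B fun e he => (Finset.mem_filter.1 (hB he)).2
    have h2 : (B.card : ℝ) ≤ 2 * n := by exact_mod_cast hBc
    calc _ ≤ _ := h1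
      _ ≤ 2 * n * (4 * C * m) := by gcongr
      _ = _ := by ring
  set G : Finset (Fin m) := Finset.univ.filter fun j => ((T.filter (·.2.1 = j)).card : ℝ) ≤ k with hG
  have hGc : (Gᶜ.card : ℝ) ≤ m / 4 := by
    have h1 := card_filter_lt_card_fiber_mul_le (k := 32 * n * C) T (·.2.1) Gᶜ fun e he => by
      simp only [hG, Finset.mem_compl, Finset.mem_filter, Finset.mem_univ, true_and, not_le] at he
      exact (Nat.le_ceil _).trans he.le
    have hn0 : (0 : ℝ) < n := by
      have : 0 < n := by omega
      exact_mod_cast this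
    have h3 : (Gᶜ.card : ℝ) * (32 * n * C) ≤ (m / 4) * (32 * n * C) := by
      calc _ ≤ _ := h1
        _ ≤ _ := hTc
        _ = _ := by ring
    exact le_of_mul_le_mul_right h3 (by positivity)
  set F := (E₀ \ Gᶜ) \ B with hF
  have hFc : N < F.card := by
    have h1 := Finset.le_card_sdiff Gᶜ E₀
    have h2 := Finset.le_card_sdiff B (E₀ \ Gᶜ)
    rw [← hF] at h2
    have h3 : E₀.card ≤ F.card + B.card + Gᶜ.card := by omega
    have h3' : (E₀.card : ℝ) ≤ F.card + 2 * n + Gᶜ.card := by exact_mod_cast h3.trans (by omega)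
    have hm' : (4 * (N + 2 * n + 1) : ℝ) ≤ m := by exact_mod_cast hm
    have : (N : ℝ) < F.card := by linarith
    exact_mod_cast this
  have hk : ∀ j ∈ F, {p ∈ D.crossings | p.2.1 = j ∧ p.1.1 ∈ B}.ncard ≤ k := by
    intro j hj
    have hjG : j ∈ G := by
      by_contra hj'
      exact (Finset.mem_sdiff.1 (Finset.mem_sdiff.1 hj).1).2 (Finset.mem_compl.2 hj')
    have hc : (T.filter (·.2.1 = j)).card ≤ k := by exact_mod_cast (Finset.mem_filter.1 hjG).2
    refine le_of_eq_of_le ?_ hc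
    rw [← Set.ncard_coe_finset]
    congr 1
    ext p
    simp [hT, hSdef]
    tauto
  obtain ⟨i, j, hij, h⟩ := PlaneDrawing.exists_homotopicIn_of_skeleton hS hB
    (Finset.sdiff_subset.trans Finset.sdiff_subset : F ⊆ E₀) Finset.disjoint_sdiff hρ hmax hL hlink hk hFc
  exact hD.1 i j hij (Or.inl h)
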